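/- Suppose k, h are integers with k ≥ 60 and 0.9k ≤ h ≤ k−2, and set t = k − h + 1. Suppose s is an integer with 2t ≤ s ≤ ⌊h/2⌋ · t, and P, D, η are real numbers with D ≥ 10, P ≥ exp(Dk²), 2/k³ < η ≤ 1/(2k), and 18/k ≤ 4·log k / (Dk²η) ≤ 0.4. Then J_{s,k,h}(C(P, P^η)) ≤ e^C · P^{2s − (t/2)(h+k) + t(t−1)/2 + ηs²/(2t) + ht·exp(−s/(ht))}, where C = s²/t + 10.5·t·(log k)²/(Dkη²) − s·( (1/η + h)·(1 − 1/h)^{s/t} − h )·log(1/(10η)). -/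

import Mathlib

/-- `JvIncomplete s k h B` is `J_{s,k,h}(B)`: the number of `2s`-tuples
`(x₁,…,x_s,y₁,…,y_s)` with all `xᵢ, yᵢ ∈ B` satisfying
`∑ᵢ (xᵢ^j − yᵢ^j) = 0` for every `h ≤ j ≤ k`. -/
noncomputable def JvIncomplete (s k h : ℕ) (B : Set ℕ) : ℕ :=
  Nat.card {xy : (Fin s → ℕ) × (Fin s → ℕ) //
    (∀ i, xy.1 i ∈ B ∧ xy.2 i ∈ B) ∧
    ∀ j, h ≤ j → j ≤ k → (∑ i, ((xy.1 i : ℤ) ^ j - (xy.2 i : ℤ) ^ j)) = 0}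

/-- `CPR P R` is the set `C(P,R)` of positive integers `n ≤ P` all of whose prime
factors `p` satisfy `√R < p ≤ R`. -/
noncomputable def CPR (P R : ℝ) : Set ℕ :=
  {n | 1 ≤ n ∧ (n : ℝ) ≤ P ∧ ∀ p : ℕ, p.Prime → p ∣ n → Real.sqrt R < p ∧ (p : ℝ) ≤ R}

namespace IncompleteVinogradov
open Finset

/-- The primes in `(√R, R]`. -/
noncomputable def primesSqrtIoc (R : ℝ) : Finset ℕ :=
  (range (⌊R⌋₊ + 1)).filter fun p => p.Prime ∧ Real.sqrt R < p

lemma mem_primesSqrtIoc {R : ℝ} (hR : 0 ≤ R) {p : ℕ} :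
    p ∈ primesSqrtIoc R ↔ p.Prime ∧ Real.sqrt R < p ∧ (p : ℝ) ≤ R := by
  simp only [primesSqrtIoc, mem_filter, mem_range, Nat.lt_succ_iff, Nat.le_floor_iff hR]
  tauto

lemma theta_succ (n : ℕ) : Chebyshev.theta ((n + 1 : ℕ) : ℝ) =
    Chebyshev.theta n + if (n + 1).Prime then Real.log ((n + 1 : ℕ) : ℝ) else 0 := by
  rw [Chebyshev.theta_eq_sum_Icc, Chebyshev.theta_eq_sum_Icc, Nat.floor_natCast,
    Nat.floor_natCast, Finset.sum_filter, Finset.sum_filter,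
    Finset.sum_Icc_succ_top (Nat.zero_le _)]

lemma sum_primes_inv_le_aux (a : ℕ) (ha : 2 ≤ a) (n : ℕ) (hn : a ≤ n) :
    ∑ p ∈ (Ioc a n).filter Nat.Prime, (1 : ℝ) / p +
      (Real.log 4 * n - Chebyshev.theta n) / (n * Real.log n) ≤
    Real.log 4 / Real.log a +
      Real.log 4 * (Real.log (Real.log n) - Real.log (Real.log a)) := by
  induction n, hn using Nat.le_induction with
  | base =>
    have h1 : 0 < Real.log a := Real.log_pos (by exact_mod_cast ha)
    have h2 : (0 : ℝ) < a := by positivity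
    simp only [Ioc_self, filter_empty, sum_empty, zero_add, sub_self, mul_zero, add_zero]
    rw [div_le_div_iff₀ (by positivity) h1]
    have := Chebyshev.theta_nonneg (a : ℝ)
    nlinarith [mul_nonneg this h1.le]
  | succ n hn ih =>
    have hn2 : (2 : ℝ) ≤ n := by exact_mod_cast ha.trans hn
    have hu : 0 < Real.log n := Real.log_pos (by linarith)
    have huv : Real.log n ≤ Real.log ((n + 1 : ℕ) : ℝ) :=
      Real.log_le_log (by linarith) (by push_cast; linarith)
    have hv : 0 < Real.log ((n + 1 : ℕ) : ℝ) := hu.trans_le huv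
    have h4 : 0 < Real.log 4 := Real.log_pos (by norm_num)
    have hth : 0 ≤ Real.log 4 * n - Chebyshev.theta n :=
      sub_nonneg.2 (Chebyshev.theta_le_log4_mul_x (by linarith))
    have hN : (0 : ℝ) < ((n + 1 : ℕ) : ℝ) := by positivity
    have key1 : (Real.log 4 * n - Chebyshev.theta n) /
        (((n + 1 : ℕ) : ℝ) * Real.log ((n + 1 : ℕ) : ℝ))
        ≤ (Real.log 4 * n - Chebyshev.theta n) / (n * Real.log n) := by
      apply div_le_div_of_nonneg_left hth (by positivity)
      apply mul_le_mul _ huv hu.le hN.le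
      push_cast; linarith
    have key2 : 1 / (((n + 1 : ℕ) : ℝ) * Real.log ((n + 1 : ℕ) : ℝ)) ≤
        Real.log (Real.log ((n + 1 : ℕ) : ℝ)) - Real.log (Real.log n) := by
      have e1 : Real.log (Real.log ((n + 1 : ℕ) : ℝ)) - Real.log (Real.log n)
        = - Real.log (Real.log n / Real.log ((n + 1 : ℕ) : ℝ)) := by
        rw [Real.log_div hu.ne' hv.ne']; ring
      have e2 := Real.log_le_sub_one_of_pos (div_pos hu hv)
      have e3 : 1 / ((n + 1 : ℕ) : ℝ) ≤ Real.log ((n + 1 : ℕ) : ℝ) - Real.log n := by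
        have := Real.log_le_sub_one_of_pos (div_pos (by linarith : (0 : ℝ) < n) hN)
        rw [Real.log_div (by linarith) hN.ne'] at this
        have e5 : (n : ℝ) / ((n + 1 : ℕ) : ℝ) = 1 - 1 / ((n + 1 : ℕ) : ℝ) := by
          field_simp; push_cast; ring
        linarith
      have e4 : 1 / (((n + 1 : ℕ) : ℝ) * Real.log ((n + 1 : ℕ) : ℝ)) ≤
          1 - Real.log n / Real.log ((n + 1 : ℕ) : ℝ) := by
        rw [← div_div, div_le_iff₀ hv, sub_mul, div_mul_cancel₀ _ hv.ne']
        linarith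
      linarith
    have key3 : (∑ p ∈ (Ioc a (n + 1)).filter Nat.Prime, (1 : ℝ) / p) =
        ∑ p ∈ (Ioc a n).filter Nat.Prime, (1 : ℝ) / p +
          if (n + 1).Prime then 1 / ((n + 1 : ℕ) : ℝ) else 0 := by
      rw [Finset.sum_filter, Finset.sum_filter, Finset.sum_Ioc_succ_top hn]
    have key4 : (Real.log 4 * ((n + 1 : ℕ) : ℝ) - Chebyshev.theta ((n + 1 : ℕ) : ℝ)) /
          (((n + 1 : ℕ) : ℝ) * Real.log ((n + 1 : ℕ) : ℝ)) +
          (if (n + 1).Prime then 1 / ((n + 1 : ℕ) : ℝ) else 0) =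
        (Real.log 4 * n - Chebyshev.theta n) / (((n + 1 : ℕ) : ℝ) * Real.log ((n + 1 : ℕ) : ℝ)) +
        Real.log 4 * (1 / (((n + 1 : ℕ) : ℝ) * Real.log ((n + 1 : ℕ) : ℝ))) := by
      rw [theta_succ]
      have h5 : ((n + 1 : ℕ) : ℝ) = (n : ℝ) + 1 := by push_cast; ring
      split_ifs
      · field_simp
        rw [h5]; ring
      · field_simp
        rw [h5]; ring
    rw [key3]
    have := mul_le_mul_of_nonneg_left key2 h4.le
    linarith

/-- Upper bound for the sum of the reciprocals of the primes in `(√R, R]`. -/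
lemma sum_primesSqrtIoc_inv_le {R : ℝ} (hR0 : 0 < R) (hR : 40 ≤ Real.log R) :
    ∑ p ∈ primesSqrtIoc R, (1 : ℝ) / p ≤ 1.1 := by
  set ρ := Real.log R with hρ
  have hsq : Real.log (Real.sqrt R) = ρ / 2 := by rw [Real.log_sqrt hR0.le]
  set a := ⌊Real.sqrt R⌋₊ with ha
  have hs0 : 0 < Real.sqrt R := Real.sqrt_pos.2 hR0
  have hsbig : 21 ≤ Real.sqrt R := by
    have := Real.add_one_le_exp (ρ / 2)
    rw [← hsq, Real.exp_log hs0, hsq] at this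
    linarith
  have hal : Real.sqrt R - 1 < a := by
    have := Nat.lt_floor_add_one (Real.sqrt R); linarith
  have ha2 : 2 ≤ a := Nat.le_floor (by push_cast; linarith)
  have ha0 : (0 : ℝ) < a := by positivity
  have hla : 0.49 * ρ ≤ Real.log a := by
    have h1 : Real.sqrt R / 1.1 ≤ a := by
      rw [div_le_iff₀ (by norm_num)]; linarith
    have h2 := Real.log_le_log (by positivity) h1
    rw [Real.log_div hs0.ne' (by norm_num), hsq] at h2
    have h3 := Real.log_le_sub_one_of_pos (show (0 : ℝ) < 1.1 by norm_num)
    linarith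
  set b := ⌊R⌋₊ with hb
  have hab : a ≤ b := by
    apply Nat.floor_mono
    rw [Real.sqrt_le_left hR0.le]
    have := Real.add_one_le_exp ρ
    rw [hρ, Real.exp_log hR0] at this
    nlinarith
  have hb0 : (0 : ℝ) < b := by
    have : 0 < b := by omega
    exact_mod_cast this
  have hlb : Real.log b ≤ ρ := Real.log_le_log hb0 (Nat.floor_le hR0.le)
  have hla0 : 0 < Real.log a := by linarith
  have hlb0 : 0 < Real.log b := hla0.trans_le (Real.log_le_log ha0 (by exact_mod_cast hab))
  have hmain := sum_primes_inv_le_aux a ha2 b hab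
  have hset : primesSqrtIoc R ⊆ (Ioc a b).filter Nat.Prime := by
    intro p hp
    rw [mem_primesSqrtIoc hR0.le] at hp
    simp only [mem_filter, mem_Ioc]
    refine ⟨⟨?_, Nat.le_floor hp.2.2⟩, hp.1⟩
    exact (Nat.floor_lt hs0.le).2 hp.2.1
  have h1 : ∑ p ∈ primesSqrtIoc R, (1 : ℝ) / p ≤ ∑ p ∈ (Ioc a b).filter Nat.Prime, (1 : ℝ) / p :=
    Finset.sum_le_sum_of_subset_of_nonneg hset fun _ _ _ => by positivity
  have h2 : 0 ≤ (Real.log 4 * b - Chebyshev.theta b) / (b * Real.log b) :=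
    div_nonneg (sub_nonneg.2 (Chebyshev.theta_le_log4_mul_x hb0.le)) (by positivity)
  have h4 : Real.log 4 ≤ 1.3864 := by
    have : (4 : ℝ) = 2 ^ 2 := by norm_num
    rw [this, Real.log_pow]; have := Real.log_two_lt_d9; push_cast; linarith
  have h40 : 0 < Real.log 4 := Real.log_pos (by norm_num)
  have h5 : Real.log (Real.log b) - Real.log (Real.log a) ≤ 0.72 := by
    have h6 : Real.log (Real.log b) ≤ Real.log ρ := Real.log_le_log hlb0 hlb
    have h7 : Real.log (0.49 * ρ) ≤ Real.log (Real.log a) :=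
      Real.log_le_log (by linarith) hla
    rw [Real.log_mul (by norm_num) (by linarith)] at h7
    have h8 : -0.72 ≤ Real.log 0.49 := by
      have e : (0.49 : ℝ) = 2⁻¹ * 0.98 := by norm_num
      rw [e, Real.log_mul (by norm_num) (by norm_num), Real.log_inv]
      have := Real.log_two_lt_d9
      have := Real.one_sub_inv_le_log_of_pos (show (0 : ℝ) < 0.98 by norm_num)
      norm_num at *
      linarith
    linarith
  have h6 : Real.log 4 / Real.log a ≤ 0.071 := by
    rw [div_le_iff₀ hla0]; nlinarith
  nlinarith

open scoped Classical in
/-- The finite set `C(Q, R)`. -/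
noncomputable def smoothSet (Q R : ℝ) : Finset ℕ :=
  (Icc 1 ⌊Q⌋₊).filter fun n => ∀ p : ℕ, p.Prime → p ∣ n → Real.sqrt R < p ∧ (p : ℝ) ≤ R

lemma mem_smoothSet {Q R : ℝ} {n : ℕ} : n ∈ smoothSet Q R ↔ 1 ≤ n ∧ (n : ℝ) ≤ Q ∧
    ∀ p : ℕ, p.Prime → p ∣ n → Real.sqrt R < p ∧ (p : ℝ) ≤ R := by
  classical
  simp only [smoothSet, mem_filter, mem_Icc]
  constructor
  · rintro ⟨⟨h1, h2⟩, h3⟩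
    exact ⟨h1, (Nat.le_floor_iff' (by omega)).1 h2, h3⟩
  · rintro ⟨h1, h2, h3⟩
    exact ⟨⟨h1, Nat.le_floor h2⟩, h3⟩

/-- A finite sum of a completely multiplicative function over numbers composed of primes of `T`
is at most the Euler product. -/
lemma sum_le_prod_inv_one_sub (T A : Finset ℕ) (f : ℕ →* ℝ) (hf0 : ∀ n, 0 ≤ f n)
    (hf1 : ∀ {p : ℕ}, p.Prime → f p < 1) (hT : ∀ p ∈ T, p.Prime)
    (hA : ∀ n ∈ A, n ∈ Nat.factoredNumbers T) :
    ∑ n ∈ A, f n ≤ ∏ p ∈ T, (1 - f p)⁻¹ := by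
  have h := EulerProduct.summable_and_hasSum_factoredNumbers_prod_filter_prime_geometric (f := f)
    (fun {p} hp => by rw [Real.norm_of_nonneg (hf0 p)]; exact hf1 hp) T
  rw [Finset.filter_true_of_mem hT] at h
  have h2 := sum_le_hasSum (A.attach.map ⟨fun n => (⟨n.1, hA n.1 n.2⟩ : Nat.factoredNumbers T),
    fun x y hxy => Subtype.ext (by simpa using hxy)⟩) (fun i _ => hf0 _) h.2
  rw [Finset.sum_map] at h2
  exact (Finset.sum_attach A (fun n => f n)).symm.le.trans h2

/-- `n ↦ n ^ (-σ)` as a monoid homomorphism. -/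
noncomputable def rpowNegHom (σ : ℝ) : ℕ →* ℝ where
  toFun n := (n : ℝ) ^ (-σ)
  map_one' := by simp
  map_mul' m n := by
    push_cast
    exact Real.mul_rpow (Nat.cast_nonneg _) (Nat.cast_nonneg _)

lemma mem_factoredNumbers_of_mem_smoothSet {Q R : ℝ} (hR : 0 ≤ R) {n : ℕ}
    (hn : n ∈ smoothSet Q R) : n ∈ Nat.factoredNumbers (primesSqrtIoc R) := by
  rw [mem_smoothSet] at hn
  rw [Nat.mem_factoredNumbers]
  refine ⟨by omega, fun p hp => ?_⟩
  have hp' := Nat.prime_of_mem_primeFactorsList hp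
  have := hn.2.2 p hp' (Nat.dvd_of_mem_primeFactorsList hp)
  exact (mem_primesSqrtIoc hR).2 ⟨hp', this⟩

lemma inv_one_sub_le_exp {x : ℝ} (hx0 : 0 ≤ x) (hx : 101 * x ≤ 1) :
    (1 - x)⁻¹ ≤ Real.exp (1.01 * x) := by
  have h1 : 0 < 1 - x := by linarith
  have h2 := Real.add_one_le_exp (1.01 * x)
  refine le_trans ?_ h2
  rw [inv_le_iff_one_le_mul₀ h1]
  nlinarith

lemma sum_smoothSet_rpow_le {Q R ε : ℝ} (hR0 : 0 < R) (hR : 40 ≤ Real.log R) (hε0 : 0 ≤ ε)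
    (hε1 : ε < 1) (hRε : 101 * R ^ ε ≤ Real.sqrt R) :
    ∑ n ∈ smoothSet Q R, (n : ℝ) ^ (-(1 - ε)) ≤ Real.exp (1.12 * R ^ ε) := by
  have hs0 : 0 < Real.sqrt R := Real.sqrt_pos.2 hR0
  have h1 := sum_le_prod_inv_one_sub (primesSqrtIoc R) (smoothSet Q R) (rpowNegHom (1 - ε))
    (fun n => Real.rpow_nonneg (Nat.cast_nonneg _) _) (fun {p} hp => by
      apply Real.rpow_lt_one_of_one_lt_of_neg
      · exact_mod_cast hp.one_lt
      · linarith)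
    (fun p hp => ((mem_primesSqrtIoc hR0.le).1 hp).1)
    (fun n hn => mem_factoredNumbers_of_mem_smoothSet hR0.le hn)
  refine h1.trans ?_
  have hRpos : 0 < R ^ ε := Real.rpow_pos_of_pos hR0 _
  have h2 : ∀ p ∈ primesSqrtIoc R, (1 - rpowNegHom (1 - ε) p)⁻¹ ≤
      Real.exp (1.01 * R ^ ε * (1 / p)) := by
    intro p hp
    rw [mem_primesSqrtIoc hR0.le] at hp
    have hp0 : (0 : ℝ) < p := by exact_mod_cast hp.1.pos
    have hle : rpowNegHom (1 - ε) p ≤ R ^ ε * (1 / p) := by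
      change (p : ℝ) ^ (-(1 - ε)) ≤ _
      rw [show -(1 - ε) = ε + (-1) by ring, Real.rpow_add hp0, Real.rpow_neg_one, one_div]
      exact mul_le_mul_of_nonneg_right (Real.rpow_le_rpow hp0.le hp.2.2 hε0) (by positivity)
    have hnn : 0 ≤ rpowNegHom (1 - ε) p := Real.rpow_nonneg hp0.le _
    have hb : 101 * (R ^ ε * (1 / p)) ≤ 1 := by
      rw [← mul_assoc, mul_one_div, div_le_one hp0]
      exact hRε.trans hp.2.1.le
    refine (inv_one_sub_le_exp hnn (by linarith)).trans ?_
    apply Real.exp_le_exp.2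
    nlinarith
  refine (Finset.prod_le_prod (fun p hp => ?_) h2).trans ?_
  · rw [mem_primesSqrtIoc hR0.le] at hp
    apply inv_nonneg.2
    have : rpowNegHom (1 - ε) p < 1 := by
      apply Real.rpow_lt_one_of_one_lt_of_neg
      · exact_mod_cast hp.1.one_lt
      · linarith
    linarith
  · rw [← Real.exp_sum, ← Finset.mul_sum]
    apply Real.exp_le_exp.2
    have := sum_primesSqrtIoc_inv_le hR0 hR
    nlinarith

/-- Rankin's bound for the cardinality of `C(Q, R)`. -/
lemma card_smoothSet_le {Q R ε : ℝ} (hQ : 0 < Q) (hR0 : 0 < R) (hR : 40 ≤ Real.log R)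
    (hε0 : 0 ≤ ε) (hε1 : ε < 1) (hRε : 101 * R ^ ε ≤ Real.sqrt R) :
    ((smoothSet Q R).card : ℝ) ≤ Real.exp (1.12 * R ^ ε) * Q ^ (1 - ε) := by
  have h := sum_smoothSet_rpow_le (Q := Q) hR0 hR hε0 hε1 hRε
  have hQp : 0 < Q ^ (1 - ε) := Real.rpow_pos_of_pos hQ _
  calc ((smoothSet Q R).card : ℝ) = ∑ n ∈ smoothSet Q R, (1 : ℝ) := by simp
    _ ≤ ∑ n ∈ smoothSet Q R, (n : ℝ) ^ (-(1 - ε)) * Q ^ (1 - ε) := by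
      apply Finset.sum_le_sum
      intro n hn
      rw [mem_smoothSet] at hn
      have hn0 : (0 : ℝ) < n := by exact_mod_cast hn.1
      rw [Real.rpow_neg hn0.le, inv_mul_eq_div, one_le_div (Real.rpow_pos_of_pos hn0 _)]
      exact Real.rpow_le_rpow hn0.le hn.2.1 (by linarith)
    _ ≤ _ := by
      rw [← Finset.sum_mul]
      exact mul_le_mul_of_nonneg_right h hQp.le

/-- Rankin's bound for a weighted sum over `C(Q, R)`. -/
lemma sum_smoothSet_rpow_neg_le {Q R δ : ℝ} (hQ : 0 < Q) (hR0 : 0 < R) (hR : 40 ≤ Real.log R)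
    (hδ : 0 ≤ δ) :
    ∑ n ∈ smoothSet Q R, (n : ℝ) ^ (-1 + δ) ≤ Real.exp 1.12 * Q ^ δ := by
  have h := sum_smoothSet_rpow_le (Q := Q) (ε := 0) hR0 hR le_rfl one_pos (by
    rw [Real.rpow_zero]
    have hsq : Real.log (Real.sqrt R) = Real.log R / 2 := by rw [Real.log_sqrt hR0.le]
    have hs0 : 0 < Real.sqrt R := Real.sqrt_pos.2 hR0
    have := Real.exp_le_exp.2 (show (20 : ℝ) ≤ Real.log (Real.sqrt R) by linarith)
    rw [Real.exp_log hs0] at this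
    refine le_trans ?_ this
    have e : Real.exp 20 = Real.exp 1 ^ 20 := by rw [← Real.exp_nat_mul]; norm_num
    rw [e]
    have h2 : (2 : ℝ) ≤ Real.exp 1 := by have := Real.exp_one_gt_d9; linarith
    calc (101 : ℝ) * 1 ≤ 2 ^ 20 := by norm_num
      _ ≤ _ := by gcongr)
  rw [Real.rpow_zero, mul_one] at h
  calc ∑ n ∈ smoothSet Q R, (n : ℝ) ^ (-1 + δ)
      ≤ ∑ n ∈ smoothSet Q R, (n : ℝ) ^ (-(1 - (0 : ℝ))) * Q ^ δ := by
        apply Finset.sum_le_sum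
        intro n hn
        rw [mem_smoothSet] at hn
        have hn0 : (0 : ℝ) < n := by exact_mod_cast hn.1
        rw [Real.rpow_add hn0, sub_zero]
        exact mul_le_mul_of_nonneg_left (Real.rpow_le_rpow hn0.le hn.2.1 hδ)
          (Real.rpow_nonneg hn0.le _)
    _ ≤ _ := by
      rw [← Finset.sum_mul]
      exact mul_le_mul_of_nonneg_right h (Real.rpow_nonneg hQ.le _)

section Jacobian
variable {K : Type*} [Field K] {t : ℕ}

/-- The Jacobian matrix of the power sums of exponents `h, …, h + t - 1`. -/
def powerSumJacobian (h : ℕ) (a : Fin t → K) : Matrix (Fin t) (Fin t) K :=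
  Matrix.of fun j i => ((h + j : ℕ) : K) * a i ^ (h + (j : ℕ) - 1)

lemma isUnit_det_powerSumJacobian (h : ℕ) (hh : 1 ≤ h)
    (hK : ∀ j : Fin t, ((h + j : ℕ) : K) ≠ 0)
    (a : Fin t → K) (ha : Function.Injective a) (ha0 : ∀ i, a i ≠ 0) :
    IsUnit (powerSumJacobian h a).det := by
  have e : powerSumJacobian h a = Matrix.of fun j i : Fin t => ((h + j : ℕ) : K) *
      (Matrix.of fun j i : Fin t =>
        a i ^ (h - 1) * ((Matrix.vandermonde a).transpose j i)) j i := by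
    ext j i
    simp only [powerSumJacobian, Matrix.of_apply, Matrix.transpose_apply, Matrix.vandermonde_apply]
    rw [← pow_add]
    congr 2; omega
  rw [e, Matrix.det_mul_column, Matrix.det_mul_row, Matrix.det_transpose]
  refine (mul_ne_zero (prod_ne_zero_iff.2 fun j _ => hK j)
    (mul_ne_zero (prod_ne_zero_iff.2 fun i _ => pow_ne_zero _ (ha0 i)) ?_)).isUnit
  exact Matrix.det_vandermonde_ne_zero_iff.2 ha

lemma exists_linear_forms (h : ℕ) (hh : 1 ≤ h) (hK : ∀ j : Fin t, ((h + j : ℕ) : K) ≠ 0)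
    (a : Fin t → K) (ha : Function.Injective a) (ha0 : ∀ i, a i ≠ 0) :
    ∃ l : Fin t → MvPolynomial (Fin t) K, ∀ j : Fin t,
      ∑ i, MvPolynomial.C (((h + j : ℕ) : K) * a i ^ (h + j - 1)) * l i = MvPolynomial.X j := by
  classical
  set L := powerSumJacobian h a
  have hdet : IsUnit L.det := isUnit_det_powerSumJacobian h hh hK a ha ha0
  refine ⟨fun i => ∑ j, MvPolynomial.C (L⁻¹ i j) * MvPolynomial.X j, fun j => ?_⟩
  have h1 : ∀ i, MvPolynomial.C (((h + j : ℕ) : K) * a i ^ (h + (j : ℕ) - 1)) *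
      ∑ j', MvPolynomial.C (L⁻¹ i j') * MvPolynomial.X j' =
      ∑ j', MvPolynomial.C (L j i * L⁻¹ i j') * (MvPolynomial.X j' : MvPolynomial (Fin t) K) := by
    intro i
    rw [Finset.mul_sum]
    refine Finset.sum_congr rfl fun j' _ => ?_
    rw [← mul_assoc, ← map_mul]; rfl
  simp only [h1]
  rw [Finset.sum_comm]
  have h2 : ∀ j', ∑ i, MvPolynomial.C (L j i * L⁻¹ i j') *
      (MvPolynomial.X j' : MvPolynomial (Fin t) K) =
      if j = j' then MvPolynomial.X j' else 0 := by
    intro j'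
    rw [← Finset.sum_mul, ← map_sum, ← Matrix.mul_apply, Matrix.mul_nonsing_inv _ hdet,
      Matrix.one_apply]
    split_ifs <;> simp
  rw [Finset.sum_congr rfl fun j' _ => h2 j']
  simp

/-- The `j`-th power-sum equation. -/
noncomputable def powerSumPoly (h : ℕ) (m : Fin t → K) (j : Fin t) : MvPolynomial (Fin t) K :=
  ∑ i, MvPolynomial.X i ^ (h + j : ℕ) - MvPolynomial.C (m j)

/-- Expansion around the point `a` in the directions `l`. -/
noncomputable def expandAt (a : Fin t → K) (l : Fin t → MvPolynomial (Fin t) K) :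
    MvPolynomial (Fin t) K →ₐ[K] Polynomial (MvPolynomial (Fin t) K) :=
  MvPolynomial.aeval fun i => Polynomial.C (MvPolynomial.C (a i)) +
    Polynomial.X * Polynomial.C (l i)

lemma coeff_zero_expandAt (a : Fin t → K) (l : Fin t → MvPolynomial (Fin t) K)
    (q : MvPolynomial (Fin t) K) :
    (expandAt a l q).coeff 0 = MvPolynomial.C (MvPolynomial.eval a q) := by
  induction q using MvPolynomial.induction_on with
  | C c =>
    rw [expandAt, MvPolynomial.aeval_C, MvPolynomial.eval_C, Polynomial.algebraMap_apply]
    simp [MvPolynomial.algebraMap_eq]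
  | add p q hp hq => simp [hp, hq]
  | mul_X p i hp =>
    rw [map_mul, Polynomial.mul_coeff_zero, hp]
    simp [expandAt]

lemma coeff_one_expandAt_powerSumPoly (h : ℕ) (m : Fin t → K)
    (a : Fin t → K) (l : Fin t → MvPolynomial (Fin t) K) (j : Fin t) :
    (expandAt a l (powerSumPoly h m j)).coeff 1 =
      ∑ i, MvPolynomial.C (((h + j : ℕ) : K) * a i ^ (h + j - 1)) * l i := by
  have h1 := Polynomial.coeff_derivative (expandAt a l (powerSumPoly h m j)) 0
  simp only [zero_add, Nat.cast_zero, mul_one] at h1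
  rw [← h1, Polynomial.coeff_zero_eq_eval_zero]
  have : ∀ c : K, expandAt a l (MvPolynomial.C c) = Polynomial.C (MvPolynomial.C c) := by
    intro c
    rw [expandAt, MvPolynomial.aeval_C, Polynomial.algebraMap_apply]; rfl
  simp only [powerSumPoly, map_sub, map_sum, map_pow, this, Polynomial.derivative_C, sub_zero]
  rw [Polynomial.eval_finsetSum]
  refine Finset.sum_congr rfl fun i _ => ?_
  simp [expandAt, Polynomial.derivative_pow]

lemma exists_expandAt_powerSumPoly (h : ℕ) (m : Fin t → K) (hh : 1 ≤ h)
    (hK : ∀ j : Fin t, ((h + j : ℕ) : K) ≠ 0) (a : Fin t → K) (ha : Function.Injective a)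
    (ha0 : ∀ i, a i ≠ 0) (hm : ∀ j : Fin t, ∑ i, a i ^ (h + j : ℕ) = m j) :
    ∃ l : Fin t → MvPolynomial (Fin t) K, ∀ j, ∃ g : Polynomial (MvPolynomial (Fin t) K),
      expandAt a l (powerSumPoly h m j) = Polynomial.X * g ∧ g.coeff 0 = MvPolynomial.X j := by
  obtain ⟨l, hl⟩ := exists_linear_forms h hh hK a ha ha0
  refine ⟨l, fun j => ?_⟩
  have h0 : (expandAt a l (powerSumPoly h m j)).coeff 0 = 0 := by
    rw [coeff_zero_expandAt]
    simp [powerSumPoly, hm]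
  obtain ⟨g, hg⟩ := Polynomial.X_dvd_iff.2 h0
  refine ⟨g, hg, ?_⟩
  have h1 := coeff_one_expandAt_powerSumPoly h m a l j
  rw [hl, hg, show 1 = 0 + 1 from rfl, Polynomial.coeff_X_mul] at h1
  exact h1

lemma degreeOf_powerSumPoly_le (h : ℕ) (m : Fin t → K) (j i : Fin t) :
    MvPolynomial.degreeOf i (powerSumPoly h m j) ≤ h + j := by
  classical
  refine (MvPolynomial.degreeOf_sub_le _ _ _).trans ?_
  rw [MvPolynomial.degreeOf_C]
  refine max_le ((MvPolynomial.degreeOf_sum_le _ _ _).trans ?_) (Nat.zero_le _)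
  refine Finset.sup_le fun i' _ => (MvPolynomial.degreeOf_pow_le _ _ _).trans ?_
  have : MvPolynomial.degreeOf i (MvPolynomial.X i' : MvPolynomial (Fin t) K) ≤ 1 := by
    rw [MvPolynomial.degreeOf_X]; split_ifs <;> omega
  nlinarith

end Jacobian

/-- The number of nonsingular solutions over `ZMod p` of a system of `t` power-sum
equations in `t` unknowns, of degrees at most `k`, is at most `(t k + 1) ^ t`. -/
lemma card_nonsingular_solutions_le {p t h k : ℕ} [Fact p.Prime] (hh : 1 ≤ h)
    (hk : ∀ j : Fin t, h + j ≤ k) (hp : k < p) (m : Fin t → ZMod p)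
    (A : Finset (Fin t → ZMod p))
    (hA : ∀ a ∈ A, Function.Injective a ∧ (∀ i, a i ≠ 0) ∧
      ∀ j : Fin t, ∑ i, a i ^ (h + j : ℕ) = m j) :
    A.card ≤ (t * k + 1) ^ t := by
  classical
  have hK : ∀ j : Fin t, ((h + j : ℕ) : ZMod p) ≠ 0 := by
    intro j
    rw [Ne, ZMod.natCast_eq_zero_iff]
    exact Nat.not_dvd_of_pos_of_lt (by omega) ((hk j).trans_lt hp)
  let v : A × (Fin t → Fin p) → MvPolynomial (Fin t) (ZMod p) := fun x =>
    MvPolynomial.indicator x.1.1 * ∏ j, powerSumPoly h m j ^ (x.2 j : ℕ)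
  have hp0 : 0 < p := (Fact.out : p.Prime).pos
  set M := (t * k + 1) * p with hM
  have hdeg : ∀ x i, MvPolynomial.degreeOf i (v x) < M := by
    intro x i
    have h1 : MvPolynomial.degreeOf i (MvPolynomial.indicator x.1.1) ≤ p - 1 := by
      have := (MvPolynomial.mem_restrictDegree_iff_sup _ _ _).1
        (MvPolynomial.indicator_mem_restrictDegree x.1.1) i
      rw [ZMod.card] at this
      rwa [MvPolynomial.degreeOf_def]
    have h2 : MvPolynomial.degreeOf i (∏ j, powerSumPoly h m j ^ (x.2 j : ℕ)) ≤
        ∑ j : Fin t, k * (p - 1) := by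
      refine (MvPolynomial.degreeOf_prod_le _ _ _).trans (Finset.sum_le_sum fun j _ => ?_)
      refine (MvPolynomial.degreeOf_pow_le _ _ _).trans ?_
      rw [mul_comm]
      exact Nat.mul_le_mul ((degreeOf_powerSumPoly_le h m j i).trans (hk j)) (by omega)
    have h3 := MvPolynomial.degreeOf_mul_le i (MvPolynomial.indicator x.1.1)
      (∏ j, powerSumPoly h m j ^ (x.2 j : ℕ))
    simp only [sum_const, card_univ, Fintype.card_fin, smul_eq_mul] at h2
    have h4 : t * (k * (p - 1)) + (p - 1) < M := by
      obtain ⟨q, rfl⟩ : ∃ q, p = q + 1 := ⟨p - 1, by omega⟩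
      simp only [Nat.add_sub_cancel]
      rw [hM]
      nlinarith [Nat.zero_le (t * k)]
    change MvPolynomial.degreeOf i (_ * _) < M
    omega
  have hli : LinearIndependent (ZMod p) v := by
    rw [Fintype.linearIndependent_iff]
    intro c hc
    by_contra! hne
    obtain ⟨x1, hx1⟩ := hne
    let supp := (Finset.univ : Finset (A × (Fin t → Fin p))).filter fun x => c x ≠ 0
    obtain ⟨x0, hx0, hmin⟩ := Finset.exists_min_image supp (fun x => ∑ j, (x.2 j : ℕ))
      ⟨x1, by simp [supp, hx1]⟩
    set b := ∑ j, (x0.2 j : ℕ) with hb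
    have hx0' : c x0 ≠ 0 := by simpa [supp] using hx0
    have hmin' : ∀ x, ∑ j, (x.2 j : ℕ) < b → c x = 0 := by
      intro x hx
      by_contra hcx
      have := hmin x (by simp [supp, hcx])
      omega
    obtain ⟨a0, β0⟩ := x0
    obtain ⟨l, hl⟩ := exists_expandAt_powerSumPoly h m hh hK a0.1 (hA _ a0.2).1 (hA _ a0.2).2.1
      (hA _ a0.2).2.2
    choose g hg1 hg0 using hl
    have hcoef : ∀ x, (expandAt a0.1 l (c x • v x)).coeff b =
        if x.1 = a0 then
          (if ∑ j, (x.2 j : ℕ) = b then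
            MvPolynomial.C (c x) * ∏ j, MvPolynomial.X j ^ (x.2 j : ℕ) else 0) else 0 := by
      intro x
      rcases lt_or_ge (∑ j, (x.2 j : ℕ)) b with hlt | hge
      · simp [hmin' x hlt]
      have e1 : expandAt a0.1 l (c x • v x) = c x • (Polynomial.X ^ (∑ j, (x.2 j : ℕ)) *
          (expandAt a0.1 l (MvPolynomial.indicator x.1.1) * ∏ j, g j ^ (x.2 j : ℕ))) := by
        rw [map_smul]
        congr 1
        simp only [v, map_mul, map_prod, map_pow, hg1, mul_pow, Finset.prod_mul_distrib,
          Finset.prod_pow_eq_pow_sum]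
        ring
      rw [e1, Polynomial.coeff_smul, Polynomial.coeff_X_pow_mul']
      rcases hge.lt_or_eq with hgt | heq
      · rw [if_neg (not_le.2 hgt), if_neg hgt.ne']; simp
      · rw [if_pos heq.symm.le, if_pos heq.symm, show ∑ j, (x.2 j : ℕ) = b from heq.symm,
          Nat.sub_self, Polynomial.mul_coeff_zero,
          coeff_zero_expandAt]
        have e2 : (∏ j, g j ^ (x.2 j : ℕ)).coeff 0 = ∏ j, MvPolynomial.X j ^ (x.2 j : ℕ) := by
          rw [Polynomial.coeff_zero_prod]
          refine Finset.prod_congr rfl fun j _ => ?_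
          rw [Polynomial.coeff_zero_eq_eval_zero, Polynomial.eval_pow,
            ← Polynomial.coeff_zero_eq_eval_zero, hg0]
        rw [e2]
        by_cases hxa : x.1 = a0
        · rw [if_pos hxa, hxa, MvPolynomial.eval_indicator_apply_eq_one]
          simp [MvPolynomial.smul_eq_C_mul]
        · rw [if_neg hxa, MvPolynomial.eval_indicator_apply_eq_zero]
          · simp
          · intro h'; exact hxa (Subtype.ext h'.symm)
    have hz := congrArg (fun q => (expandAt a0.1 l q).coeff b) hc
    simp only [map_sum, map_zero, Polynomial.coeff_zero, Polynomial.finsetSum_coeff] at hz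
    rw [Finset.sum_congr rfl fun x _ => hcoef x] at hz
    have hz2 := congrArg (MvPolynomial.coeff (Finsupp.equivFunOnFinite.symm
      fun j => (β0 j : ℕ))) hz
    rw [MvPolynomial.coeff_sum, Finset.sum_eq_single (a0, β0), if_pos rfl, if_pos hb.symm,
      MvPolynomial.coeff_C_mul, MvPolynomial.coeff_zero] at hz2
    · have e3 : (∏ j, (MvPolynomial.X j : MvPolynomial (Fin t) (ZMod p)) ^ (β0 j : ℕ)) =
          MvPolynomial.monomial (Finsupp.equivFunOnFinite.symm fun j => (β0 j : ℕ)) 1 := by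
        rw [MvPolynomial.monomial_eq, Finsupp.prod_fintype _ _ (by simp)]
        simp
      rw [e3, MvPolynomial.coeff_monomial, if_pos rfl, mul_one] at hz2
      exact hx0' hz2
    · intro x _ hx
      split_ifs with hxa hxb
      · have e3 : (∏ j, (MvPolynomial.X j : MvPolynomial (Fin t) (ZMod p)) ^ (x.2 j : ℕ)) =
          MvPolynomial.monomial (Finsupp.equivFunOnFinite.symm fun j => (x.2 j : ℕ)) 1 := by
          rw [MvPolynomial.monomial_eq, Finsupp.prod_fintype _ _ (by simp)]
          simp
        rw [MvPolynomial.coeff_C_mul, e3, MvPolynomial.coeff_monomial, if_neg, mul_zero]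
        intro h'
        apply hx
        refine Prod.ext hxa (funext fun j => Fin.ext ?_)
        have := DFunLike.congr_fun h' j
        simpa using this
      · simp
      · simp
    · simp
  let φ : MvPolynomial (Fin t) (ZMod p) →ₗ[ZMod p] ((Fin t → Fin M) → ZMod p) :=
    LinearMap.pi fun e => MvPolynomial.lcoeff (ZMod p)
      (Finsupp.equivFunOnFinite.symm fun j => (e j : ℕ))
  have hli2 : LinearIndependent (ZMod p) (φ ∘ v) := by
    rw [Fintype.linearIndependent_iff] at hli ⊢
    intro c hc
    apply hli c
    have hc2 : φ (∑ x, c x • v x) = 0 := by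
      rw [map_sum, ← hc]; simp
    apply MvPolynomial.ext
    intro e
    rw [MvPolynomial.coeff_zero]
    by_cases he : ∀ j, e j < M
    · have := congrFun hc2 fun j => ⟨e j, he j⟩
      have e' : (Finsupp.equivFunOnFinite.symm fun j => e j) = e := by ext; simp
      simpa [φ, MvPolynomial.lcoeff, e', MvPolynomial.coeff_sum] using this
    · push Not at he
      obtain ⟨j, hj⟩ := he
      rw [MvPolynomial.coeff_sum]
      refine Finset.sum_eq_zero fun x _ => ?_
      have hcoeff : MvPolynomial.coeff e (v x) = 0 := by
        rw [← MvPolynomial.notMem_support_iff]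
        exact MvPolynomial.notMem_support_of_degreeOf_lt j ((hdeg x j).trans_le hj)
      rw [MvPolynomial.coeff_smul, hcoeff, smul_zero]
  have hcard := hli2.fintype_card_le_finrank
  rw [Module.finrank_fintype_fun_eq_card] at hcard
  simp only [Fintype.card_prod, Fintype.card_coe, Fintype.card_pi, Fintype.card_fin,
    prod_const, card_univ] at hcard
  rw [hM, mul_pow] at hcard
  exact Nat.le_of_mul_le_mul_right hcard (by positivity)

/-- The point `x` has nonzero, pairwise distinct coordinates modulo `p`. -/
def Nonsing {t : ℕ} (p : ℕ) (x : Fin t → ℕ) : Prop :=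
  (∀ i, ¬ p ∣ x i) ∧ ∀ i j, x i ≡ x j [MOD p] → i = j

lemma Nonsing.injective {p t : ℕ} {x : Fin t → ℕ} (hx : Nonsing p x) :
    Function.Injective fun i => (x i : ZMod p) := fun i j hij =>
  hx.2 i j ((ZMod.natCast_eq_natCast_iff _ _ _).1 hij)

lemma Nonsing.ne_zero {p t : ℕ} {x : Fin t → ℕ} (hx : Nonsing p x) (i : Fin t) :
    (x i : ZMod p) ≠ 0 := fun hi => hx.1 i ((ZMod.natCast_eq_zero_iff _ _).1 hi)

lemma natCast_zmod_ne_zero {p t h k : ℕ} (hh : 1 ≤ h) (hk : ∀ j : Fin t, h + j ≤ k) (hp : k < p)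
    (j : Fin t) : ((h + j : ℕ) : ZMod p) ≠ 0 := by
  rw [Ne, ZMod.natCast_eq_zero_iff]
  exact Nat.not_dvd_of_pos_of_lt (by omega) ((hk j).trans_lt hp)

/-- Hensel lifting: a nonsingular solution is determined modulo `p ^ e` by its residue
modulo `p` and the values of the power sums. -/
lemma hensel_unique {p t h k : ℕ} (hpp : p.Prime) (hh : 1 ≤ h) (hk : ∀ j : Fin t, h + j ≤ k)
    (hp : k < p) {x x' : Fin t → ℕ} (hx : Nonsing p x) (hmod : ∀ i, (p : ℤ) ∣ x' i - x i)
    (e : ℕ) (hsum : ∀ j : Fin t, ((p ^ e : ℕ) : ℤ) ∣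
      ∑ i, (x' i : ℤ) ^ (h + j : ℕ) - ∑ i, (x i : ℤ) ^ (h + j : ℕ)) :
    ∀ i, ((p ^ e : ℕ) : ℤ) ∣ x' i - x i := by
  induction e with
  | zero => simp
  | succ r ih =>
    rcases Nat.eq_zero_or_pos r with rfl | hr
    · simpa using hmod
    have ih' := ih fun j => dvd_trans (by exact_mod_cast pow_dvd_pow p (Nat.le_succ r)) (hsum j)
    choose d hd using ih'
    have : Fact p.Prime := ⟨hpp⟩
    have key : ∀ j : Fin t, ∑ i, (((h + j : ℕ) : ZMod p) * (x i : ZMod p) ^ (h + j - 1 : ℕ)) *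
        (d i : ZMod p) = 0 := by
      intro j
      have h1 : ∀ i, ∃ c : ℤ, (x' i : ℤ) ^ (h + j : ℕ) - (x i : ℤ) ^ (h + j : ℕ) =
          ((h + j : ℕ) * (x i : ℤ) ^ (h + j - 1 : ℕ) * d i) * (p : ℤ) ^ r
            + c * (p : ℤ) ^ (r + 1) := by
        intro i
        obtain ⟨c, hc⟩ := Polynomial.powAddExpansion (x i : ℤ) ((p : ℤ) ^ r * d i) (h + j)
        refine ⟨c * (p : ℤ) ^ (r - 1) * d i ^ 2, ?_⟩
        have e1 : (x' i : ℤ) = x i + (p : ℤ) ^ r * d i := by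
          have := hd i; push_cast at this; linarith
        rw [e1, hc]
        obtain ⟨r', rfl⟩ : ∃ r', r = r' + 1 := ⟨r - 1, by omega⟩
        simp only [Nat.add_sub_cancel]
        push_cast
        ring
      choose c hc using h1
      have h2 := hsum j
      rw [← Finset.sum_sub_distrib, Finset.sum_congr rfl fun i _ => hc i, Finset.sum_add_distrib,
        ← Finset.sum_mul, ← Finset.sum_mul] at h2
      push_cast at h2
      rw [dvd_add_left (Dvd.intro_left _ rfl), pow_succ', mul_dvd_mul_iff_right
        (pow_ne_zero _ (by exact_mod_cast hpp.ne_zero))] at h2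
      have h3 := (ZMod.intCast_zmod_eq_zero_iff_dvd _ p).2 h2
      push_cast at h3 ⊢
      exact h3
    have hdet := isUnit_det_powerSumJacobian h hh (natCast_zmod_ne_zero hh hk hp)
      (fun i => (x i : ZMod p)) hx.injective hx.ne_zero
    have hzero := Matrix.eq_zero_of_mulVec_eq_zero (M := powerSumJacobian h fun i => (x i : ZMod p))
      (v := fun i => (d i : ZMod p)) hdet.ne_zero (funext key)
    intro i
    have h4 : (p : ℤ) ∣ d i := (ZMod.intCast_zmod_eq_zero_iff_dvd _ p).1 (congrFun hzero i)
    rw [hd i, pow_succ]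
    push_cast
    exact mul_dvd_mul_left _ h4

/-- Among points of `[0, q ^ h)^t`, nonsingular modulo all primes dividing `q` and with
congruent power sums modulo `q ^ h`, there are at most `(t k + 1) ^ t` classes for every
prime divisor of `q`. -/
lemma card_congruent_le {q t h k : ℕ} (hq : q ≠ 0) (hh : 1 ≤ h) (hk : ∀ j : Fin t, h + j ≤ k)
    (hp : ∀ p ∈ q.primeFactors, k < p) (A : Finset (Fin t → ℕ))
    (hlt : ∀ x ∈ A, ∀ i, x i < q ^ h)
    (hns : ∀ x ∈ A, ∀ p ∈ q.primeFactors, Nonsing p x)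
    (hsum : ∀ x ∈ A, ∀ x' ∈ A, ∀ j : Fin t, ((q ^ h : ℕ) : ℤ) ∣
      ∑ i, (x' i : ℤ) ^ (h + j : ℕ) - ∑ i, (x i : ℤ) ^ (h + j : ℕ)) :
    A.card ≤ ((t * k + 1) ^ t) ^ q.primeFactors.card := by
  classical
  have hcong : ∀ x ∈ A, ∀ x' ∈ A, (∀ p ∈ q.primeFactors, ∀ i, x i % p = x' i % p) → x = x' := by
    intro x hx x' hx' hmod
    have hdvd : ∀ i, ((q ^ h : ℕ) : ℤ) ∣ x' i - x i := by
      intro i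
      rw [Int.natCast_dvd, Nat.dvd_iff_prime_pow_dvd_dvd]
      intro p e hpp he
      rcases Nat.eq_zero_or_pos e with rfl | he0
      · simp
      have hpq : p ∈ q.primeFactors := by
        rw [Nat.mem_primeFactors]
        exact ⟨hpp, hpp.dvd_of_dvd_pow ((dvd_pow_self p he0.ne').trans he), hq⟩
      rw [← Int.natCast_dvd]
      refine hensel_unique hpp hh hk (hp p hpq) (hns x hx p hpq) (fun i => ?_) e (fun j => ?_) i
      · exact (Nat.modEq_iff_dvd).1 (hmod p hpq i)
      · exact dvd_trans (by exact_mod_cast he) (hsum x hx x' hx' j)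
    funext i
    have h1 := hlt x hx i
    have h2 := hlt x' hx' i
    have h3 : (x' i : ℤ) - x i = 0 := by
      apply Int.eq_zero_of_abs_lt_dvd (hdvd i)
      rw [abs_lt]; constructor <;> omega
    omega
  have hcard : ∀ p ∈ q.primeFactors,
      (A.image fun x i => x i % p).card ≤ (t * k + 1) ^ t := by
    intro p hpq
    have : Fact p.Prime := ⟨Nat.prime_of_mem_primeFactors hpq⟩
    have e : (A.image fun x i => x i % p) =
        (A.image fun x i => (x i : ZMod p)).image fun a i => (a i).val := by
      rw [Finset.image_image]
      congr 1
      funext x i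
      simp [ZMod.val_natCast]
    rw [e]
    refine Finset.card_image_le.trans ?_
    rcases A.eq_empty_or_nonempty with rfl | ⟨x0, hx0⟩
    · simp
    refine card_nonsingular_solutions_le hh hk (hp p hpq)
      (fun j => ∑ i, (x0 i : ZMod p) ^ (h + j : ℕ)) _ ?_
    intro a ha
    obtain ⟨x, hx, rfl⟩ := Finset.mem_image.1 ha
    refine ⟨(hns x hx p hpq).injective, (hns x hx p hpq).ne_zero, fun j => ?_⟩
    have h1 : ((p : ℕ) : ℤ) ∣ ∑ i, (x i : ℤ) ^ (h + j : ℕ) - ∑ i, (x0 i : ℤ) ^ (h + j : ℕ) := by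
      refine dvd_trans ?_ (hsum x0 hx0 x hx j)
      exact_mod_cast (Nat.dvd_of_mem_primeFactors hpq).trans (dvd_pow_self q (by omega))
    have h2 := (ZMod.intCast_zmod_eq_zero_iff_dvd _ p).2 h1
    push_cast at h2
    exact sub_eq_zero.1 h2
  calc A.card ≤ (q.primeFactors.pi fun p => A.image fun x i => x i % p).card := by
        apply Finset.card_le_card_of_injOn (fun x p _ i => x i % p)
        · intro x hx
          rw [Finset.mem_coe, Finset.mem_pi]
          intro p _
          exact Finset.mem_image_of_mem _ hx
        · intro x hx x' hx' hxx
          refine hcong x hx x' hx' fun p hpq i => ?_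
          exact congrFun (congrFun (congrFun hxx p) hpq) i
    _ = ∏ p ∈ q.primeFactors, (A.image fun x i => x i % p).card := Finset.card_pi _ _
    _ ≤ _ := Finset.prod_le_pow_card _ _ _ hcard

/-- A number all of whose prime factors are at most `R` has a divisor in `(M, M R]` as soon as it
exceeds `M`. -/
lemma exists_dvd_mem_Ioc {M R : ℝ} (hM : 1 ≤ M) (n : ℕ)
    (hn : ∀ p : ℕ, p.Prime → p ∣ n → (p : ℝ) ≤ R) (hMn : M < n) :
    ∃ q : ℕ, q ∣ n ∧ M < q ∧ (q : ℝ) ≤ M * R := by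
  induction n using Nat.strong_induction_on with
  | _ n ih =>
    by_cases hle : (n : ℝ) ≤ M * R
    · exact ⟨n, dvd_rfl, hMn, hle⟩
    push Not at hle
    have hn1 : n ≠ 1 := by
      rintro rfl
      simp at hMn
      linarith
    obtain ⟨p, hp, m, rfl⟩ := Nat.exists_prime_and_dvd hn1
    have hpR := hn p hp (Dvd.intro _ rfl)
    have hp0 : (0 : ℝ) < p := by exact_mod_cast hp.pos
    have hMm : M < m := by
      push_cast at hle
      have h1 : M * p ≤ M * R := mul_le_mul_of_nonneg_left hpR (by linarith)
      nlinarith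
    have hm0 : 0 < m := by
      have : (0 : ℝ) < m := by linarith
      exact_mod_cast this
    obtain ⟨q, hq1, hq2⟩ := ih m (by nlinarith [hp.two_le])
      (fun p' hp' hd => hn p' hp' (hd.mul_left _)) hMm
    exact ⟨q, hq1.mul_left _, hq2⟩

/-- `u` is bad for `x` if its divisors composed of nonsingular primes of `x` are at most `M`. -/
def IsBad {t : ℕ} (M : ℝ) (x : Fin t → ℕ) (u : ℕ) : Prop :=
  ∀ q : ℕ, q ∣ u → (∀ p : ℕ, p.Prime → p ∣ q → Nonsing p x) → (q : ℝ) ≤ M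

lemma exists_mul_of_primes (P : ℕ → Prop) (u : ℕ) (hu : u ≠ 0) :
    ∃ n d : ℕ, u = n * d ∧ (∀ p, p.Prime → p ∣ n → ¬ P p) ∧ (∀ p, p.Prime → p ∣ d → P p) := by
  induction u using induction_on_primes with
  | zero => exact absurd rfl hu
  | one => exact ⟨1, 1, rfl, fun p hp hd => absurd hd hp.not_dvd_one,
      fun p hp hd => absurd hd hp.not_dvd_one⟩
  | prime_mul p a hp ih =>
    obtain ⟨n, d, rfl, hn, hd⟩ := ih (right_ne_zero_of_mul hu)
    by_cases hP : P p
    · refine ⟨n, p * d, by ring, hn, fun q hq hqd => ?_⟩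
      rcases hq.dvd_mul.1 hqd with h | h
      · rwa [(Nat.prime_dvd_prime_iff_eq hq hp).1 h]
      · exact hd q hq h
    · refine ⟨p * n, d, by ring, fun q hq hqd => ?_, hd⟩
      rcases hq.dvd_mul.1 hqd with h | h
      · rwa [(Nat.prime_dvd_prime_iff_eq hq hp).1 h]
      · exact hn q hq h

lemma sqrt_pow_le_prod {R : ℝ} (l : List ℕ) (hl : ∀ p ∈ l, Real.sqrt R ≤ p) :
    Real.sqrt R ^ l.length ≤ (l.prod : ℕ) := by
  induction l with
  | nil => simp
  | cons a l ih =>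
    rw [List.length_cons, pow_succ', List.prod_cons, Nat.cast_mul]
    exact mul_le_mul (hl a (by simp)) (ih fun p hp => hl p (by simp [hp]))
      (pow_nonneg (Real.sqrt_nonneg _) _) (Nat.cast_nonneg _)

lemma mul_log_le_of_sqrt_pow_le {R : ℝ} (hR : 0 < R) (m n : ℕ)
    (h : Real.sqrt R ^ m ≤ n) : m * Real.log R ≤ 2 * Real.log n := by
  have hs : 0 < Real.sqrt R := Real.sqrt_pos.2 hR
  have := Real.log_le_log (pow_pos hs m) h
  rw [Real.log_pow, Real.log_sqrt hR.le] at this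
  linarith

lemma cardFactors_mul_log_le {R : ℝ} (hR : 0 < R) (n : ℕ) (hn : n ≠ 0)
    (h : ∀ p : ℕ, p.Prime → p ∣ n → Real.sqrt R < p) :
    ArithmeticFunction.cardFactors n * Real.log R ≤ 2 * Real.log n := by
  apply mul_log_le_of_sqrt_pow_le hR
  have h1 := sqrt_pow_le_prod (R := R) n.primeFactorsList fun p hp =>
    (h p (Nat.prime_of_mem_primeFactorsList hp) (Nat.dvd_of_mem_primeFactorsList hp)).le
  rwa [Nat.prod_primeFactorsList hn] at h1

lemma card_large_primeFactors_mul_log_le {R : ℝ} (hR : 0 < R) (n : ℕ) (hn : n ≠ 0)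
    (S : Finset ℕ) (hS : S ⊆ n.primeFactors) (h : ∀ p ∈ S, Real.sqrt R < p) :
    S.card * Real.log R ≤ 2 * Real.log n := by
  apply mul_log_le_of_sqrt_pow_le hR
  calc Real.sqrt R ^ S.card = ∏ p ∈ S, Real.sqrt R := by simp
    _ ≤ ∏ p ∈ S, (p : ℝ) :=
        Finset.prod_le_prod (fun _ _ => Real.sqrt_nonneg _) fun p hp => (h p hp).le
    _ = ((∏ p ∈ S, p : ℕ) : ℝ) := by push_cast; rfl
    _ ≤ n := by
      have h1 : (∏ p ∈ S, p) ∣ n :=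
        (Finset.prod_dvd_prod_of_subset _ _ _ hS).trans (Nat.prod_primeFactors_dvd n)
      exact_mod_cast Nat.le_of_dvd (Nat.pos_of_ne_zero hn) h1

/-- The multiplicative function `(z + 1) ^ (-Ω n)`. -/
noncomputable def negPowCardFactorsHom (c : ℝ) : ℕ →* ℝ where
  toFun n := if n = 0 then 0 else c ^ ArithmeticFunction.cardFactors n
  map_one' := by simp
  map_mul' m n := by
    rcases eq_or_ne m 0 with rfl | hm
    · simp
    rcases eq_or_ne n 0 with rfl | hn
    · simp
    simp [hm, hn, ArithmeticFunction.cardFactors_mul hm hn, pow_add]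

open scoped Classical in
/-- The primes of `(√R, R]` modulo which `x` is singular. -/
noncomputable def singularPrimes {t : ℕ} (R : ℝ) (x : Fin t → ℕ) : Finset ℕ :=
  (primesSqrtIoc R).filter fun p => ¬ Nonsing p x

lemma card_singularPrimes_mul_log_le {t : ℕ} {Q R : ℝ} (hR : 0 < R) (x : Fin t → ℕ)
    (hxinj : Function.Injective x) (hx0 : ∀ i, 1 ≤ x i) (hxQ : ∀ i, (x i : ℝ) ≤ Q) :
    (singularPrimes R x).card * Real.log R ≤ t ^ 2 * (2 * Real.log Q) := by
  classical
  let D : Fin t × Fin t → ℕ := fun ij =>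
    if ij.1 = ij.2 then x ij.1 else ((x ij.1 : ℤ) - x ij.2).natAbs
  have hD0 : ∀ ij, D ij ≠ 0 := by
    intro ij
    simp only [D]
    split_ifs with h
    · have := hx0 ij.1; omega
    · have : x ij.1 ≠ x ij.2 := fun h' => h (hxinj h')
      omega
  have hDQ : ∀ ij, (D ij : ℝ) ≤ Q := by
    intro ij
    simp only [D]
    split_ifs with h
    · exact hxQ _
    · have h1 := hxQ ij.1
      have h2 := hxQ ij.2
      rcases le_total (x ij.1) (x ij.2) with h3 | h3
      · refine le_trans ?_ h2
        have : ((x ij.1 : ℤ) - x ij.2).natAbs ≤ x ij.2 := by omega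
        exact_mod_cast this
      · refine le_trans ?_ h1
        have : ((x ij.1 : ℤ) - x ij.2).natAbs ≤ x ij.1 := by omega
        exact_mod_cast this
  have hsub : singularPrimes R x ⊆ Finset.univ.biUnion fun ij =>
      (D ij).primeFactors.filter fun p => Real.sqrt R < p := by
    intro p hp
    simp only [singularPrimes, mem_filter, mem_primesSqrtIoc hR.le] at hp
    obtain ⟨⟨hpp, hpR, -⟩, hns⟩ := hp
    simp only [mem_biUnion, mem_univ, true_and, mem_filter, Nat.mem_primeFactors]
    by_contra! hcon
    apply hns
    refine ⟨fun i hi => ?_, fun i j hij => ?_⟩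
    · refine absurd hpR (not_lt.2 (hcon (i, i) ⟨hpp, ?_, hD0 _⟩))
      simpa [D] using hi
    · by_contra hne
      refine absurd hpR (not_lt.2 (hcon (i, j) ⟨hpp, ?_, hD0 _⟩))
      simp only [D, if_neg hne]
      rw [← Int.natCast_dvd, ← dvd_neg, neg_sub]
      exact (Nat.modEq_iff_dvd).1 hij
  have hρ : ∀ ij, (((D ij).primeFactors.filter fun p : ℕ => Real.sqrt R < p).card : ℝ) *
      Real.log R ≤ 2 * Real.log Q := by
    intro ij
    have h1 := card_large_primeFactors_mul_log_le hR (D ij) (hD0 ij) _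
      (Finset.filter_subset _ _) (fun p hp => (Finset.mem_filter.1 hp).2)
    have h2 := Real.log_le_log (by exact_mod_cast Nat.pos_of_ne_zero (hD0 ij)) (hDQ ij)
    linarith
  have hcard := (Finset.card_le_card hsub).trans Finset.card_biUnion_le
  rcases le_or_gt (Real.log R) 0 with hneg | hpos
  · rcases eq_or_ne t 0 with rfl | ht
    · have hzero : (singularPrimes R x).card = 0 := by simpa using hcard
      rw [hzero]; simp
    have hQ : 0 ≤ Real.log Q := by
      apply Real.log_nonneg
      have := hx0 ⟨0, Nat.pos_of_ne_zero ht⟩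
      exact le_trans (by exact_mod_cast this) (hxQ ⟨0, Nat.pos_of_ne_zero ht⟩)
    have : ((singularPrimes R x).card : ℝ) * Real.log R ≤ 0 :=
      mul_nonpos_of_nonneg_of_nonpos (Nat.cast_nonneg _) hneg
    exact this.trans (by positivity)
  · have h3 : ((singularPrimes R x).card : ℝ) ≤ ∑ ij,
        (((D ij).primeFactors.filter fun p : ℕ => Real.sqrt R < p).card : ℝ) := by
      exact_mod_cast hcard
    calc ((singularPrimes R x).card : ℝ) * Real.log R
        ≤ (∑ ij, (((D ij).primeFactors.filter fun p : ℕ => Real.sqrt R < p).card : ℝ)) *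
          Real.log R := mul_le_mul_of_nonneg_right h3 hpos.le
      _ ≤ ∑ ij : Fin t × Fin t, 2 * Real.log Q := by
          rw [Finset.sum_mul]; exact Finset.sum_le_sum fun ij _ => hρ ij
      _ = _ := by simp [sq]

open scoped Classical in
/-- The number of bad elements of `C(Q, R)`. -/
lemma card_bad_le {t : ℕ} (ht : 1 ≤ t) {Q R M : ℝ} (hR : 1 < R) (hM : 1 ≤ M)
    (x : Fin t → ℕ) (hxinj : Function.Injective x) (hx0 : ∀ i, 1 ≤ x i)
    (hxQ : ∀ i, (x i : ℝ) ≤ Q) :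
    (((smoothSet Q R).filter fun u => IsBad M x u).card : ℝ) ≤
      M * (Real.exp 1 * (t ^ 2 + 1)) ^ (2 * Real.log Q / Real.log R) := by
  have hR0 : 0 < R := by linarith
  have hρ : 0 < Real.log R := Real.log_pos hR
  set w := 2 * Real.log Q / Real.log R with hw
  set T := singularPrimes R x with hT
  set z : ℝ := (t : ℝ) ^ 2 with hz
  have ht1 : (1 : ℝ) ≤ t := by exact_mod_cast ht
  have hz1 : 1 ≤ z := by rw [hz]; nlinarith
  have hTw : (T.card : ℝ) ≤ z * w := by
    have := card_singularPrimes_mul_log_le hR0 x hxinj hx0 hxQ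
    rw [hw, ← mul_div_assoc, le_div_iff₀ hρ]
    exact this
  let E : Finset ℕ := (smoothSet Q R).filter fun d => ∀ p, p.Prime → p ∣ d → ¬ Nonsing p x
  have hEcard : (E.card : ℝ) ≤ (Real.exp 1 * (z + 1)) ^ w := by
    have hc : 0 < z + 1 := by linarith
    have h1 := sum_le_prod_inv_one_sub T E (negPowCardFactorsHom (z + 1)⁻¹)
      (fun n => by
        change 0 ≤ if n = 0 then (0 : ℝ) else _
        split_ifs <;> positivity)
      (fun {p} hp => by
        change (if p = 0 then (0 : ℝ) else _) < 1
        rw [if_neg hp.ne_zero, ArithmeticFunction.cardFactors_apply_prime hp, pow_one]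
        exact inv_lt_one_of_one_lt₀ (by linarith))
      (fun p hp => by
        simp only [hT, singularPrimes, mem_filter, mem_primesSqrtIoc hR0.le] at hp
        exact hp.1.1)
      (fun d hd => by
        rw [Finset.mem_filter, mem_smoothSet] at hd
        rw [Nat.mem_factoredNumbers]
        refine ⟨by omega, fun p hp => ?_⟩
        have hpp := Nat.prime_of_mem_primeFactorsList hp
        have hpd := Nat.dvd_of_mem_primeFactorsList hp
        simp only [hT, singularPrimes, mem_filter, mem_primesSqrtIoc hR0.le]
        exact ⟨⟨hpp, hd.1.2.2 p hpp hpd⟩, hd.2 p hpp hpd⟩)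
    have h2 : ∏ p ∈ T, (1 - negPowCardFactorsHom (z + 1)⁻¹ p)⁻¹ ≤ Real.exp w := by
      calc ∏ p ∈ T, (1 - negPowCardFactorsHom (z + 1)⁻¹ p)⁻¹ = ∏ p ∈ T, (1 + 1 / z) := by
            refine Finset.prod_congr rfl fun p hp => ?_
            simp only [hT, singularPrimes, mem_filter, mem_primesSqrtIoc hR0.le] at hp
            have hpp := hp.1.1
            change (1 - (if p = 0 then (0 : ℝ) else _))⁻¹ = _
            rw [if_neg hpp.ne_zero, ArithmeticFunction.cardFactors_apply_prime hpp, pow_one]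
            have : z ≠ 0 := by linarith
            have h3 : 1 - (z + 1)⁻¹ = z / (z + 1) := by field_simp; ring
            rw [h3, inv_div]; field_simp
        _ ≤ ∏ p ∈ T, Real.exp (1 / z) := Finset.prod_le_prod (fun _ _ => by positivity)
            fun p _ => by rw [add_comm]; exact Real.add_one_le_exp _
        _ = Real.exp (T.card * (1 / z)) := by rw [Finset.prod_const, Real.exp_nat_mul]
        _ ≤ Real.exp w := by
            apply Real.exp_le_exp.2
            rw [mul_one_div, div_le_iff₀ (by linarith)]
            linarith
    have h3 : (E.card : ℝ) * (z + 1) ^ (-w) ≤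
        ∑ d ∈ E, negPowCardFactorsHom (z + 1)⁻¹ d := by
      rw [← nsmul_eq_mul, ← Finset.sum_const]
      refine Finset.sum_le_sum fun d hd => ?_
      rw [Finset.mem_filter, mem_smoothSet] at hd
      have hd0 : d ≠ 0 := by omega
      change _ ≤ if d = 0 then (0 : ℝ) else _
      rw [if_neg hd0, inv_pow, ← Real.rpow_natCast, ← Real.rpow_neg hc.le]
      apply Real.rpow_le_rpow_of_exponent_le (by linarith)
      apply neg_le_neg
      rw [hw, le_div_iff₀ hρ]
      have h4 := cardFactors_mul_log_le hR0 d hd0 fun p hp hpd => (hd.1.2.2 p hp hpd).1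
      have h5 := Real.log_le_log (by exact_mod_cast hd.1.1) hd.1.2.1
      linarith
    have h6 : (E.card : ℝ) * (z + 1) ^ (-w) ≤ Real.exp w := h3.trans (h1.trans h2)
    rw [Real.mul_rpow (Real.exp_pos _).le hc.le, Real.exp_one_rpow]
    rwa [Real.rpow_neg hc.le, ← div_eq_mul_inv, div_le_iff₀ (Real.rpow_pos_of_pos hc _)] at h6
  have hsub : ((smoothSet Q R).filter fun u => IsBad M x u) ⊆
      ((Finset.Icc 1 ⌊M⌋₊) ×ˢ E).image fun nd => nd.1 * nd.2 := by
    intro u hu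
    rw [Finset.mem_filter, mem_smoothSet] at hu
    obtain ⟨⟨hu1, huQ, hup⟩, hbad⟩ := hu
    obtain ⟨n, d, rfl, hn, hd⟩ := exists_mul_of_primes (fun p => ¬ Nonsing p x) u (by omega)
    have hn0 : 0 < n := Nat.pos_of_ne_zero (by rintro rfl; simp at hu1)
    have hd0 : 0 < d := Nat.pos_of_ne_zero (by rintro rfl; simp at hu1)
    have hnM := hbad n (Dvd.intro _ rfl) fun p hp hpn => not_not.1 (hn p hp hpn)
    refine Finset.mem_image.2 ⟨(n, d), ?_, rfl⟩
    simp only [E, Finset.mem_product, Finset.mem_Icc, Finset.mem_filter, mem_smoothSet]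
    refine ⟨⟨hn0, Nat.le_floor hnM⟩, ⟨hd0, le_trans ?_ huQ, fun p hp hpd =>
      hup p hp (hpd.mul_left _)⟩, hd⟩
    exact_mod_cast Nat.le_mul_of_pos_left d hn0
  have hcard := (Finset.card_le_card hsub).trans Finset.card_image_le
  rw [Finset.card_product, Nat.card_Icc, Nat.add_sub_cancel] at hcard
  have hcard' : (((smoothSet Q R).filter fun u => IsBad M x u).card : ℝ) ≤ ⌊M⌋₊ * E.card := by
    exact_mod_cast hcard
  refine hcard'.trans (mul_le_mul (Nat.floor_le (by linarith)) hEcard (Nat.cast_nonneg _)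
    (by linarith))

section Fourier
variable {G : Type*} [AddCommGroup G] [Fintype G]

set_option linter.unusedSectionVars false

/-- The mean of a function over the characters of a finite abelian group. -/
noncomputable def charMean (F : AddChar G ℂ → ℝ) : ℝ := (∑ ψ, F ψ) / Fintype.card G

/-- The exponential sum of the map `Φ` over the finite set `A`. -/
noncomputable def expSum {α : Type*} (A : Finset α) (Φ : α → G) (ψ : AddChar G ℂ) : ℂ :=
  ∑ a ∈ A, ψ (Φ a)

lemma card_pos' : (0 : ℝ) < Fintype.card G := by exact_mod_cast Fintype.card_pos

lemma charMean_mono {F F' : AddChar G ℂ → ℝ} (h : ∀ ψ, F ψ ≤ F' ψ) : charMean F ≤ charMean F' := by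
  unfold charMean
  exact div_le_div_of_nonneg_right (Finset.sum_le_sum fun ψ _ => h ψ) card_pos'.le

lemma charMean_const_mul (c : ℝ) (F : AddChar G ℂ → ℝ) :
    charMean (fun ψ => c * F ψ) = c * charMean F := by
  unfold charMean; rw [← Finset.mul_sum, mul_div_assoc]

lemma charMean_add (F F' : AddChar G ℂ → ℝ) :
    charMean (fun ψ => F ψ + F' ψ) = charMean F + charMean F' := by
  unfold charMean; rw [Finset.sum_add_distrib, add_div]

lemma charMean_one : charMean (fun _ : AddChar G ℂ => 1) = 1 := by
  unfold charMean
  rw [Finset.sum_const, Finset.card_univ, AddChar.card_eq, nsmul_eq_mul, mul_one,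
    div_self card_pos'.ne']

lemma card_filter_eq_zero [DecidableEq G] {α : Type*} (A : Finset α) (Φ : α → G) :
    ((A.filter fun a => Φ a = 0).card : ℂ) = (∑ ψ, expSum A Φ ψ) / Fintype.card G := by
  have hc : (Fintype.card G : ℂ) ≠ 0 := by exact_mod_cast Fintype.card_ne_zero
  rw [eq_div_iff hc]
  unfold expSum
  rw [Finset.sum_comm, Finset.sum_congr rfl fun a _ => AddChar.sum_apply_eq_ite (Φ a),
    Finset.sum_ite, Finset.sum_const, Finset.sum_const_zero, add_zero, nsmul_eq_mul]

lemma card_filter_eq_zero_le [DecidableEq G] {α : Type*} (A : Finset α) (Φ : α → G) :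
    ((A.filter fun a => Φ a = 0).card : ℝ) ≤ charMean fun ψ => ‖expSum A Φ ψ‖ := by
  have h := congrArg norm (card_filter_eq_zero A Φ)
  rw [Complex.norm_natCast, norm_div, Complex.norm_natCast] at h
  rw [h]
  exact div_le_div_of_nonneg_right (norm_sum_le _ _) card_pos'.le

lemma expSum_product {α β : Type*} (A : Finset α) (B : Finset β) (Φ : α → G) (Φ' : β → G)
    (ψ : AddChar G ℂ) :
    expSum (A ×ˢ B) (fun x => Φ x.1 + Φ' x.2) ψ = expSum A Φ ψ * expSum B Φ' ψ := by
  unfold expSum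
  rw [Finset.sum_mul_sum, Finset.sum_product]
  simp [AddChar.map_add_eq_mul]

lemma addChar_map_sum {ι : Type*} (ψ : AddChar G ℂ) (s : Finset ι) (g : ι → G) :
    ψ (∑ i ∈ s, g i) = ∏ i ∈ s, ψ (g i) := by
  classical
  induction s using Finset.induction_on with
  | empty => simp
  | insert a s ha ih => rw [Finset.sum_insert ha, Finset.prod_insert ha, AddChar.map_add_eq_mul, ih]

lemma expSum_piFinset {ι α : Type*} [Fintype ι] [DecidableEq ι] (B : ι → Finset α) (φ : ι → α → G)
    (ψ : AddChar G ℂ) :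
    expSum (Fintype.piFinset B) (fun z => ∑ i, φ i (z i)) ψ = ∏ i, expSum (B i) (φ i) ψ := by
  unfold expSum
  rw [Finset.prod_univ_sum]
  refine Finset.sum_congr rfl fun z _ => ?_
  exact addChar_map_sum _ _ _

lemma expSum_neg {α : Type*} (A : Finset α) (Φ : α → G) (ψ : AddChar G ℂ) :
    expSum A (fun a => -Φ a) ψ = starRingEnd ℂ (expSum A Φ ψ) := by
  unfold expSum
  rw [map_sum]
  exact Finset.sum_congr rfl fun a _ => AddChar.map_neg_eq_conj ψ _

lemma norm_expSum_neg {α : Type*} (A : Finset α) (Φ : α → G) (ψ : AddChar G ℂ) :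
    ‖expSum A (fun a => -Φ a) ψ‖ = ‖expSum A Φ ψ‖ := by
  rw [expSum_neg, RCLike.norm_conj]

lemma norm_expSum_le {α : Type*} (A : Finset α) (Φ : α → G) (ψ : AddChar G ℂ) :
    ‖expSum A Φ ψ‖ ≤ A.card := by
  unfold expSum
  refine (norm_sum_le _ _).trans ?_
  simp

lemma charMean_sq_eq_card [DecidableEq G] {α : Type*} (A : Finset α) (Φ : α → G) :
    charMean (fun ψ => ‖expSum A Φ ψ‖ ^ 2) =
      ((A ×ˢ A).filter fun x => Φ x.1 = Φ x.2).card := by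
  have h1 : ((A ×ˢ A).filter fun x => Φ x.1 = Φ x.2) =
      ((A ×ˢ A).filter fun x => Φ x.1 + (-Φ x.2) = 0) := by
    refine Finset.filter_congr fun x _ => ?_
    rw [← sub_eq_add_neg, sub_eq_zero]
  have h2 := card_filter_eq_zero (A ×ˢ A) (fun x : α × α => Φ x.1 + -Φ x.2)
  have h3 : ∀ ψ : AddChar G ℂ, expSum (A ×ˢ A) (fun x : α × α => Φ x.1 + -Φ x.2) ψ =
      ((‖expSum A Φ ψ‖ ^ 2 : ℝ) : ℂ) := by
    intro ψ
    rw [expSum_product A A Φ (fun a => -Φ a), expSum_neg, Complex.mul_conj]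
    rw [Complex.normSq_eq_norm_sq]
  rw [Finset.sum_congr rfl fun ψ _ => h3 ψ, ← h1] at h2
  unfold charMean
  exact_mod_cast h2.symm

lemma card_shift_le [DecidableEq G] {α : Type*} (A : Finset α) (Φ : α → G) (g : G) :
    ((A ×ˢ A).filter fun x => Φ x.1 = Φ x.2 + g).card ≤
      ((A ×ˢ A).filter fun x => Φ x.1 = Φ x.2).card := by
  have h1 : ((A ×ˢ A).filter fun x => Φ x.1 = Φ x.2 + g) =
      ((A ×ˢ A).filter fun x => Φ x.1 + -(Φ x.2 + g) = 0) := by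
    refine Finset.filter_congr fun x _ => ?_
    rw [← sub_eq_add_neg, sub_eq_zero]
  have h2 := card_filter_eq_zero_le (A ×ˢ A) (fun x : α × α => Φ x.1 + -(Φ x.2 + g))
  have h3 : ∀ ψ : AddChar G ℂ, ‖expSum (A ×ˢ A) (fun x : α × α => Φ x.1 + -(Φ x.2 + g)) ψ‖ =
      ‖expSum A Φ ψ‖ ^ 2 := by
    intro ψ
    rw [expSum_product A A Φ (fun a => -(Φ a + g)), norm_mul, norm_expSum_neg, sq]
    congr 1
    unfold expSum
    simp only [AddChar.map_add_eq_mul]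
    rw [← Finset.sum_mul, norm_mul, AddChar.norm_apply, mul_one]
  simp only [h3] at h2
  rw [← h1, charMean_sq_eq_card] at h2
  exact_mod_cast h2

/-- Hölder's inequality for three functions. -/
lemma charMean_rpow_mul_le (a b c : AddChar G ℂ → ℝ) (ha : ∀ ψ, 0 ≤ a ψ) (hb : ∀ ψ, 0 ≤ b ψ)
    (hc : ∀ ψ, 0 ≤ c ψ) {X Y Z α β γ : ℝ} (hX : 0 < X) (hY : 0 < Y) (hZ : 0 < Z)
    (hα : 0 ≤ α) (hβ : 0 ≤ β) (hγ : 0 ≤ γ) (hsum : α + β + γ = 1)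
    (haX : charMean a ≤ X) (hbY : charMean b ≤ Y) (hcZ : charMean c ≤ Z) :
    charMean (fun ψ => a ψ ^ α * b ψ ^ β * c ψ ^ γ) ≤ X ^ α * Y ^ β * Z ^ γ := by
  set W := X ^ α * Y ^ β * Z ^ γ with hW
  have hW0 : 0 < W := by positivity
  have h1 : ∀ ψ, a ψ ^ α * b ψ ^ β * c ψ ^ γ ≤
      W * (α * X⁻¹ * a ψ + (β * Y⁻¹ * b ψ + γ * Z⁻¹ * c ψ)) := by
    intro ψ
    have h2 := Real.geom_mean_le_arith_mean3_weighted hα hβ hγ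
      (div_nonneg (ha ψ) hX.le) (div_nonneg (hb ψ) hY.le) (div_nonneg (hc ψ) hZ.le) hsum
    rw [Real.div_rpow (ha ψ) hX.le, Real.div_rpow (hb ψ) hY.le, Real.div_rpow (hc ψ) hZ.le,
      div_mul_div_comm, div_mul_div_comm, div_le_iff₀ (by positivity)] at h2
    refine h2.trans (le_of_eq ?_)
    rw [hW]
    field_simp
    ring
  refine (charMean_mono h1).trans ?_
  rw [charMean_const_mul, charMean_add, charMean_const_mul, charMean_add, charMean_const_mul,
    charMean_const_mul]
  have h3 : α * X⁻¹ * charMean a ≤ α := by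
    rw [mul_assoc]
    refine mul_le_of_le_one_right hα ?_
    rw [inv_mul_le_iff₀ hX]; linarith
  have h4 : β * Y⁻¹ * charMean b ≤ β := by
    rw [mul_assoc]
    refine mul_le_of_le_one_right hβ ?_
    rw [inv_mul_le_iff₀ hY]; linarith
  have h5 : γ * Z⁻¹ * charMean c ≤ γ := by
    rw [mul_assoc]
    refine mul_le_of_le_one_right hγ ?_
    rw [inv_mul_le_iff₀ hZ]; linarith
  calc _ ≤ W * (α + (β + γ)) := by gcongr
    _ = W := by rw [← add_assoc, hsum, mul_one]

/-- Moments of a function interpolate between the zeroth and the `n`-th one. -/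
lemma charMean_pow_le (f : AddChar G ℂ → ℝ) (hf : ∀ ψ, 0 ≤ f ψ) {n m : ℕ} (hn : 0 < n)
    (hmn : m ≤ n) {Y : ℝ} (hY : 0 < Y) (hfY : charMean (fun ψ => f ψ ^ n) ≤ Y) :
    charMean (fun ψ => f ψ ^ m) ≤ Y ^ ((m : ℝ) / n) := by
  have hn' : (0 : ℝ) < n := by exact_mod_cast hn
  have hmn' : (m : ℝ) / n ≤ 1 := by
    rw [div_le_one hn']; exact_mod_cast hmn
  have h := charMean_rpow_mul_le (fun ψ => f ψ ^ n) (fun _ => 1) (fun _ => 1)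
    (fun ψ => pow_nonneg (hf ψ) n) (fun _ => zero_le_one) (fun _ => zero_le_one) hY one_pos one_pos
    (show (0 : ℝ) ≤ (m : ℝ) / n by positivity) (sub_nonneg.2 hmn') le_rfl
    (by ring) hfY charMean_one.le charMean_one.le
  simp only [Real.one_rpow, mul_one] at h
  refine le_trans (le_of_eq ?_) h
  congr 1
  funext ψ
  rw [← Real.rpow_natCast, ← Real.rpow_natCast, ← Real.rpow_mul (hf ψ), mul_div_cancel₀ _ hn'.ne']

end Fourier

section Step
variable {G : Type*} [AddCommGroup G] [Fintype G] [DecidableEq G]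
  {ι : Type*} [Fintype ι] [DecidableEq ι] {t : ℕ}

set_option linter.unusedSectionVars false

/-- A sum over `t` variables with sign `+` and further variables with prescribed signs. -/
def signedSum (φ : ℕ → G) (ε : ι → Bool) (xz : (Fin t → ℕ) × (ι → ℕ)) : G :=
  ∑ i, φ (xz.1 i) + ∑ i, (if ε i then φ (xz.2 i) else -φ (xz.2 i))

lemma norm_expSum_ite (φ : ℕ → G) (b : Bool) (B : Finset ℕ) (ψ : AddChar G ℂ) :
    ‖expSum B (fun n => if b then φ n else -φ n) ψ‖ = ‖expSum B φ ψ‖ := by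
  cases b
  · simpa using norm_expSum_neg B φ ψ
  · simp

lemma card_signedSum_le (φ : ℕ → G) (ε : ι → Bool) (Z : Finset (Fin t → ℕ)) (B : ι → Finset ℕ) :
    (((Z ×ˢ Fintype.piFinset B).filter fun xz => signedSum φ ε xz = 0).card : ℝ) ≤
      charMean fun ψ => ‖expSum Z (fun x => ∑ i, φ (x i)) ψ‖ * ∏ i, ‖expSum (B i) φ ψ‖ := by
  refine (card_filter_eq_zero_le _ _).trans (charMean_mono fun ψ => le_of_eq ?_)
  have h := expSum_product Z (Fintype.piFinset B) (fun x => ∑ i, φ (x i))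
    (fun z : ι → ℕ => ∑ i, (if ε i then φ (z i) else -φ (z i))) ψ
  unfold signedSum
  rw [h, norm_mul, expSum_piFinset B (fun i n => if ε i then φ n else -φ n), norm_prod]
  simp only [norm_expSum_ite]

lemma norm_expSum_singleton {α : Type*} (Φ : α → G) (a : α) (ψ : AddChar G ℂ) :
    ‖expSum {a} Φ ψ‖ = 1 := by
  simp [expSum]

lemma prod_norm_expSum_ite {κ : Type*} [Fintype κ] [DecidableEq κ] (φ : ℕ → G) (C : Finset ℕ)
    (U : Finset κ) (D : κ → Finset ℕ) (ψ : AddChar G ℂ) :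
    ∏ i, ‖expSum (if i ∈ U then D i else C) φ ψ‖ =
      (∏ i ∈ U, ‖expSum (D i) φ ψ‖) * ‖expSum C φ ψ‖ ^ (Fintype.card κ - U.card) := by
  have h : ∀ i, ‖expSum (if i ∈ U then D i else C) φ ψ‖ =
      if i ∈ U then ‖expSum (D i) φ ψ‖ else ‖expSum C φ ψ‖ := by
    intro i; split_ifs <;> rfl
  simp only [h]
  rw [Finset.prod_ite, Finset.prod_const, Finset.filter_mem_eq_inter, Finset.univ_inter]
  congr 2
  rw [← Finset.card_compl]
  congr 1
  ext i; simp

/-- Solutions with two coinciding coordinates. -/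
lemma card_coincident_le (φ : ℕ → G) (ε : ι → Bool) (C : Finset ℕ) {n : ℕ}
    (hn : t + Fintype.card ι = n) {X : ℝ} (hX : 0 < X)
    (hfX : charMean (fun ψ => ‖expSum C φ ψ‖ ^ n) ≤ X) :
    ((((Fintype.piFinset fun _ : Fin t => C) ×ˢ (Fintype.piFinset fun _ : ι => C)).filter
      fun xz => signedSum φ ε xz = 0 ∧ ¬ Function.Injective xz.1).card : ℝ) ≤
      t ^ 2 * C.card * X ^ (((n - 2 : ℕ) : ℝ) / n) := by
  let S : (Fin t × Fin t) × ℕ → Finset ((Fin t → ℕ) × (ι → ℕ)) := fun w =>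
    if w.1.1 = w.1.2 then ∅ else
    ((Fintype.piFinset fun i => if i ∈ ({w.1.1, w.1.2} : Finset (Fin t)) then {w.2} else C) ×ˢ
      (Fintype.piFinset fun _ : ι => C)).filter fun xz => signedSum φ ε xz = 0
  have hS : ∀ w, ((S w).card : ℝ) ≤ X ^ (((n - 2 : ℕ) : ℝ) / n) := by
    intro w
    simp only [S]
    split_ifs with hw
    · simp; positivity
    have hcard2 : ({w.1.1, w.1.2} : Finset (Fin t)).card = 2 := Finset.card_pair hw
    have ht2 : 2 ≤ t := by
      have := Finset.card_le_univ ({w.1.1, w.1.2} : Finset (Fin t))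
      rw [hcard2, Fintype.card_fin] at this; exact this
    refine (card_signedSum_le _ _ _ _).trans ?_
    refine le_trans (charMean_mono fun ψ => ?_) (charMean_pow_le (fun ψ => ‖expSum C φ ψ‖)
      (fun ψ => norm_nonneg _) (n := n) (m := n - 2) (by omega) (by omega) hX hfX)
    rw [expSum_piFinset _ (fun _ => φ), norm_prod, prod_norm_expSum_ite φ C _ (fun _ => {w.2}),
      hcard2]
    simp only [norm_expSum_singleton, Finset.prod_const_one, one_mul, Finset.prod_const,
      Finset.card_univ, Fintype.card_fin]
    rw [← pow_add]
    apply le_of_eq; congr 1; omega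
  have hsub : (((Fintype.piFinset fun _ : Fin t => C) ×ˢ (Fintype.piFinset fun _ : ι => C)).filter
      fun xz => signedSum φ ε xz = 0 ∧ ¬ Function.Injective xz.1) ⊆
      ((Finset.univ : Finset (Fin t × Fin t)) ×ˢ C).biUnion S := by
    intro xz hxz
    simp only [Finset.mem_filter, Finset.mem_product, Fintype.mem_piFinset] at hxz
    obtain ⟨⟨hx, hz⟩, h0, hinj⟩ := hxz
    simp only [Function.Injective, not_forall] at hinj
    obtain ⟨a, b, hab, hne⟩ := hinj
    rw [Finset.mem_biUnion]
    refine ⟨((a, b), xz.1 a), by simp [hx a], ?_⟩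
    simp only [S, if_neg hne, Finset.mem_filter, Finset.mem_product, Fintype.mem_piFinset]
    refine ⟨⟨fun i => ?_, hz⟩, h0⟩
    split_ifs with hi
    · rw [Finset.mem_insert, Finset.mem_singleton] at hi
      rcases hi with rfl | rfl
      · simp
      · simp [hab]
    · exact hx i
  have h1 := (Finset.card_le_card hsub).trans Finset.card_biUnion_le
  calc _ ≤ ((∑ w ∈ (Finset.univ : Finset (Fin t × Fin t)) ×ˢ C, (S w).card : ℕ) : ℝ) := by
        exact_mod_cast h1
    _ ≤ ∑ w ∈ (Finset.univ : Finset (Fin t × Fin t)) ×ˢ C, X ^ (((n - 2 : ℕ) : ℝ) / n) := by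
        push_cast
        exact Finset.sum_le_sum fun w _ => hS w
    _ = _ := by
        simp [sq]

open scoped Classical in
/-- Solutions for which many variables are bad. -/
lemma card_many_bad_le (φ : ℕ → G) (ε : ι → Bool) (C : Finset ℕ) {n l : ℕ}
    (hn : t + Fintype.card ι = n) (hn0 : 0 < n) (bad : (Fin t → ℕ) → Finset ℕ) {β : ℝ}
    (hβ0 : 0 ≤ β)
    (hβ : ∀ x : Fin t → ℕ, (∀ i, x i ∈ C) → Function.Injective x → ((bad x).card : ℝ) ≤ β)
    {X : ℝ} (hX : 0 < X) (hfX : charMean (fun ψ => ‖expSum C φ ψ‖ ^ n) ≤ X) :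
    ((((Fintype.piFinset fun _ : Fin t => C) ×ˢ (Fintype.piFinset fun _ : ι => C)).filter
      fun xz => signedSum φ ε xz = 0 ∧ Function.Injective xz.1 ∧
        l ≤ (Finset.univ.filter fun i => xz.2 i ∈ bad xz.1).card).card : ℝ) ≤
      2 ^ Fintype.card ι * C.card ^ t * β ^ l *
        X ^ (((Fintype.card ι - l : ℕ) : ℝ) / n) := by
  let 𝒳 := (Fintype.piFinset fun _ : Fin t => C).filter fun x => Function.Injective x
  let S : (Fin t → ℕ) × Finset ι → Finset ((Fin t → ℕ) × (ι → ℕ)) := fun w =>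
    (({w.1} : Finset (Fin t → ℕ)) ×ˢ (Fintype.piFinset fun i => if i ∈ w.2 then bad w.1 else
      C)).filter fun xz => signedSum φ ε xz = 0
  have hS : ∀ w ∈ 𝒳 ×ˢ (Finset.univ : Finset ι).powersetCard l,
      ((S w).card : ℝ) ≤ β ^ l * X ^ (((Fintype.card ι - l : ℕ) : ℝ) / n) := by
    rintro ⟨x, U⟩ hw
    simp only [𝒳, Finset.mem_product, Finset.mem_filter, Fintype.mem_piFinset,
      Finset.mem_powersetCard] at hw
    obtain ⟨⟨hxC, hxi⟩, -, hU⟩ := hw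
    have hβx := hβ x hxC hxi
    refine (card_signedSum_le _ _ _ _).trans ?_
    have h1 : ∀ ψ : AddChar G ℂ, ‖expSum {x} (fun x => ∑ i, φ (x i)) ψ‖ *
        ∏ i, ‖expSum (if i ∈ U then bad x else C) φ ψ‖ ≤
        β ^ l * ‖expSum C φ ψ‖ ^ (Fintype.card ι - l) := by
      intro ψ
      rw [norm_expSum_singleton, one_mul, prod_norm_expSum_ite φ C U (fun _ => bad x), hU,
        Finset.prod_const, hU]
      gcongr
      exact (norm_expSum_le _ _ _).trans hβx
    refine (charMean_mono h1).trans ?_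
    rw [charMean_const_mul]
    refine mul_le_mul_of_nonneg_left ?_ (pow_nonneg ((Nat.cast_nonneg _).trans hβx) _)
    exact charMean_pow_le (fun ψ => ‖expSum C φ ψ‖) (fun ψ => norm_nonneg _) hn0 (by omega) hX hfX
  have hsub : (((Fintype.piFinset fun _ : Fin t => C) ×ˢ (Fintype.piFinset fun _ : ι => C)).filter
      fun xz => signedSum φ ε xz = 0 ∧ Function.Injective xz.1 ∧
        l ≤ (Finset.univ.filter fun i => xz.2 i ∈ bad xz.1).card) ⊆
      (𝒳 ×ˢ (Finset.univ : Finset ι).powersetCard l).biUnion S := by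
    rintro ⟨x, z⟩ hxz
    simp only [Finset.mem_filter, Finset.mem_product, Fintype.mem_piFinset] at hxz
    obtain ⟨⟨hx, hz⟩, h0, hinj, hl⟩ := hxz
    obtain ⟨U, hU1, hU2⟩ := Finset.exists_subset_card_eq hl
    rw [Finset.mem_biUnion]
    refine ⟨(x, U), ?_, ?_⟩
    · simp only [𝒳, Finset.mem_product, Finset.mem_filter, Fintype.mem_piFinset,
        Finset.mem_powersetCard]
      exact ⟨⟨hx, hinj⟩, Finset.subset_univ _, hU2⟩
    · simp only [S, Finset.mem_filter, Finset.mem_product, Fintype.mem_piFinset,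
        Finset.mem_singleton, true_and]
      refine ⟨fun i => ?_, h0⟩
      split_ifs with hi
      · exact (Finset.mem_filter.1 (hU1 hi)).2
      · exact hz i
  have h1 := (Finset.card_le_card hsub).trans Finset.card_biUnion_le
  have h𝒳 : (𝒳.card : ℝ) ≤ (C.card : ℝ) ^ t := by
    have := Finset.card_filter_le (Fintype.piFinset fun _ : Fin t => C) fun x =>
      Function.Injective x
    rw [Fintype.card_piFinset_const] at this
    exact_mod_cast this
  have h2 : (((Finset.univ : Finset ι).powersetCard l).card : ℝ) ≤ 2 ^ Fintype.card ι := by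
    have := Finset.card_le_univ ((Finset.univ : Finset ι).powersetCard l)
    rw [Fintype.card_finset] at this
    exact_mod_cast this
  calc _ ≤ ((∑ w ∈ 𝒳 ×ˢ (Finset.univ : Finset ι).powersetCard l, (S w).card : ℕ) : ℝ) := by
        exact_mod_cast h1
    _ ≤ ∑ w ∈ 𝒳 ×ˢ (Finset.univ : Finset ι).powersetCard l,
        β ^ l * X ^ (((Fintype.card ι - l : ℕ) : ℝ) / n) := by
        push_cast
        exact Finset.sum_le_sum fun w hw => hS w hw
    _ = (((Finset.univ : Finset ι).powersetCard l).card : ℝ) * 𝒳.card *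
        (β ^ l * X ^ (((Fintype.card ι - l : ℕ) : ℝ) / n)) := by
        rw [Finset.sum_const, nsmul_eq_mul, Finset.card_product]
        push_cast
        ring
    _ ≤ 2 ^ Fintype.card ι * C.card ^ t *
        (β ^ l * X ^ (((Fintype.card ι - l : ℕ) : ℝ) / n)) := by gcongr
    _ = _ := by ring

/-- Solutions in which one variable runs over `D`. -/
lemma card_good_le (φ : ℕ → G) (ε : ι → Bool) (C D : Finset ℕ) (Z : Finset (Fin t → ℕ)) (i₀ : ι)
    {s : ℕ} (hs : 1 ≤ s) (hι : Fintype.card ι = 2 * s + t)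
    {X T : ℝ} (hX : 0 < X) (hT : 0 < T)
    (hfX : charMean (fun ψ => ‖expSum C φ ψ‖ ^ (2 * (s + t))) ≤ X)
    (hZX : charMean (fun ψ => ‖expSum Z (fun x => ∑ i, φ (x i)) ψ‖ ^ 2 *
      ‖expSum C φ ψ‖ ^ (2 * s)) ≤ X)
    (hZT : charMean (fun ψ => ‖expSum Z (fun x => ∑ i, φ (x i)) ψ‖ ^ 2 *
      ‖expSum D φ ψ‖ ^ (2 * s)) ≤ T) :
    (((Z ×ˢ Fintype.piFinset fun i => if i ∈ ({i₀} : Finset ι) then D else C).filter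
      fun xz => signedSum φ ε xz = 0).card : ℝ) ≤
      T ^ (1 / (2 * s : ℝ)) * X ^ (1 - 1 / (2 * s : ℝ)) := by
  have hs' : (1 : ℝ) ≤ s := by exact_mod_cast hs
  refine (card_signedSum_le _ _ _ _).trans ?_
  have hnn : (0 : ℝ) ≤ 1 / 2 - 1 / (2 * s) := by
    rw [sub_nonneg]; gcongr; linarith
  have h := charMean_rpow_mul_le
    (fun ψ => ‖expSum Z (fun x => ∑ i, φ (x i)) ψ‖ ^ 2 * ‖expSum D φ ψ‖ ^ (2 * s))
    (fun ψ => ‖expSum Z (fun x => ∑ i, φ (x i)) ψ‖ ^ 2 * ‖expSum C φ ψ‖ ^ (2 * s))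
    (fun ψ => ‖expSum C φ ψ‖ ^ (2 * (s + t)))
    (fun ψ => by positivity) (fun ψ => by positivity) (fun ψ => by positivity) hT hX hX
    (α := 1 / (2 * s : ℝ)) (β := 1 / 2 - 1 / (2 * s : ℝ)) (γ := 1 / 2) (by positivity) hnn
    (by norm_num) (by ring) hZT hZX hfX
  refine le_trans (charMean_mono fun ψ => le_of_eq ?_) (h.trans (le_of_eq ?_))
  · rw [prod_norm_expSum_ite φ C {i₀} (fun _ => D), Finset.prod_singleton, hι,
      Finset.card_singleton]
    set a := ‖expSum Z (fun x => ∑ i, φ (x i)) ψ‖ with ha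
    set b := ‖expSum C φ ψ‖ with hb
    set d := ‖expSum D φ ψ‖ with hd
    have ha0 : 0 ≤ a := norm_nonneg _
    have hb0 : 0 ≤ b := norm_nonneg _
    have hd0 : 0 ≤ d := norm_nonneg _
    have e1 : ∀ c : ℝ, (c ^ (2 * s)) = (c ^ 2) ^ (s : ℝ) := fun c => by
      rw [Real.rpow_natCast, pow_mul]
    rw [Real.mul_rpow (by positivity) (by positivity),
      Real.mul_rpow (by positivity) (by positivity)]
    have p1 : (d ^ (2 * s)) ^ (1 / (2 * s : ℝ)) = d := by
      rw [← Real.rpow_natCast, ← Real.rpow_mul hd0]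
      push_cast
      rw [mul_one_div_cancel (by positivity), Real.rpow_one]
    have p2 : (a ^ 2) ^ (1 / (2 * s : ℝ)) * (a ^ 2) ^ (1 / 2 - 1 / (2 * s : ℝ)) = a := by
      rw [← Real.rpow_add_of_nonneg (by positivity) (by positivity) hnn, ← Real.rpow_natCast,
        ← Real.rpow_mul ha0]
      norm_num
    have p3 : (b ^ (2 * s)) ^ (1 / 2 - 1 / (2 * s : ℝ)) * (b ^ (2 * (s + t))) ^ (1 / 2 : ℝ) =
        b ^ (2 * s + t - 1) := by
      rw [← Real.rpow_natCast b, ← Real.rpow_mul hb0, ← Real.rpow_natCast b (2 * (s + t)),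
        ← Real.rpow_mul hb0, ← Real.rpow_add_of_nonneg hb0 (by positivity) (by positivity),
        ← Real.rpow_natCast]
      congr 1
      rw [Nat.cast_sub (by omega)]
      push_cast
      field_simp
      ring
    calc _ = a * d * b ^ (2 * s + t - 1) := by ring
      _ = ((a ^ 2) ^ (1 / (2 * s : ℝ)) * (a ^ 2) ^ (1 / 2 - 1 / (2 * s : ℝ))) *
          ((d ^ (2 * s)) ^ (1 / (2 * s : ℝ))) * ((b ^ (2 * s)) ^ (1 / 2 - 1 / (2 * s : ℝ)) *
          (b ^ (2 * (s + t))) ^ (1 / 2 : ℝ)) := by rw [p1, p2, p3]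
      _ = _ := by ring
  · rw [mul_assoc, ← Real.rpow_add hX]
    congr 2; ring

end Step

/-- The number of solutions of `∑ xᵢ^(h+j) = ∑ yᵢ^(h+j)` for `j < t` with `s` variables on each
side, all lying in `B`. -/
def vCount (h t s : ℕ) (B : Finset ℕ) : ℕ :=
  (((Fintype.piFinset fun _ : Fin s => B) ×ˢ (Fintype.piFinset fun _ : Fin s => B)).filter
    fun xy => ∀ j : Fin t, ∑ i, xy.1 i ^ (h + j : ℕ) = ∑ i, xy.2 i ^ (h + j : ℕ)).card

/-- The vector of the powers `n^h, …, n^(h+t-1)` modulo `N`. -/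
def powVec (N h t n : ℕ) : Fin t → ZMod N := fun j => (n : ZMod N) ^ (h + j : ℕ)

lemma sum_powVec_eq_iff {N h t : ℕ} {ι κ : Type*} (I : Finset ι) (K : Finset κ)
    (x : ι → ℕ) (y : κ → ℕ)
    (hx : ∀ j : Fin t, ∑ i ∈ I, x i ^ (h + j : ℕ) < N)
    (hy : ∀ j : Fin t, ∑ i ∈ K, y i ^ (h + j : ℕ) < N) :
    ∑ i ∈ I, powVec N h t (x i) = ∑ i ∈ K, powVec N h t (y i) ↔
      ∀ j : Fin t, ∑ i ∈ I, x i ^ (h + j : ℕ) = ∑ i ∈ K, y i ^ (h + j : ℕ) := by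
  rw [funext_iff]
  refine forall_congr' fun j => ?_
  simp only [Finset.sum_apply, powVec]
  have h := ZMod.natCast_eq_natCast_iff (∑ i ∈ I, x i ^ (h + j : ℕ)) (∑ i ∈ K, y i ^ (h + j : ℕ)) N
  rw [Nat.ModEq, Nat.mod_eq_of_lt (hx j), Nat.mod_eq_of_lt (hy j)] at h
  rw [← h]
  push_cast
  rfl

lemma sum_pow_lt {N e s : ℕ} {ι : Type*} {I : Finset ι} (hI : I.card ≤ s) {C : Finset ℕ}
    (hN0 : 0 < N) (hN : ∀ n ∈ C, s * n ^ e < N) {x : ι → ℕ} (hx : ∀ i ∈ I, x i ∈ C) :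
    ∑ i ∈ I, x i ^ e < N := by
  rcases I.eq_empty_or_nonempty with rfl | hne
  · simpa using hN0
  obtain ⟨i, hi, hmax⟩ := I.exists_max_image x hne
  calc ∑ i ∈ I, x i ^ e ≤ I.card • (x i ^ e) :=
        Finset.sum_le_card_nsmul _ _ _ fun j hj => Nat.pow_le_pow_left (hmax j hj) e
    _ ≤ s * x i ^ e := by rw [smul_eq_mul]; exact Nat.mul_le_mul_right _ hI
    _ < N := hN _ (hx i hi)

lemma charMean_eq_vCount {N h t s S : ℕ} [NeZero N] (hs : s ≤ S) {C B : Finset ℕ} (hBC : B ⊆ C)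
    (hN : ∀ n ∈ C, ∀ j : Fin t, S * n ^ (h + j : ℕ) < N) :
    charMean (fun ψ => ‖expSum B (powVec N h t) ψ‖ ^ (2 * s)) = vCount h t s B := by
  have h1 := charMean_sq_eq_card (Fintype.piFinset fun _ : Fin s => B)
    (fun x => ∑ i, powVec N h t (x i))
  have h2 : ∀ ψ, expSum (Fintype.piFinset fun _ : Fin s => B)
      (fun x => ∑ i, powVec N h t (x i)) ψ = expSum B (powVec N h t) ψ ^ s := by
    intro ψ
    rw [expSum_piFinset (fun _ : Fin s => B) (fun _ => powVec N h t)]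
    simp
  simp only [h2, norm_pow, ← pow_mul] at h1
  rw [mul_comm 2 s, h1, vCount]
  congr 2
  refine Finset.filter_congr fun xy hxy => ?_
  rw [Finset.mem_product, Fintype.mem_piFinset, Fintype.mem_piFinset] at hxy
  have hcard : (Finset.univ : Finset (Fin s)).card ≤ S := by simpa using hs
  exact sum_powVec_eq_iff _ _ _ _
    (fun j => sum_pow_lt hcard (Nat.pos_of_neZero N) (fun n hn => hN n hn j)
      fun i _ => hBC (hxy.1 i))
    (fun j => sum_pow_lt hcard (Nat.pos_of_neZero N) (fun n hn => hN n hn j)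
      fun i _ => hBC (hxy.2 i))

lemma vCount_image_mul {h t s q : ℕ} (hq : q ≠ 0) (B : Finset ℕ) :
    vCount h t s (B.image (q * ·)) ≤ vCount h t s B := by
  unfold vCount
  refine Finset.card_le_card_of_surjOn
    (fun xy => (fun i => q * xy.1 i, fun i => q * xy.2 i)) ?_
  rintro ⟨x, y⟩ hxy
  simp only [Finset.coe_filter, Finset.mem_product, Fintype.mem_piFinset, Set.mem_ofPred_eq,
    Finset.mem_image] at hxy
  obtain ⟨⟨hx, hy⟩, heq⟩ := hxy
  choose x' hx' hqx using hx
  choose y' hy' hqy using hy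
  refine ⟨(x', y'), ?_, ?_⟩
  · simp only [Finset.coe_filter, Finset.mem_product, Fintype.mem_piFinset, Set.mem_ofPred_eq]
    refine ⟨⟨hx', hy'⟩, fun j => ?_⟩
    have := heq j
    simp only [← hqx, ← hqy, mul_pow, ← Finset.mul_sum] at this
    exact Nat.eq_of_mul_eq_mul_left (pow_pos (Nat.pos_of_ne_zero hq) _) this
  · simp only [Prod.mk.injEq]
    exact ⟨funext hqx, funext hqy⟩

lemma second_moment_le {N h t s q b : ℕ} [NeZero N] {C D : Finset ℕ}
    (hDC : D ⊆ C) (hqD : ∀ d ∈ D, q ∣ d) {Z : Finset (Fin t → ℕ)}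
    (hZ : ∀ x ∈ Z, ∀ i, x i ∈ C)
    (hN : ∀ n ∈ C, ∀ j : Fin t, (s + t) * n ^ (h + j : ℕ) < N)
    (hb : ∀ x ∈ Z, (Z.filter fun x' => ∀ j : Fin t, ((q ^ h : ℕ) : ℤ) ∣
      ∑ i, (x' i : ℤ) ^ (h + j : ℕ) - ∑ i, (x i : ℤ) ^ (h + j : ℕ)).card ≤ b) :
    charMean (fun ψ => ‖expSum Z (fun x => ∑ i, powVec N h t (x i)) ψ‖ ^ 2 *
      ‖expSum D (powVec N h t) ψ‖ ^ (2 * s)) ≤ b * (C.card : ℝ) ^ t * vCount h t s D := by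
  classical
  set φ := powVec N h t with hφ
  set W := Fintype.piFinset fun _ : Fin s => D with hW
  let Φ : (Fin t → ℕ) × (Fin s → ℕ) → (Fin t → ZMod N) :=
    fun xw => ∑ i, φ (xw.1 i) + ∑ i, φ (xw.2 i)
  have h1 := charMean_sq_eq_card (Z ×ˢ W) Φ
  have h2 : ∀ ψ, expSum (Z ×ˢ W) Φ ψ =
      expSum Z (fun x => ∑ i, φ (x i)) ψ * expSum D φ ψ ^ s := by
    intro ψ
    rw [expSum_product Z W (fun x => ∑ i, φ (x i)) (fun w => ∑ i, φ (w i)), hW,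
      expSum_piFinset (fun _ : Fin s => D) (fun _ => φ)]
    simp
  simp only [h2, norm_mul, norm_pow, mul_pow, ← pow_mul] at h1
  rw [mul_comm 2 s, h1]
  set V := (W ×ˢ W).filter fun w => ∑ i, φ (w.1 i) = ∑ i, φ (w.2 i) with hV
  have hcardV : (V.card : ℝ) = vCount h t s D := by
    rw [← charMean_eq_vCount (Nat.le_add_right s t) hDC hN]
    have h3 := charMean_sq_eq_card W (fun x => ∑ i, φ (x i))
    rw [← h3]
    congr 1
    funext ψ
    rw [hW, expSum_piFinset (fun _ : Fin s => D) (fun _ => φ)]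
    simp [← pow_mul, mul_comm, hφ]
  let cong : (Fin t → ℕ) → Finset (Fin t → ℕ) := fun x =>
    Z.filter fun x' => ∀ j : Fin t, ((q ^ h : ℕ) : ℤ) ∣
      ∑ i, (x' i : ℤ) ^ (h + j : ℕ) - ∑ i, (x i : ℤ) ^ (h + j : ℕ)
  let S : (Σ _ : Fin t → ℕ, Fin t → ℕ) →
      Finset (((Fin t → ℕ) × (Fin s → ℕ)) × ((Fin t → ℕ) × (Fin s → ℕ))) := fun p =>
    ((W ×ˢ W).filter fun w =>
      ∑ i, φ (w.1 i) = ∑ i, φ (w.2 i) + (∑ i, φ (p.2 i) - ∑ i, φ (p.1 i))).image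
      fun w => ((p.1, w.1), (p.2, w.2))
  have hScard : ∀ p, (S p).card ≤ V.card := fun p =>
    Finset.card_image_le.trans (card_shift_le W (fun w => ∑ i, φ (w i)) _)
  have hsub : (((Z ×ˢ W) ×ˢ (Z ×ˢ W)).filter fun x => Φ x.1 = Φ x.2) ⊆
      (Z.sigma cong).biUnion S := by
    rintro ⟨⟨x, w⟩, ⟨x', w'⟩⟩ hm
    simp only [Finset.mem_filter, Finset.mem_product] at hm
    obtain ⟨⟨⟨hx, hw⟩, hx', hw'⟩, heq⟩ := hm
    rw [Finset.mem_biUnion]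
    have hw1 : ∀ i, w i ∈ D := by simpa [hW] using hw
    have hw2 : ∀ i, w' i ∈ D := by simpa [hW] using hw'
    refine ⟨⟨x, x'⟩, ?_, ?_⟩
    · simp only [Finset.mem_sigma, cong, Finset.mem_filter]
      refine ⟨hx, hx', fun j => ?_⟩
      have hcard : (Finset.univ : Finset (Fin t ⊕ Fin s)).card ≤ s + t := by
        simp [add_comm]
      have key := (sum_powVec_eq_iff (N := N) (h := h) (t := t) Finset.univ Finset.univ
        (Sum.elim x w) (Sum.elim x' w')
        (fun j => sum_pow_lt hcard (Nat.pos_of_neZero N) (fun n hn => hN n hn j) (by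
          rintro (i | i) -
          · exact hZ x hx i
          · exact hDC (hw1 i)))
        (fun j => sum_pow_lt hcard (Nat.pos_of_neZero N) (fun n hn => hN n hn j) (by
          rintro (i | i) -
          · exact hZ x' hx' i
          · exact hDC (hw2 i)))).1 (by
            simpa [Fintype.sum_sum_type, Φ, hφ] using heq) j
      simp only [Fintype.sum_sum_type, Sum.elim_inl, Sum.elim_inr] at key
      have hdvd : ∀ v : Fin s → ℕ, (∀ i, v i ∈ D) →
          ((q ^ h : ℕ) : ℤ) ∣ ∑ i, (v i : ℤ) ^ (h + j : ℕ) := by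
        intro v hv
        refine Finset.dvd_sum fun i _ => ?_
        have : q ^ h ∣ v i ^ (h + j : ℕ) :=
          (pow_dvd_pow q (Nat.le_add_right h j)).trans (pow_dvd_pow_of_dvd (hqD _ (hv i)) _)
        exact_mod_cast this
      have hz : ∑ i, (x' i : ℤ) ^ (h + j : ℕ) - ∑ i, (x i : ℤ) ^ (h + j : ℕ) =
          ∑ i, (w i : ℤ) ^ (h + j : ℕ) - ∑ i, (w' i : ℤ) ^ (h + j : ℕ) := by
        have : (∑ i, (x i : ℤ) ^ (h + j : ℕ)) + ∑ i, (w i : ℤ) ^ (h + j : ℕ) =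
          (∑ i, (x' i : ℤ) ^ (h + j : ℕ)) + ∑ i, (w' i : ℤ) ^ (h + j : ℕ) := by
          exact_mod_cast key
        linarith
      rw [hz]
      exact dvd_sub (hdvd w hw1) (hdvd w' hw2)
    · simp only [S, Finset.mem_image, Finset.mem_filter, Finset.mem_product]
      refine ⟨(w, w'), ⟨⟨hw, hw'⟩, ?_⟩, rfl⟩
      simp only [Φ] at heq
      calc ∑ i, φ (w i) = (∑ i, φ (x i) + ∑ i, φ (w i)) - ∑ i, φ (x i) := by abel
        _ = _ := by rw [heq]; abel
  have hZcard : Z.card ≤ C.card ^ t := by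
    have : Z ⊆ Fintype.piFinset fun _ : Fin t => C := fun x hx =>
      Fintype.mem_piFinset.2 (hZ x hx)
    simpa using Finset.card_le_card this
  have hfin : (((Z ×ˢ W) ×ˢ (Z ×ˢ W)).filter fun x => Φ x.1 = Φ x.2).card ≤
      b * C.card ^ t * V.card := by
    calc _ ≤ _ := (Finset.card_le_card hsub).trans Finset.card_biUnion_le
      _ ≤ ∑ _p ∈ Z.sigma cong, V.card := Finset.sum_le_sum fun p _ => hScard p
      _ = (∑ x ∈ Z, (cong x).card) * V.card := by
          rw [Finset.sum_const, smul_eq_mul, Finset.card_sigma]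
      _ ≤ (∑ _x ∈ Z, b) * V.card := Nat.mul_le_mul_right _ (Finset.sum_le_sum hb)
      _ ≤ _ := by
          rw [Finset.sum_const, smul_eq_mul, mul_comm Z.card]
          gcongr
  rw [← hcardV]
  exact_mod_cast hfin

lemma one_mem_smoothSet {Q R : ℝ} (hQ : 1 ≤ Q) : 1 ∈ smoothSet Q R := by
  rw [mem_smoothSet]
  exact ⟨le_rfl, by simpa using hQ, fun p hp hp1 => absurd (Nat.dvd_one.1 hp1) hp.one_lt.ne'⟩

lemma one_le_card_smoothSet {Q R : ℝ} (hQ : 1 ≤ Q) : 1 ≤ (smoothSet Q R).card :=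
  Finset.card_pos.2 ⟨1, one_mem_smoothSet hQ⟩

lemma one_le_vCount {h t s : ℕ} {Q R : ℝ} (hQ : 1 ≤ Q) : 1 ≤ vCount h t s (smoothSet Q R) := by
  refine Finset.card_pos.2 ⟨(fun _ => 1, fun _ => 1), ?_⟩
  simp [one_mem_smoothSet hQ]

lemma pow_lt_of_le {S h t m : ℕ} {C : Finset ℕ} (hC : ∀ n ∈ C, n ≤ m) :
    ∀ n ∈ C, ∀ j : Fin t, S * n ^ (h + j : ℕ) < S * (m + 1) ^ (h + t) + 1 := by
  intro n hn j
  refine Nat.lt_succ_of_le (Nat.mul_le_mul_left _ ?_)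
  exact (Nat.pow_le_pow_left ((hC n hn).trans (Nat.le_succ _)) _).trans
    (Nat.pow_le_pow_right (Nat.succ_pos _) (by omega))

lemma card_signedSum_eq {G : Type*} [AddCommGroup G] [Fintype G] [DecidableEq G]
    (φ : ℕ → G) (C : Finset ℕ) (s t : ℕ) :
    ((((Fintype.piFinset fun _ : Fin t => C) ×ˢ
      (Fintype.piFinset fun _ : Fin s ⊕ Fin (s + t) => C)).filter
        fun xz => signedSum φ Sum.isLeft xz = 0).card : ℝ) =
      charMean fun ψ => ‖expSum C φ ψ‖ ^ (2 * (s + t)) := by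
  have h1 := card_filter_eq_zero ((Fintype.piFinset fun _ : Fin t => C) ×ˢ
      (Fintype.piFinset fun _ : Fin s ⊕ Fin (s + t) => C)) (signedSum φ Sum.isLeft)
  have h2 : ∀ ψ, expSum ((Fintype.piFinset fun _ : Fin t => C) ×ˢ
      (Fintype.piFinset fun _ : Fin s ⊕ Fin (s + t) => C)) (signedSum φ Sum.isLeft) ψ =
      ((‖expSum C φ ψ‖ ^ (2 * (s + t)) : ℝ) : ℂ) := by
    intro ψ
    have h := expSum_product (Fintype.piFinset fun _ : Fin t => C)
      (Fintype.piFinset fun _ : Fin s ⊕ Fin (s + t) => C) (fun x => ∑ i, φ (x i))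
      (fun z => ∑ i, (if Sum.isLeft i then φ (z i) else -φ (z i))) ψ
    unfold signedSum
    rw [h, expSum_piFinset _ (fun _ => φ),
      expSum_piFinset _ (fun (i : Fin s ⊕ Fin (s + t)) n => if i.isLeft then φ n else -φ n),
      Fintype.prod_sum_type]
    simp only [Sum.isLeft_inl, Sum.isLeft_inr, if_true, Bool.false_eq_true, if_false,
      expSum_neg, Finset.prod_const, Finset.card_univ, Fintype.card_fin]
    rw [← mul_assoc, ← pow_add, add_comm t s, ← mul_pow, Complex.mul_conj,
      Complex.normSq_eq_norm_sq, pow_mul]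
    push_cast
    rfl
  have h3 : (∑ ψ, expSum ((Fintype.piFinset fun _ : Fin t => C) ×ˢ
      (Fintype.piFinset fun _ : Fin s ⊕ Fin (s + t) => C)) (signedSum φ Sum.isLeft) ψ) /
        (Fintype.card G : ℂ) =
      ((charMean fun ψ => ‖expSum C φ ψ‖ ^ (2 * (s + t)) : ℝ) : ℂ) := by
    simp only [h2, charMean]
    push_cast
    rfl
  rw [h3] at h1
  exact_mod_cast h1

lemma charMean_subset_le {G : Type*} [AddCommGroup G] [Fintype G] [DecidableEq G] {t : ℕ}
    (φ : ℕ → G) (C : Finset ℕ) (s : ℕ) (Z : Finset (Fin t → ℕ)) (hZ : ∀ x ∈ Z, ∀ i, x i ∈ C) :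
    charMean (fun ψ => ‖expSum Z (fun x => ∑ i, φ (x i)) ψ‖ ^ 2 * ‖expSum C φ ψ‖ ^ (2 * s)) ≤
      charMean fun ψ => ‖expSum C φ ψ‖ ^ (2 * (s + t)) := by
  have key : ∀ A : Finset (Fin t → ℕ),
      charMean (fun ψ => ‖expSum A (fun x => ∑ i, φ (x i)) ψ‖ ^ 2 *
        ‖expSum C φ ψ‖ ^ (2 * s)) =
      (((A ×ˢ (Fintype.piFinset fun _ : Fin s => C)) ×ˢ
        (A ×ˢ (Fintype.piFinset fun _ : Fin s => C))).filter fun x =>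
          ∑ i, φ (x.1.1 i) + ∑ i, φ (x.1.2 i) = ∑ i, φ (x.2.1 i) + ∑ i, φ (x.2.2 i)).card := by
    intro A
    rw [← charMean_sq_eq_card _ fun x : (Fin t → ℕ) × (Fin s → ℕ) =>
      ∑ i, φ (x.1 i) + ∑ i, φ (x.2 i)]
    congr 1
    funext ψ
    rw [expSum_product A _ (fun x => ∑ i, φ (x i)) (fun w : Fin s → ℕ => ∑ i, φ (w i)),
      expSum_piFinset (fun _ : Fin s => C) (fun _ => φ)]
    simp only [Finset.prod_const, Finset.card_univ, Fintype.card_fin, norm_mul, norm_pow]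
    ring
  have hsub : Z ⊆ Fintype.piFinset fun _ : Fin t => C := fun x hx =>
    Fintype.mem_piFinset.2 (hZ x hx)
  calc _ ≤ charMean (fun ψ => ‖expSum (Fintype.piFinset fun _ : Fin t => C)
        (fun x => ∑ i, φ (x i)) ψ‖ ^ 2 * ‖expSum C φ ψ‖ ^ (2 * s)) := by
        rw [key, key]
        gcongr
    _ = _ := by
        congr 1
        funext ψ
        rw [expSum_piFinset (fun _ : Fin t => C) (fun _ => φ)]
        simp only [Finset.prod_const, Finset.card_univ, Fintype.card_fin, norm_pow]
        ring

open scoped Classical in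
theorem vCount_add_le {k h t s : ℕ} {Q R M β B : ℝ} (ht : 1 ≤ t) (hs : 1 ≤ s)
    (hhk : h + t = k + 1) (hh : 1 ≤ h) (hQ : 1 ≤ Q) (hR : 1 < R) (hM : 1 ≤ M) (hMQ : Q ≤ M ^ h)
    (hkR : (k : ℝ) ≤ √R)
    (hβ : M * (Real.exp 1 * (t ^ 2 + 1)) ^ (2 * Real.log Q / Real.log R) ≤ β)
    (hB1 : 1 ≤ B) (hB : ∀ q ∈ smoothSet (M * R) R,
      (((t * k + 1) ^ t : ℕ) : ℝ) ^ q.primeFactors.card ≤ B) :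
    (vCount h t (s + t) (smoothSet Q R) : ℝ) ≤
      t ^ 2 * (smoothSet Q R).card *
        (vCount h t (s + t) (smoothSet Q R) : ℝ) ^
          (((2 * (s + t) - 2 : ℕ) : ℝ) / (2 * (s + t) : ℕ)) +
      2 ^ (2 * s + t) * ((smoothSet Q R).card : ℝ) ^ t * β ^ (s + t) *
        (vCount h t (s + t) (smoothSet Q R) : ℝ) ^ ((s : ℝ) / (2 * (s + t) : ℕ)) +
      (2 * s + t : ℝ) / (s + 1) *
        ((∑ q ∈ (smoothSet (M * R) R).filter fun q : ℕ => M < q ∧ (q : ℝ) ≤ Q,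
          (B * ((smoothSet Q R).card : ℝ) ^ t * vCount h t s (smoothSet (Q / q) R)) ^
            (1 / (2 * s : ℝ))) *
          (vCount h t (s + t) (smoothSet Q R) : ℝ) ^ (1 - 1 / (2 * s : ℝ))) := by
  set C := smoothSet Q R with hC
  set 𝒬 := (smoothSet (M * R) R).filter fun q : ℕ => M < q ∧ (q : ℝ) ≤ Q with h𝒬
  set X : ℝ := (vCount h t (s + t) C : ℝ) with hXdef
  have hs0 : (0 : ℝ) < s := by exact_mod_cast hs
  have hX1 : (1 : ℝ) ≤ X := by
    rw [hXdef]; exact_mod_cast one_le_vCount (s := s + t) hQ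
  have hX : 0 < X := by linarith
  have hC1 : (1 : ℝ) ≤ C.card := by
    exact_mod_cast one_le_card_smoothSet hQ
  have hCle : ∀ n ∈ C, n ≤ ⌊Q⌋₊ := fun n hn => Nat.le_floor (mem_smoothSet.1 hn).2.1
  have hNlt := pow_lt_of_le (S := s + t) (h := h) (t := t) hCle
  set N := (s + t) * (⌊Q⌋₊ + 1) ^ (h + t) + 1
  set φ := powVec N h t with hφ
  have hfX : charMean (fun ψ => ‖expSum C φ ψ‖ ^ (2 * (s + t))) = X :=
    charMean_eq_vCount le_rfl subset_rfl hNlt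
  set Sol := ((Fintype.piFinset fun _ : Fin t => C) ×ˢ
      (Fintype.piFinset fun _ : Fin s ⊕ Fin (s + t) => C)).filter
        fun xz => signedSum φ Sum.isLeft xz = 0 with hSol
  have hSolX : (Sol.card : ℝ) = X := (card_signedSum_eq φ C s t).trans hfX
  let bad : (Fin t → ℕ) → Finset ℕ := fun x => C.filter (IsBad M x)
  have hβ0 : 0 ≤ β := le_trans (by positivity) hβ
  have hcardι : Fintype.card (Fin s ⊕ Fin (s + t)) = 2 * s + t := by simp; ring
  have hn : t + Fintype.card (Fin s ⊕ Fin (s + t)) = 2 * (s + t) := by rw [hcardι]; ring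
  have hbad : ∀ x : Fin t → ℕ, (∀ i, x i ∈ C) → Function.Injective x →
      ((bad x).card : ℝ) ≤ β := by
    intro x hx hinj
    refine le_trans ?_ hβ
    exact card_bad_le ht hR hM x hinj (fun i => (mem_smoothSet.1 (hx i)).1)
      (fun i => (mem_smoothSet.1 (hx i)).2.1)
  have e1 := card_coincident_le φ Sum.isLeft C hn hX hfX.le
  have e2 := card_many_bad_le φ Sum.isLeft C (l := s + t) hn (by omega) bad hβ0 hbad hX hfX.le
  rw [hcardι, show 2 * s + t - (s + t) = s by omega] at e2
  set 𝒞 := ((Fintype.piFinset fun _ : Fin t => C) ×ˢ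
      (Fintype.piFinset fun _ : Fin s ⊕ Fin (s + t) => C)) with h𝒞
  set S1 := 𝒞.filter fun xz => signedSum φ Sum.isLeft xz = 0 ∧ ¬ Function.Injective xz.1
    with hS1
  set S2 := 𝒞.filter fun xz => signedSum φ Sum.isLeft xz = 0 ∧ Function.Injective xz.1 ∧
        s + t ≤ (Finset.univ.filter fun i => xz.2 i ∈ bad xz.1).card with hS2
  set S3 := Sol.filter fun xz =>
        s + 1 ≤ (Finset.univ.filter fun i => xz.2 i ∉ bad xz.1).card with hS3
  have hcover : Sol ⊆ S1 ∪ S2 ∪ S3 := by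
    intro xz hxz
    by_cases hinj : Function.Injective xz.1
    · by_cases hl : s + t ≤ (Finset.univ.filter fun i => xz.2 i ∈ bad xz.1).card
      · refine Finset.mem_union_left _ (Finset.mem_union_right _ ?_)
        rw [hSol, Finset.mem_filter] at hxz
        exact Finset.mem_filter.2 ⟨hxz.1, hxz.2, hinj, hl⟩
      · refine Finset.mem_union_right _ (Finset.mem_filter.2 ⟨hxz, ?_⟩)
        have := Finset.card_filter_add_card_filter_not (s := Finset.univ)
          (fun i => xz.2 i ∈ bad xz.1)
        rw [Finset.card_univ, hcardι] at this
        omega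
    · refine Finset.mem_union_left _ (Finset.mem_union_left _ ?_)
      rw [hSol, Finset.mem_filter] at hxz
      exact Finset.mem_filter.2 ⟨hxz.1, hxz.2, hinj⟩
  let Z : ℕ → Finset (Fin t → ℕ) := fun q =>
    (Fintype.piFinset fun _ : Fin t => C).filter fun x => ∀ p ∈ q.primeFactors, Nonsing p x
  let Dq : ℕ → Finset ℕ := fun q => (smoothSet (Q / q) R).image (q * ·)
  let T : ℕ → ℝ := fun q => B * (C.card : ℝ) ^ t * vCount h t s (smoothSet (Q / q) R)
  let Y : (Fin s ⊕ Fin (s + t)) → ℕ → Finset ((Fin t → ℕ) × (Fin s ⊕ Fin (s + t) → ℕ)) :=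
    fun i q => (Z q ×ˢ Fintype.piFinset fun i' => if i' ∈ ({i} : Finset _) then Dq q else C).filter
      fun xz => signedSum φ Sum.isLeft xz = 0
  have hq0 : ∀ q ∈ 𝒬, q ≠ 0 := fun q hq =>
    Nat.one_le_iff_ne_zero.1 (mem_smoothSet.1 (Finset.mem_filter.1 hq).1).1
  have hY : ∀ i, ∀ q ∈ 𝒬, ((Y i q).card : ℝ) ≤
      T q ^ (1 / (2 * s : ℝ)) * X ^ (1 - 1 / (2 * s : ℝ)) := by
    intro i q hq
    have hqne := hq0 q hq
    obtain ⟨hqs, hMq, hqQ⟩ := Finset.mem_filter.1 hq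
    have hqpos : (0 : ℝ) < q := by exact_mod_cast Nat.pos_of_ne_zero hqne
    have hqs' := mem_smoothSet.1 hqs
    have hDC : Dq q ⊆ C := by
      intro n hn
      obtain ⟨m, hm, rfl⟩ := Finset.mem_image.1 hn
      have hm' := mem_smoothSet.1 hm
      rw [hC, mem_smoothSet]
      refine ⟨Nat.mul_pos hqs'.1 hm'.1, ?_, fun p hp hpn => ?_⟩
      · push_cast
        have := hm'.2.1
        rw [le_div_iff₀ hqpos] at this
        linarith
      · rcases hp.dvd_mul.1 hpn with h | h
        · exact hqs'.2.2 p hp h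
        · exact hm'.2.2 p hp h
    have hZC : ∀ x ∈ Z q, ∀ i, x i ∈ C := fun x hx =>
      Fintype.mem_piFinset.1 (Finset.mem_filter.1 hx).1
    have hT0 : 0 < T q := by
      have : (1 : ℝ) ≤ vCount h t s (smoothSet (Q / q) R) := by
        exact_mod_cast one_le_vCount ((one_le_div hqpos).2 hqQ)
      have h2 : (1 : ℝ) ≤ (C.card : ℝ) ^ t := one_le_pow₀ hC1
      simp only [T]
      positivity
    have hb : ∀ x ∈ Z q, ((Z q).filter fun x' => ∀ j : Fin t, ((q ^ h : ℕ) : ℤ) ∣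
        ∑ i, (x' i : ℤ) ^ (h + j : ℕ) - ∑ i, (x i : ℤ) ^ (h + j : ℕ)).card ≤
        ((t * k + 1) ^ t) ^ q.primeFactors.card := by
      intro x hx
      refine card_congruent_le hqne hh (fun j => by omega) ?_ _ ?_ ?_ ?_
      · intro p hp
        have := (hqs'.2.2 p (Nat.prime_of_mem_primeFactors hp)
          (Nat.dvd_of_mem_primeFactors hp)).1
        exact_mod_cast hkR.trans_lt this
      · intro y hy i
        have h1 := (mem_smoothSet.1 (hZC y (Finset.mem_filter.1 hy).1 i)).2.1
        have h2 : M ^ h < (q : ℝ) ^ h := pow_lt_pow_left₀ hMq (by linarith) (by omega)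
        have : ((y i : ℕ) : ℝ) < ((q ^ h : ℕ) : ℝ) := by push_cast; linarith
        exact_mod_cast this
      · intro y hy
        exact (Finset.mem_filter.1 (Finset.mem_filter.1 hy).1).2
      · intro y hy y' hy' j
        have h1 := (Finset.mem_filter.1 hy).2 j
        have h2 := (Finset.mem_filter.1 hy').2 j
        have := dvd_sub h2 h1
        rwa [sub_sub_sub_cancel_right] at this
    refine card_good_le φ Sum.isLeft C (Dq q) (Z q) i hs hcardι hX hT0 hfX.le ?_ ?_
    · exact (charMean_subset_le φ C s (Z q) hZC).trans_eq hfX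
    · refine (second_moment_le hDC (fun d hd => ?_) hZC hNlt hb).trans ?_
      · obtain ⟨m, -, rfl⟩ := Finset.mem_image.1 hd
        exact dvd_mul_right _ _
      · have hb2 := hB q hqs
        simp only [T]
        gcongr
        · push_cast at hb2 ⊢
          exact hb2
        · exact vCount_image_mul hqne _
  have hS3card : ((s : ℝ) + 1) * S3.card ≤ (2 * s + t) *
      ((∑ q ∈ 𝒬, T q ^ (1 / (2 * s : ℝ))) * X ^ (1 - 1 / (2 * s : ℝ))) := by
    have h1 : (s + 1) * S3.card ≤
        ∑ xz ∈ S3, (Finset.univ.filter fun i => xz.2 i ∉ bad xz.1).card := by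
      rw [mul_comm, ← smul_eq_mul]
      exact Finset.card_nsmul_le_sum _ _ _ fun xz hxz => (Finset.mem_filter.1 hxz).2
    have h2 : ∑ xz ∈ S3, (Finset.univ.filter fun i => xz.2 i ∉ bad xz.1).card =
        ∑ i, (S3.filter fun xz => xz.2 i ∉ bad xz.1).card := by
      simp only [Finset.card_filter]
      exact Finset.sum_comm
    have h3 : ∀ i, (S3.filter fun xz => xz.2 i ∉ bad xz.1) ⊆ 𝒬.biUnion (Y i) := by
      intro i ⟨x, z⟩ hxz
      obtain ⟨hxz3, hzi⟩ := Finset.mem_filter.1 hxz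
      have hxzS := (Finset.mem_filter.1 hxz3).1
      rw [hSol, Finset.mem_filter, h𝒞, Finset.mem_product, Fintype.mem_piFinset,
        Fintype.mem_piFinset] at hxzS
      obtain ⟨⟨hx, hz⟩, h0⟩ := hxzS
      simp only at hx hz hzi
      have hziC := mem_smoothSet.1 (hz i)
      have hnb : ¬ IsBad M x (z i) := fun hb => hzi (Finset.mem_filter.2 ⟨hz i, hb⟩)
      simp only [IsBad, not_forall, not_le] at hnb
      obtain ⟨q', hq'z, hq'ns, hMq'⟩ := hnb
      obtain ⟨q, hqq', hMq, hqM⟩ := exists_dvd_mem_Ioc hM q'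
        (fun p hp hpq => (hziC.2.2 p hp (hpq.trans hq'z)).2) hMq'
      have hqz : q ∣ z i := hqq'.trans hq'z
      have hqpos : 1 ≤ q := Nat.pos_of_dvd_of_pos hqz hziC.1
      have hqR : (0 : ℝ) < q := by exact_mod_cast hqpos
      rw [Finset.mem_biUnion]
      refine ⟨q, ?_, ?_⟩
      · rw [h𝒬, Finset.mem_filter, mem_smoothSet]
        refine ⟨⟨hqpos, hqM, fun p hp hpq => hziC.2.2 p hp (hpq.trans hqz)⟩, hMq, ?_⟩
        exact le_trans (by exact_mod_cast Nat.le_of_dvd hziC.1 hqz) hziC.2.1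
      · simp only [Y, Z, Finset.mem_filter, Finset.mem_product, Fintype.mem_piFinset]
        refine ⟨⟨⟨hx, fun p hp => hq'ns p (Nat.prime_of_mem_primeFactors hp)
          ((Nat.dvd_of_mem_primeFactors hp).trans hqq')⟩, fun i' => ?_⟩, h0⟩
        split_ifs with hi'
        · rw [Finset.mem_singleton] at hi'
          subst hi'
          obtain ⟨m, hm⟩ := hqz
          refine Finset.mem_image.2 ⟨m, mem_smoothSet.2 ⟨?_, ?_, fun p hp hpm => ?_⟩, hm.symm⟩
          · exact Nat.pos_of_ne_zero fun h0 => by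
              rw [h0, mul_zero] at hm
              omega
          · rw [le_div_iff₀ hqR]
            have := hziC.2.1
            rw [hm] at this
            push_cast at this
            linarith
          · exact hziC.2.2 p hp (hm ▸ hpm.mul_left q)
        · exact hz i'
    have h4 : ∀ i, ((S3.filter fun xz => xz.2 i ∉ bad xz.1).card : ℝ) ≤
        (∑ q ∈ 𝒬, T q ^ (1 / (2 * s : ℝ))) * X ^ (1 - 1 / (2 * s : ℝ)) := by
      intro i
      calc ((S3.filter fun xz => xz.2 i ∉ bad xz.1).card : ℝ) ≤
          ((∑ q ∈ 𝒬, (Y i q).card : ℕ) : ℝ) := by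
            exact_mod_cast (Finset.card_le_card (h3 i)).trans Finset.card_biUnion_le
        _ ≤ _ := by
          push_cast
          rw [Finset.sum_mul]
          exact Finset.sum_le_sum (hY i)
    calc ((s : ℝ) + 1) * S3.card ≤
        ((∑ i, (S3.filter fun xz => xz.2 i ∉ bad xz.1).card : ℕ) : ℝ) := by
          rw [h2] at h1; exact_mod_cast h1
      _ ≤ ∑ _i : Fin s ⊕ Fin (s + t), (∑ q ∈ 𝒬, T q ^ (1 / (2 * s : ℝ))) *
          X ^ (1 - 1 / (2 * s : ℝ)) := by
        push_cast
        exact Finset.sum_le_sum fun i _ => h4 i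
      _ = _ := by
        rw [Finset.sum_const, Finset.card_univ, hcardι, nsmul_eq_mul]
        push_cast
        rfl
  have hS3' : (S3.card : ℝ) ≤ (2 * s + t : ℝ) / (s + 1) *
      ((∑ q ∈ 𝒬, T q ^ (1 / (2 * s : ℝ))) * X ^ (1 - 1 / (2 * s : ℝ))) := by
    rw [div_mul_eq_mul_div, le_div_iff₀ (by positivity)]
    linarith
  have hfinal : (Sol.card : ℝ) ≤ S1.card + S2.card + S3.card := by
    exact_mod_cast (Finset.card_le_card hcover).trans ((Finset.card_union_le _ _).trans
      (Nat.add_le_add_right (Finset.card_union_le _ _) _))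
  rw [hSolX] at hfinal
  linarith

/-- Interpolation between numbers of variables. -/
lemma vCount_le_rpow {h t s S : ℕ} (hS : 0 < S) (hs : s ≤ S) {C : Finset ℕ}
    (hpos : 0 < vCount h t S C) :
    (vCount h t s C : ℝ) ≤ (vCount h t S C : ℝ) ^ ((s : ℝ) / S) := by
  have hN := pow_lt_of_le (S := S) (h := h) (t := t) (C := C) (m := C.sup id)
    fun n hn => Finset.le_sup (f := id) hn
  have h1 := charMean_eq_vCount hs subset_rfl hN
  have h2 := charMean_eq_vCount le_rfl subset_rfl hN
  rw [← h1]
  refine (charMean_pow_le _ (fun ψ => norm_nonneg _) (n := 2 * S) (by omega) (by omega)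
    (by exact_mod_cast hpos) h2.le).trans (le_of_eq ?_)
  congr 1
  push_cast
  field_simp

/-- Nearly all solutions with `t` variables are diagonal. -/
lemma vCount_self_le {h t k : ℕ} (hhk : h + t = k + 1) (hh : 1 ≤ h) {C : Finset ℕ}
    (hC0 : ∀ n ∈ C, 1 ≤ n) (hCne : 0 < vCount h t t C) :
    (vCount h t t C : ℝ) ≤
      t ^ 2 * C.card * (vCount h t t C : ℝ) ^ (((2 * t - 2 : ℕ) : ℝ) / (2 * t : ℕ)) +
        ((t * k + 1) ^ t : ℕ) * (C.card : ℝ) ^ t := by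
  classical
  set m := C.sup id with hm
  have hCle : ∀ n ∈ C, n ≤ m := fun n hn => Finset.le_sup (f := id) hn
  have hN := pow_lt_of_le (S := t) (h := h) (t := t) hCle
  set N := t * (m + 1) ^ (h + t) + 1
  set φ := powVec N h t with hφ
  set X : ℝ := (vCount h t t C : ℝ) with hX
  have hX0 : 0 < X := by rw [hX]; exact_mod_cast hCne
  have hfX : charMean (fun ψ => ‖expSum C φ ψ‖ ^ (2 * t)) = X :=
    charMean_eq_vCount le_rfl subset_rfl hN
  have e1 := card_coincident_le (t := t) φ (fun _ : Fin t => false) C (n := 2 * t)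
    (by simp; ring) hX0 hfX.le
  set 𝒞 := (Fintype.piFinset fun _ : Fin t => C) ×ˢ (Fintype.piFinset fun _ : Fin t => C) with h𝒞
  set S1 := 𝒞.filter fun xz => signedSum φ (fun _ : Fin t => false) xz = 0 ∧
    ¬ Function.Injective xz.1 with hS1
  set S2 := 𝒞.filter fun xy => (∀ j : Fin t, ∑ i, xy.1 i ^ (h + j : ℕ) =
    ∑ i, xy.2 i ^ (h + j : ℕ)) ∧ Function.Injective xy.1 with hS2
  have hcard : (Finset.univ : Finset (Fin t)).card ≤ t := by simp
  have hcover : (𝒞.filter fun xy => ∀ j : Fin t, ∑ i, xy.1 i ^ (h + j : ℕ) =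
      ∑ i, xy.2 i ^ (h + j : ℕ)) ⊆ S1 ∪ S2 := by
    intro xy hxy
    obtain ⟨hmem, heq⟩ := Finset.mem_filter.1 hxy
    by_cases hinj : Function.Injective xy.1
    · exact Finset.mem_union_right _ (Finset.mem_filter.2 ⟨hmem, heq, hinj⟩)
    · refine Finset.mem_union_left _ (Finset.mem_filter.2 ⟨hmem, ?_, hinj⟩)
      have hmem' := hmem
      rw [h𝒞, Finset.mem_product, Fintype.mem_piFinset, Fintype.mem_piFinset] at hmem'
      have h1 := (sum_powVec_eq_iff (N := N) (h := h) (t := t) Finset.univ Finset.univ xy.1 xy.2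
        (fun j => sum_pow_lt hcard (Nat.succ_pos _) (fun n hn => hN n hn j)
          fun i _ => hmem'.1 i)
        (fun j => sum_pow_lt hcard (Nat.succ_pos _) (fun n hn => hN n hn j)
          fun i _ => hmem'.2 i)).2 heq
      simp only [signedSum, Bool.false_eq_true, if_false, Finset.sum_neg_distrib]
      rw [← sub_eq_add_neg, sub_eq_zero]
      exact h1
  obtain ⟨p, hpm, hp⟩ := Nat.exists_infinite_primes (max m k + 1)
  have hpm' : m < p := by omega
  have hpk : k < p := by omega
  have hfib : ∀ y : Fin t → ℕ, (((Fintype.piFinset fun _ : Fin t => C).filter fun x =>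
      (∀ j : Fin t, ∑ i, x i ^ (h + j : ℕ) = ∑ i, y i ^ (h + j : ℕ)) ∧
        Function.Injective x).card) ≤ (t * k + 1) ^ t := by
    intro y
    have hlt : ∀ x : Fin t → ℕ, (∀ i, x i ∈ C) → ∀ i, x i < p := fun x hx i =>
      (hCle _ (hx i)).trans_lt hpm'
    refine (card_congruent_le (k := k) hp.ne_zero hh (fun j => by omega) ?_ _ ?_ ?_ ?_).trans_eq ?_
    · intro q hq
      rwa [(Nat.prime_dvd_prime_iff_eq (Nat.prime_of_mem_primeFactors hq) hp).1
        (Nat.dvd_of_mem_primeFactors hq)]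
    · intro x hx i
      have hx' := Fintype.mem_piFinset.1 (Finset.mem_filter.1 hx).1
      exact (hlt x hx' i).trans_le (Nat.le_self_pow (by omega) p)
    · intro x hx q hq
      have hx' := Fintype.mem_piFinset.1 (Finset.mem_filter.1 hx).1
      have hinj := (Finset.mem_filter.1 hx).2.2
      have hqp := (Nat.prime_dvd_prime_iff_eq (Nat.prime_of_mem_primeFactors hq) hp).1
        (Nat.dvd_of_mem_primeFactors hq)
      subst hqp
      refine ⟨fun i hdvd => ?_, fun i j hij => hinj ?_⟩
      · exact absurd (Nat.le_of_dvd (hC0 _ (hx' i)) hdvd) (by have := hlt x hx' i; omega)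
      · rwa [Nat.ModEq, Nat.mod_eq_of_lt (hlt x hx' i), Nat.mod_eq_of_lt (hlt x hx' j)] at hij
    · intro x hx x' hx' j
      have h1 := (Finset.mem_filter.1 hx).2.1 j
      have h2 := (Finset.mem_filter.1 hx').2.1 j
      have h3 : ∑ i, (x' i : ℤ) ^ (h + j : ℕ) = ∑ i, (x i : ℤ) ^ (h + j : ℕ) := by
        exact_mod_cast h2.trans h1.symm
      rw [h3, sub_self]
      exact dvd_zero _
    · rw [hp.primeFactors, Finset.card_singleton, pow_one]
  have hS2card : S2.card ≤ C.card ^ t * (t * k + 1) ^ t := by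
    have hmap : ∀ xy ∈ S2, xy.2 ∈ Fintype.piFinset fun _ : Fin t => C := fun xy hxy =>
      (Finset.mem_product.1 (Finset.mem_filter.1 hxy).1).2
    rw [Finset.card_eq_sum_card_fiberwise hmap]
    calc _ ≤ ∑ _y ∈ Fintype.piFinset fun _ : Fin t => C, (t * k + 1) ^ t := by
          refine Finset.sum_le_sum fun y _ => le_trans ?_ (hfib y)
          refine Finset.card_le_card_of_injOn Prod.fst ?_ ?_
          · rintro ⟨x, y'⟩ hxy
            simp only [Finset.coe_filter, Set.mem_ofPred_eq, S2, h𝒞, Finset.mem_filter,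
              Finset.mem_product] at hxy ⊢
            obtain ⟨⟨⟨hx, -⟩, heq, hinj⟩, rfl⟩ := hxy
            exact ⟨hx, heq, hinj⟩
          · rintro ⟨x, y1⟩ h1 ⟨x', y2⟩ h2 (rfl : x = x')
            have h3 := (Finset.mem_filter.1 h1).2
            have h4 := (Finset.mem_filter.1 h2).2
            simp only at h3 h4
            rw [h3, h4]
      _ = _ := by simp
  have hfin : X ≤ S1.card + S2.card := by
    rw [hX, vCount]
    exact_mod_cast (Finset.card_le_card hcover).trans (Finset.card_union_le _ _)
  have h5 : (S2.card : ℝ) ≤ ((t * k + 1) ^ t : ℕ) * (C.card : ℝ) ^ t := by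
    rw [mul_comm]; exact_mod_cast hS2card
  linarith

lemma mul_log_le_of_le_mul_rpow {J a δ : ℝ} (hJ : 0 < J) (ha : 0 < a) (h : J ≤ a * J ^ (1 - δ)) :
    δ * Real.log J ≤ Real.log a := by
  have h1 := Real.log_le_log hJ h
  rw [Real.log_mul ha.ne' (Real.rpow_pos_of_pos hJ _).ne', Real.log_rpow hJ] at h1
  linarith

lemma log_vCount_self_le {h t k : ℕ} (ht : 1 ≤ t) (htk : t + 1 ≤ k) (hhk : h + t = k + 1)
    (hh : 1 ≤ h) {Q R : ℝ} (hQ : 1 ≤ Q) :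
    Real.log (vCount h t t (smoothSet Q R)) ≤
      t * (4 * Real.log k + Real.log (smoothSet Q R).card) := by
  set C := smoothSet Q R with hC
  have hJ1 : 1 ≤ vCount h t t C := one_le_vCount hQ
  have hJ : (1 : ℝ) ≤ vCount h t t C := by exact_mod_cast hJ1
  have hC1 : (1 : ℝ) ≤ C.card := by exact_mod_cast one_le_card_smoothSet hQ
  have hmain := vCount_self_le hhk hh (fun n hn => (mem_smoothSet.1 hn).1) hJ1
  set J : ℝ := (vCount h t t C : ℝ) with hJdef
  have ht' : (1 : ℝ) ≤ t := by exact_mod_cast ht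
  have htk' : (t : ℝ) + 1 ≤ k := by exact_mod_cast htk
  have hk0 : (0 : ℝ) < k := by linarith
  have hlk : Real.log 2 ≤ Real.log k := Real.log_le_log two_pos (by linarith)
  have hlk0 : 0 < Real.log 2 := Real.log_pos one_lt_two
  rw [show ((2 * t - 2 : ℕ) : ℝ) / (2 * t : ℕ) = 1 - 1 / t by
    rw [Nat.cast_sub (by omega)]; push_cast; field_simp] at hmain
  rcases le_or_gt (J / 2) (t ^ 2 * C.card * J ^ (1 - 1 / (t : ℝ))) with h1 | h1
  · have h2 := mul_log_le_of_le_mul_rpow (a := 2 * t ^ 2 * C.card) (J := J) (δ := 1 / t)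
      (by linarith) (by positivity) (by linarith)
    rw [Real.log_mul (by positivity) (by positivity), one_div_mul_eq_div,
      div_le_iff₀' (by linarith)] at h2
    have h3 : Real.log (2 * t ^ 2) ≤ 4 * Real.log k := by
      rw [Real.log_mul two_ne_zero (by positivity), Real.log_pow]
      have : Real.log t ≤ Real.log k := Real.log_le_log (by linarith) (by linarith)
      push_cast
      linarith
    refine h2.trans ?_
    gcongr
  · have h2 : J ≤ 2 * (((t * k + 1) ^ t : ℕ) * (C.card : ℝ) ^ t) := by linarith
    have h3 := Real.log_le_log (by linarith) h2
    push_cast at h3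
    rw [Real.log_mul two_ne_zero (by positivity), Real.log_mul (by positivity) (by positivity),
      Real.log_pow, Real.log_pow] at h3
    have h4 : Real.log (t * k + 1) ≤ 2 * Real.log k := by
      rw [← Nat.cast_two (R := ℝ), ← Real.log_pow]
      exact Real.log_le_log (by positivity) (by nlinarith)
    have h5 : (t : ℝ) * Real.log (t * k + 1) ≤ t * (2 * Real.log k) := by gcongr
    nlinarith

lemma log_vCount_le_of_le {h t k s : ℕ} (ht : 1 ≤ t) (htk : t + 1 ≤ k) (hhk : h + t = k + 1)
    (hh : 1 ≤ h) (hs : s ≤ t) {Q R : ℝ} (hQ : 1 ≤ Q) :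
    Real.log (vCount h t s (smoothSet Q R)) ≤
      s * (4 * Real.log k + Real.log (smoothSet Q R).card) := by
  have h1 := log_vCount_self_le ht htk hhk hh hQ (R := R)
  have h2 := vCount_le_rpow (h := h) (t := t) ht hs (one_le_vCount (h := h) (t := t) (s := t)
    (R := R) hQ)
  have hs1 : (1 : ℝ) ≤ vCount h t s (smoothSet Q R) := by
    exact_mod_cast one_le_vCount (h := h) (t := t) (s := s) (R := R) hQ
  have ht1 : (1 : ℝ) ≤ vCount h t t (smoothSet Q R) := by
    exact_mod_cast one_le_vCount (h := h) (t := t) (s := t) (R := R) hQ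
  have h3 := Real.log_le_log (by linarith) h2
  rw [Real.log_rpow (by linarith)] at h3
  have ht0 : (0 : ℝ) < t := by exact_mod_cast ht
  calc _ ≤ _ := h3
    _ ≤ (s : ℝ) / t * (t * (4 * Real.log k + Real.log (smoothSet Q R).card)) := by gcongr
    _ = _ := by field_simp

lemma pos_and_log_le_of_le_mul_rpow {J W A m : ℝ} (hJ : 1 ≤ J) (hA : 0 < A) (hm : 0 < m)
    (h : 3 * J / 4 ≤ A * (W * J ^ (1 - 1 / m))) :
    0 < W ∧ Real.log J ≤ m * (Real.log (4 / 3 * A) + Real.log W) := by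
  have hJp : 0 < J ^ (1 - 1 / m) := Real.rpow_pos_of_pos (by linarith) _
  have hW : 0 < W := by
    by_contra! hneg
    have : A * (W * J ^ (1 - 1 / m)) ≤ 0 :=
      mul_nonpos_of_nonneg_of_nonpos hA.le (mul_nonpos_of_nonpos_of_nonneg hneg hJp.le)
    linarith
  refine ⟨hW, ?_⟩
  have h2 := mul_log_le_of_le_mul_rpow (a := 4 / 3 * A * W) (J := J) (δ := 1 / m)
    (by linarith) (by positivity) (by linarith)
  rwa [Real.log_mul (by positivity) (by positivity), one_div_mul_eq_div,
    div_le_iff₀' hm] at h2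

lemma log_vCount_add_le {k h t s : ℕ} {Q R M β B : ℝ} (ht : 1 ≤ t) (hs : 1 ≤ s)
    (hhk : h + t = k + 1) (hh : 1 ≤ h) (hQ : 1 ≤ Q) (hR : 1 < R) (hM : 1 ≤ M) (hMQ : Q ≤ M ^ h)
    (hkR : (k : ℝ) ≤ √R)
    (hβ : M * (Real.exp 1 * (t ^ 2 + 1)) ^ (2 * Real.log Q / Real.log R) ≤ β)
    (hB1 : 1 ≤ B) (hB : ∀ q ∈ smoothSet (M * R) R,
      (((t * k + 1) ^ t : ℕ) : ℝ) ^ q.primeFactors.card ≤ B) :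
    Real.log (vCount h t (s + t) (smoothSet Q R)) ≤
      (s + t) * (Real.log (8 * t ^ 2) + Real.log (smoothSet Q R).card) ∨
    (s + 2 * t) * Real.log (vCount h t (s + t) (smoothSet Q R)) ≤
      2 * (s + t) * ((2 * s + t + 3) * Real.log 2 + t * Real.log (smoothSet Q R).card +
        (s + t) * Real.log β) ∨
    (0 < (∑ q ∈ (smoothSet (M * R) R).filter fun q : ℕ => M < q ∧ (q : ℝ) ≤ Q,
          (B * ((smoothSet Q R).card : ℝ) ^ t * vCount h t s (smoothSet (Q / q) R)) ^
            (1 / (2 * s : ℝ))) ∧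
      Real.log (vCount h t (s + t) (smoothSet Q R)) ≤
      2 * s * (Real.log (4 / 3 * ((2 * s + t : ℝ) / (s + 1))) +
        Real.log (∑ q ∈ (smoothSet (M * R) R).filter fun q : ℕ => M < q ∧ (q : ℝ) ≤ Q,
          (B * ((smoothSet Q R).card : ℝ) ^ t * vCount h t s (smoothSet (Q / q) R)) ^
            (1 / (2 * s : ℝ)))) ) := by
  have hmain := vCount_add_le ht hs hhk hh hQ hR hM hMQ hkR hβ hB1 hB
  have hJ : (1 : ℝ) ≤ vCount h t (s + t) (smoothSet Q R) := by
    exact_mod_cast one_le_vCount (h := h) (t := t) (s := s + t) (R := R) hQ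
  have hC1 : (1 : ℝ) ≤ (smoothSet Q R).card := by exact_mod_cast one_le_card_smoothSet hQ
  set J : ℝ := (vCount h t (s + t) (smoothSet Q R) : ℝ)
  set c : ℝ := ((smoothSet Q R).card : ℝ)
  set W := ∑ q ∈ (smoothSet (M * R) R).filter fun q : ℕ => M < q ∧ (q : ℝ) ≤ Q,
    (B * c ^ t * vCount h t s (smoothSet (Q / q) R)) ^ (1 / (2 * s : ℝ))
  have ht' : (1 : ℝ) ≤ t := by exact_mod_cast ht
  have hs' : (1 : ℝ) ≤ s := by exact_mod_cast hs
  have hβ0 : 0 < β := lt_of_lt_of_le (by positivity) hβ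
  rw [show ((2 * (s + t) - 2 : ℕ) : ℝ) / (2 * (s + t) : ℕ) = 1 - 1 / (s + t) by
      rw [Nat.cast_sub (by omega)]; push_cast; field_simp,
    show (s : ℝ) / (2 * (s + t) : ℕ) = 1 - (s + 2 * t) / (2 * (s + t)) by
      push_cast; field_simp; ring] at hmain
  have hcases : J / 8 ≤ t ^ 2 * c * J ^ (1 - 1 / (s + t : ℝ)) ∨
      J / 8 ≤ 2 ^ (2 * s + t) * c ^ t * β ^ (s + t) *
        J ^ (1 - (s + 2 * t : ℝ) / (2 * (s + t))) ∨
      3 * J / 4 ≤ (2 * s + t : ℝ) / (s + 1) * (W * J ^ (1 - 1 / (2 * s : ℝ))) := by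
    by_contra! hcon
    linarith [hcon.1, hcon.2.1, hcon.2.2]
  rcases hcases with h1 | h1 | h1
  · left
    have h2 := mul_log_le_of_le_mul_rpow (a := 8 * t ^ 2 * c) (J := J) (δ := 1 / (s + t))
      (by linarith) (by positivity) (by linarith)
    rwa [Real.log_mul (by positivity) (by positivity), one_div_mul_eq_div,
      div_le_iff₀' (by linarith)] at h2
  · right; left
    have h2 := mul_log_le_of_le_mul_rpow (a := 2 ^ (2 * s + t + 3) * c ^ t * β ^ (s + t)) (J := J)
      (δ := (s + 2 * t) / (2 * (s + t))) (by linarith) (by positivity) (by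
        rw [pow_add 2 _ 3]; linarith)
    rw [Real.log_mul (by positivity) (by positivity), Real.log_mul (by positivity) (by positivity),
      Real.log_pow, Real.log_pow, Real.log_pow, div_mul_eq_mul_div,
      div_le_iff₀' (by positivity)] at h2
    push_cast at h2
    exact h2
  · right; right
    exact pos_and_log_le_of_le_mul_rpow hJ (by positivity) (by positivity) h1

/-- The numerical hypotheses under which the recursion is run: `R = exp ρ`, `P = exp (ρ / η)`. -/
structure Admissible (k h t : ℕ) (η ρ w : ℝ) : Prop where
  sixty_le : 60 ≤ k
  add_eq : h + t = k + 1
  three_le : 3 ≤ t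
  le_h : 0.9 * (k : ℝ) ≤ h
  lt_eta : 2 / (k : ℝ) ^ 3 < η
  eta_le : η ≤ 1 / (2 * (k : ℝ))
  le_w : 18 / (k : ℝ) ≤ w
  w_le : w ≤ 0.4
  log_le : 4 * Real.log k ≤ w * ρ

/-- The saving exponent in the count of smooth numbers. -/
noncomputable def saving (η ρ : ℝ) : ℝ := (1 + Real.log (1 / (10 * η))) / ρ

/-- The additive constant in the logarithmic count of smooth numbers. -/
noncomputable def cardConst (η : ℝ) : ℝ := 1.12 * (Real.exp 1 / (10 * η))

/-- The initial constant of the recursion. -/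
noncomputable def initConst (k t : ℕ) (η w : ℝ) : ℝ :=
  Real.log k * (2.625 * w * k - 6) * t / η

/-- The logarithm of the constant lost in each step of the recursion. -/
noncomputable def stepConst : ℝ := 2 * (Real.log (8 / 3) + 1.12)

namespace Admissible

variable {k h t : ℕ} {η ρ w : ℝ}

lemma sixty_le' (H : Admissible k h t η ρ w) : (60 : ℝ) ≤ k := by exact_mod_cast H.sixty_le

lemma four_le_log (H : Admissible k h t η ρ w) : 4 ≤ Real.log k := by
  rw [Real.le_log_iff_exp_le (by linarith [H.sixty_le'])]
  have h1 : Real.exp 4 = Real.exp 1 ^ 4 := by rw [← Real.exp_nat_mul]; norm_num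
  have h2 : Real.exp 1 ^ 4 ≤ 2.7182818286 ^ 4 :=
    pow_le_pow_left₀ (Real.exp_pos 1).le Real.exp_one_lt_d9.le 4
  rw [h1]
  refine h2.trans (le_trans (by norm_num) H.sixty_le')

lemma eta_pos (H : Admissible k h t η ρ w)
    : 0 < η := lt_trans (div_pos two_pos (pow_pos (by linarith [H.sixty_le']) 3)) H.lt_eta

lemma w_pos (H : Admissible k h t η ρ w)
    : 0 < w := lt_of_lt_of_le (div_pos (by norm_num) (by linarith [H.sixty_le'])) H.le_w

lemma le_rho (H : Admissible k h t η ρ w) : 10 * Real.log k ≤ ρ := by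
  have h1 := H.log_le
  have h2 := H.four_le_log
  have h3 := H.w_le
  have h4 := H.w_pos
  have h5 : 0 < ρ := by
    by_contra! hc
    nlinarith
  nlinarith

lemma forty_le (H : Admissible k h t η ρ w) : 40 ≤ ρ := by linarith [H.le_rho, H.four_le_log]

lemma t_le (H : Admissible k h t η ρ w) : (t : ℝ) ≤ 0.1 * k + 1 := by
  have h1 : (h : ℝ) + t = k + 1 := by exact_mod_cast H.add_eq
  linarith [H.le_h]

lemma three_le' (H : Admissible k h t η ρ w) : (3 : ℝ) ≤ t := by exact_mod_cast H.three_le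

lemma fifty_le (H : Admissible k h t η ρ w) : (54 : ℝ) ≤ h := by linarith [H.le_h, H.sixty_le']

lemma t_le_h (H : Admissible k h t η ρ w)
    : (t : ℝ) ≤ 0.13 * h := by linarith [H.t_le, H.le_h, H.sixty_le']

lemma inv_le (H : Admissible k h t η ρ w) : 1 / (10 * η) ≤ (k : ℝ) ^ 3 / 20 := by
  have h1 := H.lt_eta
  have h2 := H.eta_pos
  have h3 : (0 : ℝ) < (k : ℝ) ^ 3 := pow_pos (by linarith [H.sixty_le']) 3
  rw [div_lt_iff₀ h3] at h1
  rw [div_le_div_iff₀ (by linarith) (by norm_num)]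
  nlinarith

lemma twelve_le (H : Admissible k h t η ρ w) : 12 ≤ 1 / (10 * η) := by
  have h1 := H.eta_le
  have h2 := H.eta_pos
  have h3 := H.sixty_le'
  rw [le_div_iff₀ (by linarith)] at h1 ⊢
  nlinarith

lemma log_inv_le (H : Admissible k h t η ρ w)
    : 1 + Real.log (1 / (10 * η)) ≤ 3 * Real.log k - 1.9 := by
  have hk := H.sixty_le'
  have h1 := Real.log_le_log (by linarith [H.twelve_le]) H.inv_le
  rw [Real.log_div (x := (k : ℝ) ^ 3) (by positivity) (by norm_num), Real.log_pow] at h1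
  have h2 : (2.9 : ℝ) ≤ Real.log 20 := by
    rw [Real.le_log_iff_exp_le (by norm_num)]
    have h3 : Real.exp 2.9 ^ 10 = Real.exp 1 ^ 29 := by
      rw [← Real.exp_nat_mul, ← Real.exp_nat_mul]; norm_num
    have h4 : Real.exp 1 ^ 29 ≤ 2.7182818286 ^ 29 :=
      pow_le_pow_left₀ (Real.exp_pos 1).le Real.exp_one_lt_d9.le 29
    refine le_of_pow_le_pow_left₀ (n := 10) (by norm_num) (by norm_num) ?_
    rw [h3]
    exact h4.trans (by norm_num)
  push_cast at h1
  linarith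

lemma log_inv_nonneg (H : Admissible k h t η ρ w) : 0 ≤ Real.log (1 / (10 * η)) :=
  Real.log_nonneg (by linarith [H.twelve_le])

lemma saving_pos (H : Admissible k h t η ρ w) : 0 < saving η ρ :=
  div_pos (by linarith [H.log_inv_nonneg]) (by linarith [H.forty_le])

lemma saving_mul (H : Admissible k h t η ρ w) : saving η ρ * ρ = 1 + Real.log (1 / (10 * η)) :=
  div_mul_cancel₀ _ (by linarith [H.forty_le])

lemma saving_lt_one (H : Admissible k h t η ρ w) : saving η ρ < 1 := by
  rw [saving, div_lt_one (by linarith [H.forty_le])]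
  linarith [H.log_inv_le, H.le_rho, H.four_le_log]

lemma exp_rho_rpow (H : Admissible k h t η ρ w)
    : Real.exp ρ ^ saving η ρ = Real.exp 1 / (10 * η) := by
  rw [← Real.exp_mul, mul_comm, H.saving_mul, Real.exp_add,
    Real.exp_log (by linarith [H.twelve_le])]
  ring

lemma pow_five_le (H : Admissible k h t η ρ w) : (k : ℝ) ^ 5 ≤ √(Real.exp ρ) := by
  have hk := H.sixty_le'
  rw [Real.sqrt_eq_rpow, ← Real.exp_mul]
  calc (k : ℝ) ^ 5 = Real.exp (Real.log ((k : ℝ) ^ 5)) := by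
        rw [Real.exp_log (by positivity)]
    _ ≤ _ := by
        rw [Real.log_pow]
        push_cast
        exact Real.exp_le_exp.2 (by linarith [H.le_rho])

lemma log_card_le (H : Admissible k h t η ρ w) {Q : ℝ} (hQ : 1 ≤ Q) :
    Real.log (smoothSet Q (Real.exp ρ)).card ≤
      cardConst η + (1 - saving η ρ) * Real.log Q := by
  have hk := H.sixty_le'
  have h1 := card_smoothSet_le (Q := Q) (R := Real.exp ρ) (ε := saving η ρ) (by linarith)
    (Real.exp_pos _) (by rw [Real.log_exp]; exact H.forty_le) H.saving_pos.le H.saving_lt_one (by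
      rw [H.exp_rho_rpow]
      refine le_trans ?_ H.pow_five_le
      have h2 : Real.exp 1 / (10 * η) = Real.exp 1 * (1 / (10 * η)) := by ring
      have h3 : Real.exp 1 * (1 / (10 * η)) ≤ 2.7182818286 * ((k : ℝ) ^ 3 / 20) :=
        mul_le_mul Real.exp_one_lt_d9.le H.inv_le (by linarith [H.twelve_le]) (by norm_num)
      rw [h2]
      have h4 : 3600 * (k : ℝ) ^ 3 ≤ (k : ℝ) ^ 2 * (k : ℝ) ^ 3 := by
        gcongr
        nlinarith
      have h5 : 0 ≤ (k : ℝ) ^ 3 := by positivity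
      rw [show (k : ℝ) ^ 5 = (k : ℝ) ^ 2 * (k : ℝ) ^ 3 by ring]
      linarith)
  have h2 := Real.log_le_log (by exact_mod_cast one_le_card_smoothSet hQ) h1
  rwa [Real.log_mul (Real.exp_pos _).ne' (Real.rpow_pos_of_pos (by linarith) _).ne', Real.log_exp,
    Real.log_rpow (by linarith), H.exp_rho_rpow] at h2

lemma cardConst_pos (H : Admissible k h t η ρ w) : 0 < cardConst η := by
  have := H.eta_pos
  unfold cardConst
  positivity

lemma le_initConst (H : Admissible k h t η ρ w)
    : 41.25 * t * Real.log k / η ≤ initConst k t η w := by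
  have h1 := H.le_w
  have hk := H.sixty_le'
  have h2 := H.eta_pos
  rw [div_le_iff₀ (by linarith)] at h1
  have h3 : 0 ≤ (t : ℝ) * Real.log k / η := by
    have := H.four_le_log
    positivity
  calc 41.25 * t * Real.log k / η = 41.25 * (t * Real.log k / η) := by ring
    _ ≤ (2.625 * w * k - 6) * (t * Real.log k / η) := by
        gcongr
        linarith
    _ = _ := by unfold initConst; ring

lemma initConst_nonneg (H : Admissible k h t η ρ w) : 0 ≤ initConst k t η w := by
  refine le_trans ?_ H.le_initConst
  have := H.eta_pos
  have := H.four_le_log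
  positivity

lemma saving_le (H : Admissible k h t η ρ w)
    : saving η ρ ≤ 0.75 * (4 * Real.log k / ρ) - 1.9 * (1 / ρ) := by
  have h1 := H.log_inv_le
  have h2 : 0 < ρ := by linarith [H.forty_le]
  rw [saving, show 0.75 * (4 * Real.log k / ρ) - 1.9 * (1 / ρ) = (3 * Real.log k - 1.9) / ρ by ring]
  gcongr

lemma log_le_three_add (H : Admissible k h t η ρ w) : Real.log k ≤ 3 + k / 54 := by
  have hk := H.sixty_le'
  have h1 := Real.log_le_sub_one_of_pos (show (0 : ℝ) < k * Real.exp (-4) by positivity)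
  have h2 : Real.exp (-4) ≤ 1 / 54 := by
    rw [Real.exp_neg, ← one_div]
    gcongr
    have h1 : Real.exp 4 = Real.exp 1 ^ 4 := by rw [← Real.exp_nat_mul]; norm_num
    rw [h1]
    exact le_trans (by norm_num) (pow_le_pow_left₀ (by norm_num) Real.exp_one_gt_d9.le 4)
  rw [Real.log_mul (by positivity) (by positivity), Real.log_exp] at h1
  have h3 : k * Real.exp (-4) ≤ k * (1 / 54) := by gcongr
  linarith

set_option maxHeartbeats 800000 in
lemma excess_mul_le (H : Admissible k h t η ρ w)
    {s : ℕ} (hs : 1 ≤ s) (hsh : 2 * ((s : ℝ) + t) ≤ h * t) {y : ℝ} (hy0 : 0 ≤ y)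
    (hy : y ≤ ρ / η) :
    (2 * ((s : ℝ) + t) * (1 / h + 2 * (2 * Real.log k - 1) / ρ) - (1 - saving η ρ) * s) * y ≤
      initConst k t η w := by
  have hρ : 0 < ρ := by linarith [H.forty_le]
  have hη := H.eta_pos
  have hk := H.sixty_le'
  have hl := H.four_le_log
  have ht3 := H.three_le'
  have hth := H.t_le_h
  have hh := H.fifty_le
  have hs1 : (1 : ℝ) ≤ s := by exact_mod_cast hs
  set ω : ℝ := 4 * Real.log k / ρ with hω
  set r : ℝ := 1 / ρ with hr
  have hr0 : 0 < r := by positivity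
  have hω0 : 0 < ω := by positivity
  have hωw : ω ≤ w := by rw [hω, div_le_iff₀ hρ]; exact H.log_le
  have hω4 : ω ≤ 0.4 := hωw.trans H.w_le
  have hωy : ω * y ≤ 4 * Real.log k / η := by
    calc ω * y ≤ ω * (ρ / η) := by gcongr
      _ = _ := by rw [hω]; field_simp
  have hε := H.saving_le
  rw [← hω, ← hr] at hε
  have hεs : saving η ρ * s ≤ (0.75 * ω - 1.9 * r) * s := by gcongr
  have hdiv : 2 * (2 * Real.log k - 1) / ρ = ω - 2 * r := by rw [hω, hr]; ring
  rw [hdiv]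
  set i : ℝ := 1 / (h : ℝ) with hi
  have hi0 : 0 < i := by positivity
  have hi54 : i ≤ 1 / 54 := by rw [hi]; gcongr
  have hti : t * i ≤ 0.13 := by
    rw [hi, mul_one_div, div_le_iff₀ (by linarith)]; exact hth
  have hζ := H.le_initConst
  have hlη : 0 < Real.log k / η := by positivity
  rcases le_total (s : ℝ) t with hst | hst
  · have hE : 2 * ((s : ℝ) + t) * (i + (ω - 2 * r)) - (1 - saving η ρ) * s ≤ 3 * t * ω := by
      have e1 : (s : ℝ) * i ≤ s * (1 / 54) := by gcongr
      have e2 : 0 ≤ r * s := by positivity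
      have e3 : 0 ≤ r * t := by positivity
      have e4 : 0 ≤ (t - s) * ω := mul_nonneg (by linarith) hω0.le
      have e5 : ω * s ≤ 0.4 * s := by gcongr
      nlinarith
    calc _ ≤ 3 * t * ω * y := by gcongr
      _ = 3 * t * (ω * y) := by ring
      _ ≤ 3 * t * (4 * Real.log k / η) := by gcongr
      _ = 12 * (t * (Real.log k / η)) := by ring
      _ ≤ 41.25 * (t * (Real.log k / η)) := by gcongr; norm_num
      _ = 41.25 * t * Real.log k / η := by ring
      _ ≤ _ := hζ
  · have e1 : t * i ≤ s * i := by gcongr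
    have e2 : 0 ≤ r * t := by positivity
    have e2' : 0 ≤ r * s := by positivity
    rcases le_or_gt ω 0.33 with hω3 | hω3
    · have hE : 2 * ((s : ℝ) + t) * (i + (ω - 2 * r)) - (1 - saving η ρ) * s ≤ 2 * t * ω := by
        have e3 : (s : ℝ) * i ≤ s * (1 / 54) := by gcongr
        have e5 : ω * s ≤ 0.33 * s := by gcongr
        nlinarith
      calc _ ≤ 2 * t * ω * y := by gcongr
        _ = 2 * t * (ω * y) := by ring
        _ ≤ 2 * t * (4 * Real.log k / η) := by gcongr
        _ = 8 * (t * (Real.log k / η)) := by ring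
        _ ≤ 41.25 * (t * (Real.log k / η)) := by gcongr; norm_num
        _ = 41.25 * t * Real.log k / η := by ring
        _ ≤ _ := hζ
    · have hlk := H.log_le_three_add
      have hi4 : 4 * i ≤ 5.9 * r := by
        rw [hi, hr, mul_one_div, mul_one_div, div_le_div_iff₀ (by linarith) hρ]
        rw [hω, lt_div_iff₀ hρ] at hω3
        nlinarith [H.le_h]
      have hE : 2 * ((s : ℝ) + t) * (i + (ω - 2 * r)) - (1 - saving η ρ) * s ≤
          (2 * t + s / 4) * ω := by
        have e3 : (s : ℝ) * (4 * i) ≤ s * (5.9 * r) := by gcongr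
        have e5 : ω * s ≤ 0.4 * s := by gcongr
        nlinarith
      have hhk : (h : ℝ) ≤ k := by
        have : (h : ℝ) + t = k + 1 := by exact_mod_cast H.add_eq
        linarith
      have e9 : 8 * (t : ℝ) + s ≤ (2.625 * w * k - 6) * t := by
        have e6 : (h : ℝ) * t ≤ k * t := by gcongr
        have e7 : 0.33 * (k * t : ℝ) ≤ w * (k * t) :=
          mul_le_mul_of_nonneg_right (hω3.le.trans hωw) (by positivity)
        have e8 : (60 : ℝ) * t ≤ k * t := by gcongr
        linarith
      calc _ ≤ (2 * t + s / 4) * ω * y := by gcongr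
        _ = (2 * t + s / 4) * (ω * y) := by ring
        _ ≤ (2 * t + s / 4) * (4 * Real.log k / η) := by gcongr
        _ = (8 * t + s) * (Real.log k / η) := by ring
        _ ≤ ((2.625 * w * k - 6) * t) * (Real.log k / η) := mul_le_mul_of_nonneg_right e9 hlη.le
        _ = _ := by unfold initConst; ring

end Admissible

lemma log_sum_rpow_le {s : ℕ} {Q' R X δ B c : ℝ} {f : ℕ → ℝ} (hs : 1 ≤ s) (hQ' : 1 ≤ Q')
    (hR0 : 0 < R) (hR : 40 ≤ Real.log R) (hδ : 0 ≤ δ) (p : ℕ → Prop) [DecidablePred p]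
    (hBc : 0 ≤ B * c) (hf : ∀ q ∈ smoothSet Q' R, p q → 0 ≤ f q)
    (hle : ∀ q ∈ smoothSet Q' R, p q →
      B * c * f q ≤ Real.exp (X + 2 * s * (-1 + δ) * Real.log q))
    (hpos : 0 < ∑ q ∈ (smoothSet Q' R).filter p, (B * c * f q) ^ (1 / (2 * s : ℝ))) :
    Real.log (∑ q ∈ (smoothSet Q' R).filter p, (B * c * f q) ^ (1 / (2 * s : ℝ))) ≤
      X / (2 * s) + 1.12 + δ * Real.log Q' := by
  have hs' : (0 : ℝ) < s := by exact_mod_cast hs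
  have hterm : ∀ q ∈ (smoothSet Q' R).filter p, (B * c * f q) ^ (1 / (2 * s : ℝ)) ≤
      Real.exp (X / (2 * s)) * (q : ℝ) ^ (-1 + δ) := by
    intro q hq
    obtain ⟨hq, hpq⟩ := mem_filter.1 hq
    have hq0 : (0 : ℝ) < q := by exact_mod_cast (mem_smoothSet.1 hq).1
    calc (B * c * f q) ^ (1 / (2 * s : ℝ))
        ≤ (Real.exp (X + 2 * s * (-1 + δ) * Real.log q)) ^ (1 / (2 * s : ℝ)) :=
          Real.rpow_le_rpow (mul_nonneg hBc (hf q hq hpq)) (hle q hq hpq) (by positivity)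
      _ = _ := by
          rw [← Real.exp_mul, Real.rpow_def_of_pos hq0, ← Real.exp_add]
          congr 1
          field_simp
  have hsum : ∑ q ∈ (smoothSet Q' R).filter p, (B * c * f q) ^ (1 / (2 * s : ℝ)) ≤
      Real.exp (X / (2 * s)) * (Real.exp 1.12 * Q' ^ δ) := by
    calc _ ≤ ∑ q ∈ (smoothSet Q' R).filter p,
          Real.exp (X / (2 * s)) * (q : ℝ) ^ (-1 + δ) := sum_le_sum hterm
      _ ≤ ∑ q ∈ smoothSet Q' R, Real.exp (X / (2 * s)) * (q : ℝ) ^ (-1 + δ) :=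
          sum_le_sum_of_subset_of_nonneg (filter_subset _ _) fun q _ _ => by positivity
      _ ≤ _ := by
          rw [← mul_sum]
          gcongr
          exact sum_smoothSet_rpow_neg_le (by linarith) hR0 hR hδ
  have h1 := Real.log_le_log hpos hsum
  rw [Real.log_mul (by positivity) (by positivity),
    Real.log_mul (by positivity) (Real.rpow_pos_of_pos (by linarith) _).ne', Real.log_exp,
    Real.log_exp, Real.log_rpow (by linarith)] at h1
  linarith

namespace Admissible

variable {k h t : ℕ} {η ρ w : ℝ}

lemma t_le_k (H : Admissible k h t η ρ w) : (t : ℝ) + 1 ≤ k := by linarith [H.t_le, H.sixty_le']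

lemma h_pos (H : Admissible k h t η ρ w) : 1 ≤ h := by
  have := H.fifty_le
  exact_mod_cast (by linarith : (1 : ℝ) ≤ h)

lemma exp_sq_le (H : Admissible k h t η ρ w) {y : ℝ} (hy : 0 ≤ y) :
    (Real.exp 1 * ((t : ℝ) ^ 2 + 1)) ^ (2 * y / ρ) ≤
      Real.exp ((2 * Real.log k - 1) * (2 * y / ρ)) := by
  have hρ : 0 < ρ := by linarith [H.forty_le]
  have hk := H.sixty_le'
  have ht := H.t_le
  have ht3 := H.three_le'
  rw [Real.exp_mul]
  gcongr
  have h1 : Real.exp (2 * Real.log k) = (k : ℝ) ^ 2 := by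
    rw [two_mul, Real.exp_add, Real.exp_log (by linarith), sq]
  rw [sub_eq_add_neg, Real.exp_add, h1, Real.exp_neg, ← div_eq_mul_inv,
    le_div_iff₀ (Real.exp_pos 1)]
  have h2 : Real.exp 1 * Real.exp 1 ≤ 2.72 * 2.72 := by
    gcongr <;> linarith [Real.exp_one_lt_d9]
  have h3 : ((t : ℝ) ^ 2 + 1) ≤ 0.0139 * (k : ℝ) ^ 2 := by nlinarith
  calc _ = ((t : ℝ) ^ 2 + 1) * (Real.exp 1 * Real.exp 1) := by ring
    _ ≤ 0.0139 * (k : ℝ) ^ 2 * (2.72 * 2.72) := by gcongr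
    _ ≤ _ := by nlinarith

lemma pow_card_primeFactors_le (H : Admissible k h t η ρ w) {y : ℝ} (hy : y ≤ ρ / η) {q : ℕ}
    (hq : q ∈ smoothSet (Real.exp (y / h) * Real.exp ρ) (Real.exp ρ)) :
    (((t * k + 1) ^ t : ℕ) : ℝ) ^ q.primeFactors.card ≤
      Real.exp ((4 * t + 4 * t / (h * η)) * Real.log k) := by
  have hρ : 0 < ρ := by linarith [H.forty_le]
  have hk := H.sixty_le'
  have ht := H.t_le
  have hη := H.eta_pos
  have ht3 := H.three_le'
  have hh := H.fifty_le
  have hl := H.four_le_log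
  obtain ⟨hq1, hq2, hq3⟩ := mem_smoothSet.1 hq
  have hq0 : (1 : ℝ) ≤ q := by exact_mod_cast hq1
  have h1 := card_large_primeFactors_mul_log_le (Real.exp_pos ρ) q (by omega) q.primeFactors
    subset_rfl (fun p hp => (hq3 p (Nat.prime_of_mem_primeFactors hp)
      (Nat.dvd_of_mem_primeFactors hp)).1)
  have h2 := Real.log_le_log (by linarith) hq2
  rw [← Real.exp_add, Real.log_exp] at h2
  rw [Real.log_exp] at h1
  have h3 : (q.primeFactors.card : ℝ) ≤ 2 + 2 / (h * η) := by
    have h4 : y / h ≤ ρ / η / h := by gcongr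
    have h5 : (q.primeFactors.card : ℝ) * ρ ≤ (2 + 2 / (h * η)) * ρ := by
      calc _ ≤ 2 * Real.log q := h1
        _ ≤ 2 * (ρ / η / h + ρ) := by linarith
        _ = _ := by field_simp; ring
    exact le_of_mul_le_mul_right h5 hρ
  have h6 : Real.log (t * k + 1) ≤ 2 * Real.log k := by
    rw [← Nat.cast_two (R := ℝ), ← Real.log_pow]
    exact Real.log_le_log (by positivity) (by nlinarith)
  rw [← Real.exp_log (show (0 : ℝ) < (((t * k + 1) ^ t : ℕ) : ℝ) ^ q.primeFactors.card by
    positivity), Real.log_pow]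
  push_cast
  rw [Real.log_pow]
  refine Real.exp_le_exp.2 ?_
  have h7 : 0 ≤ Real.log ((t : ℝ) * k + 1) := Real.log_nonneg (by nlinarith)
  calc (q.primeFactors.card : ℝ) * (t * Real.log (t * k + 1))
      ≤ (2 + 2 / (h * η)) * (t * (2 * Real.log k)) := by
        gcongr
    _ = _ := by field_simp; ring

lemma log_eight_sq_le (H : Admissible k h t η ρ w)
    : Real.log (8 * (t : ℝ) ^ 2) ≤ 4 * Real.log k := by
  have hk := H.sixty_le'
  have ht := H.t_le
  have ht3 := H.three_le'
  rw [show (4 : ℝ) = ((4 : ℕ) : ℝ) by norm_num, ← Real.log_pow]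
  refine Real.log_le_log (by positivity) ?_
  have h1 : (t : ℝ) ^ 2 ≤ (k : ℝ) ^ 2 := pow_le_pow_left₀ (by linarith) (by linarith) 2
  have h2 : (8 : ℝ) * (k : ℝ) ^ 2 ≤ (k : ℝ) ^ 2 * (k : ℝ) ^ 2 := by
    gcongr
    nlinarith
  calc 8 * (t : ℝ) ^ 2 ≤ 8 * (k : ℝ) ^ 2 := by gcongr
    _ ≤ _ := h2.trans_eq (by ring)

lemma step_of_log_le_card (H : Admissible k h t η ρ w) {s : ℕ} {a Δ y j c : ℝ} (hΔ1 : Δ ≤ s)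
    (ha : (4 * Real.log k + cardConst η) * s ≤ a) (hy0 : 0 ≤ y)
    (hc : c ≤ cardConst η + (1 - saving η ρ) * y)
    (hj : j ≤ (s + t) * (Real.log (8 * t ^ 2) + c)) :
    j ≤ (a + (4 * Real.log k + cardConst η) * t) +
      (2 * (s + t) - (1 + saving η ρ) * (t + (1 - 1 / h) * Δ)) * y := by
  have h1 := H.log_eight_sq_le
  have hε := H.saving_pos
  have hh := H.fifty_le
  have hi : 0 ≤ 1 / (h : ℝ) := by positivity
  have hi1 : 1 / (h : ℝ) ≤ 1 := by rw [div_le_one (by linarith)]; linarith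
  have h2 : (1 - 1 / (h : ℝ)) * Δ ≤ s := by
    nlinarith [show (0 : ℝ) ≤ s by positivity]
  have h3 : (1 + saving η ρ) * (t + (1 - 1 / h) * Δ) * y ≤ (1 + saving η ρ) * (t + s) * y := by
    gcongr
  have h4 : ((s : ℝ) + t) * (Real.log (8 * t ^ 2) + c) ≤
      (s + t) * (4 * Real.log k + (cardConst η + (1 - saving η ρ) * y)) := by gcongr
  linarith

lemma step_of_log_beta (H : Admissible k h t η ρ w)
    {s : ℕ} {a Δ y j c b : ℝ} (hs : 1 ≤ s) (hsh : 2 * ((s : ℝ) + t) ≤ h * t)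
    (hΔ1 : Δ ≤ s)
    (ha : initConst k t η w + (4 * Real.log k + cardConst η) * s ≤ a) (hy0 : 0 ≤ y)
    (hy : y ≤ ρ / η)
    (hc : c ≤ cardConst η + (1 - saving η ρ) * y)
    (hb : b = y / h + (2 * Real.log k - 1) * (2 * y / ρ))
    (hj : (s + 2 * t) * j ≤ 2 * (s + t) * ((2 * s + t + 3) * Real.log 2 + t * c + (s + t) * b)) :
    j ≤ (a + (4 * Real.log k + cardConst η) * t) +
      (2 * (s + t) - (1 + saving η ρ) * (t + (1 - 1 / h) * Δ)) * y := by
  have hE := H.excess_mul_le hs hsh hy0 hy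
  have hζ := H.initConst_nonneg
  have hε := H.saving_pos
  have hh := H.fifty_le
  have ht3 := H.three_le'
  have hl := H.four_le_log
  have hs' : (1 : ℝ) ≤ s := by exact_mod_cast hs
  have hK := H.cardConst_pos
  have hi : 0 ≤ 1 / (h : ℝ) := by positivity
  have hi1 : 1 / (h : ℝ) ≤ 1 := by rw [div_le_one (by linarith)]; linarith
  have h2 : (1 - 1 / (h : ℝ)) * Δ ≤ s := by nlinarith
  have h3 : (1 + saving η ρ) * (t + (1 - 1 / h) * Δ) * y ≤ (1 + saving η ρ) * (t + s) * y := by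
    gcongr
  have hlog2 : Real.log 2 ≤ 1 := by linarith [Real.log_two_lt_d9]
  have hb' : 2 * b = (2 * (1 / h + 2 * (2 * Real.log k - 1) / ρ)) * y := by rw [hb]; ring
  suffices hsuff : (s + 2 * t) * j ≤ (s + 2 * t) * (initConst k t η w +
      (4 * Real.log k + cardConst η) * (s + t) + (1 - saving η ρ) * (s + t) * y) by
    have := le_of_mul_le_mul_left hsuff (by positivity)
    linarith
  have g1 : (2 * s + t + 3 : ℝ) * Real.log 2 ≤ 2 * (s + 2 * t) * 1 := by
    gcongr
    linarith
  have g2 : t * c ≤ t * (cardConst η + (1 - saving η ρ) * y) := by gcongr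
  have g3 : ((s : ℝ) + t) * (2 * (s + t) * (1 / h + 2 * (2 * Real.log k - 1) / ρ) * y -
      (1 - saving η ρ) * s * y) ≤ (s + t) * initConst k t η w := by
    gcongr
    linarith
  have g4 : 0 ≤ t * initConst k t η w := by positivity
  have g5 : 0 ≤ cardConst η * (s + t) * s := by positivity
  have g6 : (2 * ((s : ℝ) + t) * (2 * (s + 2 * t))) * 1 ≤
      (2 * ((s : ℝ) + t) * (2 * (s + 2 * t))) * Real.log k := by
    gcongr
    linarith
  calc _ ≤ _ := hj
    _ = 2 * (s + t) * ((2 * s + t + 3) * Real.log 2 + t * c) + (s + t) * (s + t) * (2 * b) := by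
        ring
    _ ≤ 2 * (s + t) * (2 * (s + 2 * t) * 1 + t * (cardConst η + (1 - saving η ρ) * y)) +
        (s + t) * (s + t) * (2 * b) := by gcongr
    _ ≤ _ := by rw [hb']; linarith

lemma step_of_log_sum (H : Admissible k h t η ρ w)
    {s : ℕ} {a Δ y j W X c lB : ℝ} (hs : 1 ≤ s) (hΔ1 : Δ ≤ s)
    (hc : c ≤ cardConst η + (1 - saving η ρ) * y)
    (hlB : lB = (4 * t + 4 * t / (h * η)) * Real.log k)
    (hX : X = lB + t * c + a + (2 * s - (1 + saving η ρ) * Δ) * y)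
    (hW : W ≤ X / (2 * s) + 1.12 + (1 + saving η ρ) * Δ / (2 * s) * (y / h + ρ))
    (hj : j ≤ 2 * s * (Real.log (4 / 3 * ((2 * s + t : ℝ) / (s + 1))) + W)) :
    j ≤ (a + (4 * Real.log k + cardConst η) * t + (4 * t * Real.log k / (η * h) + t) +
        ((1 + saving η ρ) * ρ + stepConst) * s) +
      (2 * (s + t) - (1 + saving η ρ) * (t + (1 - 1 / h) * Δ)) * y := by
  have hs' : (1 : ℝ) ≤ s := by exact_mod_cast hs
  have hε := H.saving_pos
  have hρ := H.forty_le
  have h1 : 2 * s * Real.log (4 / 3 * ((2 * s + t : ℝ) / (s + 1))) ≤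
      2 * s * Real.log (8 / 3) + t := by
    have h2 : 4 / 3 * ((2 * s + t : ℝ) / (s + 1)) ≤ 8 / 3 * Real.exp (t / (2 * s)) := by
      calc 4 / 3 * ((2 * s + t : ℝ) / (s + 1)) ≤ 4 / 3 * ((2 * s + t : ℝ) / s) := by
            gcongr
            linarith
        _ = 8 / 3 * (t / (2 * s) + 1) := by field_simp; ring
        _ ≤ _ := by gcongr; exact Real.add_one_le_exp _
    have h3 := Real.log_le_log (by positivity) h2
    rw [Real.log_mul (by norm_num) (Real.exp_pos _).ne', Real.log_exp] at h3
    calc _ ≤ 2 * s * (Real.log (8 / 3) + t / (2 * s)) := by gcongr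
      _ = _ := by field_simp
  have h4 : 2 * s * W ≤
      X + 2 * s * 1.12 + (1 + saving η ρ) * Δ * (y / h + ρ) := by
    calc 2 * s * W ≤ 2 * s * (X / (2 * s) + 1.12 +
          (1 + saving η ρ) * Δ / (2 * s) * (y / h + ρ)) := by gcongr
      _ = _ := by field_simp
  have h5 : (1 + saving η ρ) * Δ * ρ ≤ (1 + saving η ρ) * s * ρ := by gcongr
  have h6 : t * c ≤ t * (cardConst η + (1 - saving η ρ) * y) := by gcongr
  have h7 : lB = 4 * t * Real.log k + 4 * t * Real.log k / (η * h) := by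
    rw [hlB, mul_comm (h : ℝ)]; ring
  have h8 : stepConst * s = 2 * s * Real.log (8 / 3) + 2 * s * 1.12 := by
    unfold stepConst; ring
  have h9 : (1 + saving η ρ) * Δ * (y / h + ρ) =
      (1 + saving η ρ) * Δ * (1 / h * y) + (1 + saving η ρ) * Δ * ρ := by ring
  linarith

lemma log_vCount_step (H : Admissible k h t η ρ w)
    {s : ℕ} (hs : 1 ≤ s) (hsh : 2 * ((s : ℝ) + t) ≤ h * t) {a Δ : ℝ}
    (hΔ0 : 0 ≤ Δ) (hΔ1 : Δ ≤ s)
    (ha : initConst k t η w + (4 * Real.log k + cardConst η) * s ≤ a)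
    (IH : ∀ Q : ℝ, 1 ≤ Q → Real.log Q ≤ ρ / η →
      Real.log (vCount h t s (smoothSet Q (Real.exp ρ))) ≤
        a + (2 * s - (1 + saving η ρ) * Δ) * Real.log Q)
    {Q : ℝ} (hQ : 1 ≤ Q) (hQP : Real.log Q ≤ ρ / η) :
    Real.log (vCount h t (s + t) (smoothSet Q (Real.exp ρ))) ≤
      (a + (4 * Real.log k + cardConst η) * t + (4 * t * Real.log k / (η * h) + t) +
        ((1 + saving η ρ) * ρ + stepConst) * s) +
      (2 * (s + t) - (1 + saving η ρ) * (t + (1 - 1 / h) * Δ)) * Real.log Q := by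
  have hε := H.saving_pos
  have hη := H.eta_pos
  have hh := H.fifty_le
  have hl := H.four_le_log
  have hρ := H.forty_le
  have hk := H.sixty_le'
  have hy0 := Real.log_nonneg hQ
  have hc := H.log_card_le hQ
  have ht1 : 1 ≤ t := by linarith [H.three_le]
  have hextra : 0 ≤ (4 * t * Real.log k / (η * h) + t) +
      ((1 + saving η ρ) * ρ + stepConst) * s := by
    have : 0 ≤ Real.log (8 / 3) := Real.log_nonneg (by norm_num)
    unfold stepConst
    positivity
  set y := Real.log Q with hy
  have hζ := H.initConst_nonneg
  obtain hcase | hcase | ⟨hW, hcase⟩ := log_vCount_add_le (k := k) (h := h) (t := t) (s := s)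
    (Q := Q) (R := Real.exp ρ) (M := Real.exp (y / h))
    (β := Real.exp (y / h + (2 * Real.log k - 1) * (2 * y / ρ)))
    (B := Real.exp ((4 * t + 4 * t / (h * η)) * Real.log k)) ht1 hs H.add_eq H.h_pos hQ
    (Real.one_lt_exp_iff.2 (by linarith)) (Real.one_le_exp (by positivity))
    (by
      rw [← Real.exp_nat_mul, mul_div_cancel₀ _ (by linarith), hy, Real.exp_log (by linarith)])
    (le_trans (by nlinarith [pow_le_pow_left₀ (by norm_num) hk 4]) H.pow_five_le)
    (by
      rw [Real.exp_add, Real.log_exp]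
      gcongr
      exact H.exp_sq_le hy0)
    (Real.one_le_exp (by positivity))
    (fun q hq => H.pow_card_primeFactors_le hQP hq)
  · linarith [H.step_of_log_le_card (a := a) hΔ1 (by linarith) hy0 hc hcase]
  · rw [Real.log_exp] at hcase
    linarith [H.step_of_log_beta hs hsh hΔ1 ha hy0 hQP hc rfl hcase]
  · refine H.step_of_log_sum hs hΔ1 hc rfl rfl ?_ hcase
    have hs' : (0 : ℝ) < s := by exact_mod_cast hs
    have hc1 : (1 : ℝ) ≤ (smoothSet Q (Real.exp ρ)).card := by
      exact_mod_cast one_le_card_smoothSet hQ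
    have hlogM : Real.log (Real.exp (y / h) * Real.exp ρ) = y / h + ρ := by
      rw [← Real.exp_add, Real.log_exp]
    rw [← hlogM]
    refine log_sum_rpow_le hs (one_le_mul_of_one_le_of_one_le (Real.one_le_exp (by positivity))
      (Real.one_le_exp (by linarith))) (Real.exp_pos _) (by rw [Real.log_exp]; exact hρ)
      (by positivity) _ (by positivity) (fun q _ _ => by positivity) (fun q hq hpq => ?_) hW
    have hq1 : (1 : ℝ) ≤ q := by exact_mod_cast (mem_smoothSet.1 hq).1
    have hQq : 1 ≤ Q / q := by rw [le_div_iff₀ (by linarith)]; linarith [hpq.2]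
    have hlogq : Real.log (Q / q) = y - Real.log q := Real.log_div (by linarith) (by linarith)
    have hlq := Real.log_nonneg hq1
    have h1 := IH (Q / q) hQq (by linarith)
    have hv : (1 : ℝ) ≤ vCount h t s (smoothSet (Q / q) (Real.exp ρ)) := by
      exact_mod_cast one_le_vCount hQq
    rw [← Real.exp_log (show 0 < Real.exp ((4 * t + 4 * t / (h * η)) * Real.log k) *
      ((smoothSet Q (Real.exp ρ)).card : ℝ) ^ t *
        vCount h t s (smoothSet (Q / q) (Real.exp ρ)) by positivity)]
    refine Real.exp_le_exp.2 ?_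
    rw [Real.log_mul (by positivity) (by positivity), Real.log_mul (by positivity) (by positivity),
      Real.log_exp, Real.log_pow]
    rw [hlogq] at h1
    have h2 : 2 * (s : ℝ) * (-1 + (1 + saving η ρ) * Δ / (2 * s)) * Real.log q =
        -(2 * s - (1 + saving η ρ) * Δ) * Real.log q := by
      field_simp
      ring
    rw [h2]
    linarith

/-- The bound for `s₀ + n t` pairs of variables obtained after `n` steps of the recursion. -/
lemma log_vCount_iterate (H : Admissible k h t η ρ w)
    {s₀ : ℕ} (hs₀ : 1 ≤ s₀) (hs₀t : s₀ ≤ t) (n : ℕ)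
    (hn : 2 * ((s₀ : ℝ) + n * t) ≤ h * t) {Q : ℝ} (hQ : 1 ≤ Q) (hQP : Real.log Q ≤ ρ / η) :
    Real.log (vCount h t (s₀ + n * t) (smoothSet Q (Real.exp ρ))) ≤
      (initConst k t η w + (4 * Real.log k + cardConst η) * (s₀ + n * t) +
        n * (4 * t * Real.log k / (η * h) + t) +
        ((1 + saving η ρ) * ρ + stepConst) * (n * s₀ + t * (n * (n - 1) / 2))) +
      (2 * (s₀ + n * t) - (1 + saving η ρ) * (h * t - (h * t - s₀) * (1 - 1 / h) ^ n)) *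
        Real.log Q := by
  have hε := H.saving_pos
  have hη := H.eta_pos
  have hh := H.fifty_le
  have hl := H.four_le_log
  have hρ := H.forty_le
  have hs₀' : (1 : ℝ) ≤ s₀ := by exact_mod_cast hs₀
  have hs₀t' : (s₀ : ℝ) ≤ t := by exact_mod_cast hs₀t
  induction n generalizing Q with
  | zero =>
    have h1 := log_vCount_le_of_le (h := h) (k := k) (by linarith [H.three_le])
      (by exact_mod_cast H.t_le_k) H.add_eq H.h_pos hs₀t hQ (R := Real.exp ρ)
    have h2 : s₀ * Real.log (smoothSet Q (Real.exp ρ)).card ≤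
      s₀ * (cardConst η + (1 - saving η ρ) * Real.log Q) := by
      gcongr
      exact H.log_card_le hQ
    have h3 := H.initConst_nonneg
    simp only [zero_mul, add_zero]
    norm_num
    linarith
  | succ n ih =>
    push_cast at hn
    have hi0 : 0 ≤ 1 / (h : ℝ) := by positivity
    have hi1 : 1 / (h : ℝ) ≤ 1 := by rw [div_le_one (by linarith)]; linarith
    have hht : (t : ℝ) ≤ h * t := le_mul_of_one_le_left (by positivity) (by linarith)
    have hpow1 : (1 - 1 / (h : ℝ)) ^ n ≤ 1 := pow_le_one₀ (by linarith) (by linarith)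
    have hpow0 : 1 + n * (-1 / (h : ℝ)) ≤ (1 - 1 / (h : ℝ)) ^ n := by
      have := one_add_mul_le_pow (a := -1 / (h : ℝ)) (by rw [neg_div]; linarith) n
      rwa [show 1 + -1 / (h : ℝ) = 1 - 1 / h by ring] at this
    have hn' : 2 * ((s₀ : ℝ) + n * t) ≤ h * t := by linarith
    have hcast : ((s₀ + n * t : ℕ) : ℝ) = s₀ + n * t := by push_cast; ring
    have hstep := H.log_vCount_step (s := s₀ + n * t) (by omega) (by rw [hcast]; linarith)
      (a := initConst k t η w + (4 * Real.log k + cardConst η) * (s₀ + n * t) +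
        n * (4 * t * Real.log k / (η * h) + t) +
        ((1 + saving η ρ) * ρ + stepConst) * (n * s₀ + t * (n * (n - 1) / 2)))
      (Δ := h * t - (h * t - s₀) * (1 - 1 / h) ^ n)
      (by
        have : (h * t - s₀ : ℝ) * (1 - 1 / h) ^ n ≤ (h * t - s₀) * 1 := by
          gcongr
          linarith
        linarith)
      (by
        rw [hcast]
        have h1 : (h * t - s₀ : ℝ) * (1 + n * (-1 / (h : ℝ))) ≤
            (h * t - s₀) * (1 - 1 / h) ^ n := by
          gcongr
          linarith
        have h2 : (h * t - s₀ : ℝ) * (1 + n * (-1 / (h : ℝ))) =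
          h * t - s₀ - n * t + s₀ * n * (1 / h) := by field_simp; ring
        have h3 : 0 ≤ s₀ * n * (1 / (h : ℝ)) := by positivity
        linarith)
      (by
        rw [hcast]
        have h1 : 0 ≤ (n : ℝ) * (4 * t * Real.log k / (η * h) + t) := by positivity
        have h2 : 0 ≤ (n : ℝ) * (n - 1) := by
          rcases n.eq_zero_or_pos with rfl | hn0
          · simp
          · have : (1 : ℝ) ≤ n := by exact_mod_cast hn0
            exact mul_nonneg (by linarith) (by linarith)
        have h3 : 0 ≤ stepConst := by
          have : 0 ≤ Real.log (8 / 3) := Real.log_nonneg (by norm_num)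
          unfold stepConst
          positivity
        have h4 : 0 ≤ ((1 + saving η ρ) * ρ + stepConst) * (n * s₀ + t * (n * (n - 1) / 2)) := by
          positivity
        linarith)
      (fun Q' hQ' hQP' => by rw [hcast]; exact ih hn' hQ' hQP') hQ hQP
    rw [show s₀ + n * t + t = s₀ + (n + 1) * t by ring, hcast] at hstep
    refine hstep.trans (le_of_eq ?_)
    have h4 : (1 - 1 / (h : ℝ)) * (h * t - (h * t - s₀) * (1 - 1 / h) ^ n) =
        h * t - t - (h * t - s₀) * (1 - 1 / h) ^ (n + 1) := by
      rw [pow_succ]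
      field_simp
    rw [h4]
    push_cast
    ring

end Admissible

lemma exp_neg_le_quadratic {x : ℝ} (hx : 0 ≤ x) : Real.exp (-x) ≤ 1 - x + x ^ 2 / 2 := by
  have h1 := Real.quadratic_le_exp_of_nonneg hx
  have h2 : 0 < 1 - x + x ^ 2 / 2 := by nlinarith [sq_nonneg (x - 1)]
  rw [Real.exp_neg, inv_le_iff_one_le_mul₀ (Real.exp_pos x)]
  calc (1 : ℝ) ≤ (1 - x + x ^ 2 / 2) * (1 + x + x ^ 2 / 2) := by nlinarith [sq_nonneg (x ^ 2)]
    _ ≤ _ := by gcongr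

lemma one_add_mul_exp_neg_le {x : ℝ} (hx : 0 ≤ x) (hx2 : x ≤ 1 / 2) :
    (1 + x) * Real.exp (-x) ≤ 1 - x ^ 2 / 4 := by
  have h1 := Real.quadratic_le_exp_of_nonneg hx
  rw [Real.exp_neg, ← div_eq_mul_inv, div_le_iff₀ (Real.exp_pos x)]
  have h2 : 0 ≤ 1 - x ^ 2 / 4 := by nlinarith
  calc 1 + x ≤ (1 - x ^ 2 / 4) * (1 + x + x ^ 2 / 2) := by
        have : 0 ≤ x ^ 2 * (1 / 4 - x / 4 - x ^ 2 / 8) :=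
          mul_nonneg (sq_nonneg x) (by nlinarith)
        nlinarith
    _ ≤ _ := by gcongr

lemma final_bracket_nonneg {u x r h L c K E : ℝ} (hx0 : 0 ≤ x) (hx : x ≤ 1 / 2) (hh : 0 < h)
    (hr : r = x * h) (hu : 2 * h ≤ u) (hu2 : 120 ≤ u) (hL : 2 ≤ L) (hc : c ≤ 4.3)
    (hK : K ≤ 0.305 * u) (hE : E = Real.exp (-x)) :
    K * r + r + (1 + L + c) * (r ^ 2 / 2) - (1 + L) * u * (h * (1 - E)) ≤
      r ^ 2 - r * ((u + h) * E - h) * L := by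
  have e1 : E ≤ 1 - x + x ^ 2 / 2 := hE ▸ exp_neg_le_quadratic hx0
  have e2 : (1 + x) * E ≤ 1 - x ^ 2 / 4 := hE ▸ one_add_mul_exp_neg_le hx0 hx
  have e3 : x * (1 - x / 2) ≤ 1 - E := by linarith
  have e3' : x * (1 / 2) ≤ x * (1 - x / 2) := by gcongr; linarith
  have hxh : 0 ≤ x * h := by positivity
  have hu0 : 0 < u := by linarith
  have b1 : 0 ≤ u * h * ((1 - E) - x * E - x ^ 2 / 4) := by
    apply mul_nonneg (by positivity); linarith
  have b2 : 0 ≤ x * h ^ 2 * ((1 - E) - x * (3 / 4)) := by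
    apply mul_nonneg (by positivity)
    have : x * (3 / 4) ≤ x * (1 - x / 2) := by gcongr; linarith
    linarith
  have b3 : 0 ≤ u * h * ((1 - E) - x * (1 - x / 2)) := by
    apply mul_nonneg (by positivity); linarith
  have b4 : 0 ≤ (L - 2) * (u * h * (x ^ 2 / 4) + x ^ 2 * h ^ 2 / 4) := by
    apply mul_nonneg (by linarith); positivity
  have b5 : 0 ≤ L * (u * h * ((1 - E) - x * E - x ^ 2 / 4)) := mul_nonneg (by linarith) b1
  have b6 : 0 ≤ L * (x * h ^ 2 * ((1 - E) - x * (3 / 4))) := mul_nonneg (by linarith) b2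
  have b7 : 0 ≤ x * h * (0.695 * u - 1 - 1.15 * (x * h)) := by
    apply mul_nonneg hxh
    have : x * h ≤ 1 / 2 * h := by gcongr
    linarith
  have b8 : K * (x * h) ≤ 0.305 * u * (x * h) := by gcongr
  have b9 : c * (x ^ 2 * h ^ 2) ≤ 4.3 * (x ^ 2 * h ^ 2) := by gcongr
  subst hr
  linarith

lemma stepConst_le : stepConst ≤ 4.3 := by
  have : Real.log (8 / 3) ≤ 1 := by
    rw [Real.log_le_iff_le_exp (by norm_num)]
    linarith [Real.exp_one_gt_d9]
  unfold stepConst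
  linarith

lemma stepConst_nonneg : 0 ≤ stepConst := by
  have : 0 ≤ Real.log (8 / 3) := Real.log_nonneg (by norm_num)
  unfold stepConst
  positivity

namespace Admissible

variable {k h t : ℕ} {η ρ w : ℝ}

lemma two_le_log_inv (H : Admissible k h t η ρ w) : 2 ≤ Real.log (1 / (10 * η)) := by
  rw [Real.le_log_iff_exp_le (by linarith [H.twelve_le])]
  refine le_trans ?_ H.twelve_le
  rw [show (2 : ℝ) = 1 + 1 by norm_num, Real.exp_add]
  nlinarith [Real.exp_one_lt_d9, Real.exp_one_gt_d9]

lemma two_mul_k_le (H : Admissible k h t η ρ w) : 2 * (k : ℝ) ≤ 1 / η := by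
  have h1 := H.eta_le
  have h2 := H.eta_pos
  have h3 := H.sixty_le'
  rw [le_div_iff₀ (by linarith)] at h1 ⊢
  linarith

lemma h_le_k (H : Admissible k h t η ρ w) : (h : ℝ) ≤ k := by
  have h1 : (h : ℝ) + t = k + 1 := by exact_mod_cast H.add_eq
  linarith [H.three_le']

lemma log_vCount_le (H : Admissible k h t η ρ w)
    {s : ℕ} (hs : 1 ≤ s) (hsh : 2 * (s : ℝ) ≤ h * t) {P : ℝ} (hP : 1 ≤ P)
    (hPρ : ρ = η * Real.log P) :
    Real.log (vCount h t s (smoothSet P (Real.exp ρ))) ≤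
      (s : ℝ) ^ 2 / t + 2.625 * w * k * t * Real.log k / η -
        s * ((1 / η + h) * (1 - 1 / (h : ℝ)) ^ ((s : ℝ) / t) - h) * Real.log (1 / (10 * η)) +
      (2 * s - h * t + η * (s : ℝ) ^ 2 / (2 * t) + h * t * Real.exp (-s / (h * t))) *
        Real.log P := by
  have hη := H.eta_pos
  have hh := H.fifty_le
  have hl := H.four_le_log
  have hρ := H.forty_le
  have ht3 := H.three_le'
  have hk := H.sixty_le'
  have hL := H.two_le_log_inv
  have htpos : 0 < t := by linarith [H.three_le]
  obtain ⟨n, s₀, hs₀, hs₀t, rfl⟩ : ∃ n s₀ : ℕ, 1 ≤ s₀ ∧ s₀ ≤ t ∧ s = s₀ + n * t := by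
    refine ⟨(s - 1) / t, (s - 1) % t + 1, by omega, Nat.mod_lt _ htpos, ?_⟩
    have := Nat.mod_add_div' (s - 1) t
    omega
  have hs₀' : (1 : ℝ) ≤ s₀ := by exact_mod_cast hs₀
  have hs₀t' : (s₀ : ℝ) ≤ t := by exact_mod_cast hs₀t
  have hPy : Real.log P = ρ / η := by rw [hPρ, mul_div_cancel_left₀ _ hη.ne']
  push_cast at hsh ⊢
  have hiter := H.log_vCount_iterate hs₀ hs₀t n hsh hP hPy.le
  refine hiter.trans ?_
  have hY0 : 0 ≤ Real.log P := Real.log_nonneg hP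
  have hεY : saving η ρ * Real.log P = (1 + Real.log (1 / (10 * η))) * (1 / η) := by
    rw [hPy, ← H.saving_mul]; ring
  have hερ := H.saving_mul
  set L := Real.log (1 / (10 * η))
  set Y := Real.log P
  set u : ℝ := 1 / η with hu
  set S : ℝ := (s₀ : ℝ) + n * t with hS
  have hS0 : 0 < S := by positivity
  set x : ℝ := S / (h * t) with hx
  have hx0 : 0 ≤ x := by positivity
  have hx2 : x ≤ 1 / 2 := by
    rw [hx, div_le_iff₀ (by positivity)]; linarith
  set E := Real.exp (-x) with hE
  set G : ℝ := (h * t - s₀) * (1 - 1 / (h : ℝ)) ^ n with hG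
  set N : ℝ := n * s₀ + t * (n * (n - 1) / 2) with hN
  have hi1 : 0 ≤ 1 - 1 / (h : ℝ) := by
    rw [sub_nonneg, div_le_one (by linarith)]; linarith
  have hq1 : 1 - 1 / (h : ℝ) ≤ Real.exp (-(1 / h)) := Real.one_sub_le_exp_neg _
  have hGle : G ≤ h * t * E := by
    have h1 : h * t - s₀ ≤ (h * t : ℝ) * Real.exp (-(s₀ / (h * t))) := by
      calc (h * t - s₀ : ℝ) = h * t * (1 - s₀ / (h * t)) := by field_simp
        _ ≤ _ := by gcongr; exact Real.one_sub_le_exp_neg _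
    have h2 : (1 - 1 / (h : ℝ)) ^ n ≤ Real.exp (-(1 / h)) ^ n := by gcongr
    calc G ≤ h * t * Real.exp (-(s₀ / (h * t))) * Real.exp (-(1 / h)) ^ n := by
          rw [hG]; gcongr
      _ = _ := by
          rw [← Real.exp_nat_mul, mul_assoc, ← Real.exp_add, hE, hx, hS]
          congr 2
          field_simp
          ring
  have hNle : N ≤ S ^ 2 / (2 * t) := by
    have : S ^ 2 / (2 * t) = N + (s₀ ^ 2 / (2 * t) + t * n / 2) := by
      rw [hS, hN]; field_simp; ring
    rw [this]
    linarith [show (0 : ℝ) ≤ s₀ ^ 2 / (2 * t) + t * n / 2 by positivity]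
  have hqr : (1 - 1 / (h : ℝ)) ^ (S / t) ≤ E := by
    calc _ ≤ Real.exp (-(1 / h)) ^ (S / t) := Real.rpow_le_rpow hi1 hq1 (by positivity)
      _ = _ := by rw [← Real.exp_mul, hE, hx]; congr 1; field_simp
  have hu2 : 2 * (k : ℝ) ≤ u := H.two_mul_k_le
  have hhk := H.h_le_k
  have hK : cardConst η ≤ 0.305 * u := by
    have h1 : cardConst η = 1.12 * Real.exp 1 / 10 * u := by
      unfold cardConst; rw [hu]; ring
    rw [h1]
    gcongr
    linarith [Real.exp_one_lt_d9]
  have hfin := final_bracket_nonneg (u := u) (x := x) (r := S / t) (h := h) (L := L)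
    (c := stepConst) (K := cardConst η) (E := E) hx0 hx2 (by linarith)
    (by rw [hx]; field_simp) (by linarith) (by linarith) hL stepConst_le hK hE
  have hfin' : cardConst η * S + S + (1 + L + stepConst) * (S ^ 2 / (2 * t)) -
      (1 + L) * u * (h * t * (1 - E)) ≤ S ^ 2 / t - S * ((u + h) * E - h) * L := by
    have h1 := mul_le_mul_of_nonneg_left hfin (show (0 : ℝ) ≤ t by linarith)
    have h2 : t * (S / t) = S := by field_simp
    have h3 : t * (S / t) ^ 2 = S ^ 2 / t := by field_simp
    have h4 : S ^ 2 / (2 * t) = S ^ 2 / t / 2 := by field_simp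
    rw [h4, ← h3]
    nth_rewrite 1 2 5 [← h2]
    linarith
  have hstep0 := stepConst_nonneg
  have hnt : (n : ℝ) * t ≤ S := by linarith
  have hn2 : 2 * (n : ℝ) ≤ h := by
    have : 2 * (n : ℝ) * t ≤ h * t := by linarith
    exact le_of_mul_le_mul_right this (by linarith)
  have g1 : G * Y ≤ h * t * E * Y := by gcongr
  have g2 : (1 + L) * u * G ≤ (1 + L) * u * (h * t * E) := by gcongr
  have g3 : (ρ + 1 + L + stepConst) * N ≤ (ρ + 1 + L + stepConst) * (S ^ 2 / (2 * t)) := by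
    gcongr
  have g4 : S * (u + h) * L * (1 - 1 / (h : ℝ)) ^ (S / t) ≤ S * (u + h) * L * E := by gcongr
  have g5 : 4 * Real.log k * S ≤ u * t * Real.log k := by
    have : 4 * S ≤ u * t := by
      have : (2 : ℝ) * h * t ≤ u * t := by gcongr; linarith
      linarith
    calc _ = Real.log k * (4 * S) := by ring
      _ ≤ Real.log k * (u * t) := by gcongr
      _ = _ := by ring
  have g6 : n * (4 * t * Real.log k / (η * h)) ≤ 2 * (u * t * Real.log k) := by
    calc n * (4 * t * Real.log k / (η * h)) = 2 * n * (2 * t * Real.log k / (η * h)) := by ring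
      _ ≤ h * (2 * t * Real.log k / (η * h)) := by gcongr
      _ = _ := by rw [hu]; field_simp
  have g7 : initConst k t η w =
      2.625 * w * k * t * Real.log k / η - 6 * (u * t * Real.log k) := by
    unfold initConst; rw [hu]; ring
  have g8 : 0 ≤ u * t * Real.log k := by positivity
  have g9 : η * S ^ 2 / (2 * t) * Y = ρ * (S ^ 2 / (2 * t)) := by rw [hPρ]; ring
  have g10 : -S / (h * t) = -x := by rw [hx]; ring
  have g11 : (1 + saving η ρ) * ρ = ρ + 1 + L := by rw [add_mul, hερ]; ring
  have g12 : (2 * S - (1 + saving η ρ) * (h * t - G)) * Y =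
      2 * S * Y - (h * t - G) * Y - (1 + L) * u * (h * t - G) := by
    rw [← hεY]; ring
  rw [g10, g12, g11]
  linarith

end Admissible

lemma JvIncomplete_eq_vCount {k h t : ℕ} (hhk : h + t = k + 1) (s : ℕ) (P R : ℝ) :
    JvIncomplete s k h (CPR P R) = vCount h t s (smoothSet P R) := by
  classical
  unfold JvIncomplete vCount
  rw [Nat.subtype_card]
  rintro ⟨x, y⟩
  have hmem : ∀ n, n ∈ smoothSet P R ↔ n ∈ CPR P R := fun n => by rw [mem_smoothSet]; rfl
  simp only [mem_filter, mem_product, Fintype.mem_piFinset, hmem, sum_sub_distrib, sub_eq_zero,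
    ← forall_and]
  refine and_congr_right fun _ => ⟨fun H j hj hjk => ?_, fun H j => ?_⟩
  · have := H ⟨j - h, by omega⟩
    simp only [Nat.add_sub_cancel' hj] at this
    exact_mod_cast this
  · exact_mod_cast H (h + j) (by omega) (by omega)

end IncompleteVinogradov

/-- **Theorem 4, Ford**: explicit bound for the incomplete Vinogradov system counted over
integers composed of primes in `(√R, R]`, `R = P^η`. -/
theorem incomplete_system_bound (k h : ℕ) (hk : 60 ≤ k) (hh₁ : (0.9 : ℝ) * k ≤ (h : ℝ))
    (hh₂ : h + 2 ≤ k) (s : ℕ) (hs₁ : 2 * (k - h + 1) ≤ s) (hs₂ : s ≤ h / 2 * (k - h + 1))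
    (P D η : ℝ) (hD : 10 ≤ D) (hP : Real.exp (D * (k : ℝ) ^ 2) ≤ P)
    (hη₁ : 2 / (k : ℝ) ^ 3 < η) (hη₂ : η ≤ 1 / (2 * (k : ℝ)))
    (hx₁ : 18 / (k : ℝ) ≤ 4 * Real.log k / (D * (k : ℝ) ^ 2 * η))
    (hx₂ : 4 * Real.log k / (D * (k : ℝ) ^ 2 * η) ≤ 0.4) :
    (JvIncomplete s k h (CPR P (P ^ η)) : ℝ) ≤
      Real.exp ((s : ℝ) ^ 2 / (k - h + 1 : ℕ)
            + 10.5 * (k - h + 1 : ℕ) * (Real.log k) ^ 2 / (D * k * η ^ 2)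
            - s * ((1 / η + h) * (1 - 1 / (h : ℝ)) ^ ((s : ℝ) / (k - h + 1 : ℕ)) - h)
                * Real.log (1 / (10 * η))) *
        P ^ (2 * (s : ℝ) - (k - h + 1 : ℕ) / 2 * ((h : ℝ) + k)
            + (k - h + 1 : ℕ) * ((k - h + 1 : ℕ) - 1) / 2
            + η * (s : ℝ) ^ 2 / (2 * (k - h + 1 : ℕ))
            + (h : ℝ) * (k - h + 1 : ℕ) * Real.exp (-(s : ℝ) / (h * (k - h + 1 : ℕ)))) := by
  obtain ⟨t, ht⟩ : ∃ t, t = k - h + 1 := ⟨_, rfl⟩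
  rw [← ht] at hs₁ hs₂ ⊢
  have hk' : (60 : ℝ) ≤ k := by exact_mod_cast hk
  have hhk : h + t = k + 1 := by omega
  have hhk' : (h : ℝ) + t = k + 1 := by exact_mod_cast hhk
  have hη : 0 < η := lt_trans (by positivity) hη₁
  have hP1 : 1 ≤ P := (Real.one_le_exp (by positivity)).trans hP
  have hY : D * (k : ℝ) ^ 2 ≤ Real.log P := by
    rwa [Real.le_log_iff_exp_le (by linarith)]
  have hl : 0 < Real.log k := Real.log_pos (by linarith)
  have H : IncompleteVinogradov.Admissible k h t η (η * Real.log P)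
      (4 * Real.log k / (D * (k : ℝ) ^ 2 * η)) := by
    refine ⟨hk, hhk, by omega, hh₁, hη₁, hη₂, hx₁, hx₂, ?_⟩
    calc 4 * Real.log k = 4 * Real.log k / (D * (k : ℝ) ^ 2 * η) * (η * (D * (k : ℝ) ^ 2)) := by
          field_simp
      _ ≤ _ := by gcongr
  have hs2 : 2 * (s : ℝ) ≤ h * t := by
    have : 2 * s ≤ h * t := by
      calc 2 * s ≤ 2 * (h / 2 * t) := by gcongr
        _ = (2 * (h / 2)) * t := by ring
        _ ≤ h * t := by gcongr; omega
    exact_mod_cast this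
  have hmain := H.log_vCount_le (s := s) (by omega) hs2 hP1 rfl
  have hPη : P ^ η = Real.exp (η * Real.log P) := by
    rw [Real.rpow_def_of_pos (by linarith), mul_comm]
  rw [IncompleteVinogradov.JvIncomplete_eq_vCount hhk, hPη,
    Real.rpow_def_of_pos (by linarith : 0 < P), ← Real.exp_add]
  have hv : (1 : ℝ) ≤ IncompleteVinogradov.vCount h t s
      (IncompleteVinogradov.smoothSet P (Real.exp (η * Real.log P))) := by
    exact_mod_cast IncompleteVinogradov.one_le_vCount hP1
  refine (Real.log_le_iff_le_exp (by linarith)).1 (hmain.trans_eq ?_)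
  have e1 : 2.625 * (4 * Real.log k / (D * (k : ℝ) ^ 2 * η)) * k * t * Real.log k / η =
      10.5 * t * Real.log k ^ 2 / (D * k * η ^ 2) := by
    have : D ≠ 0 := by linarith
    field_simp
    ring
  have e2 : (t : ℝ) / 2 * (h + k) - t * (t - 1) / 2 = h * t := by
    rw [show (k : ℝ) = h + t - 1 by linarith]; ring
  rw [e1, ← e2]
  ring
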